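/- Let d ∈ ℕ, α ∈ (0, min(2,d)) and δ ∈ (0, d-α). For every T > 0 there is a constant c > 0 such that for all t ∈ (0,T] and x, y ∈ ℝ^d \ {0}, p̃⁰_{V⁰_δ}(t,x,y) ≤ p̃⁰_{V_δ}(t,x,y) ≤ c p̃⁰_{V⁰_δ}(t,x,y), where p̃⁰_{V⁰_δ} and p̃⁰_{V_δ} are the Schrödinger perturbations of p⁰ by V⁰_δ and by V_δ respectively. -/

import Mathlib

open MeasureTheory Real Set Filter RealInnerProductSpace

noncomputable section

/-- Euclidean space `ℝ^d`. -/
abbrev Ed (d : ℕ) := EuclideanSpace ℝ (Fin d)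

/-- Modified Bessel function of the second kind `K_ν(r)`. -/
def besselK (ν r : ℝ) : ℝ :=
  (1 / 2) * (r / 2) ^ ν * ∫ u in Ioi (0 : ℝ), u ^ (-ν - 1) * Real.exp (-u - r ^ 2 / (4 * u))

/-- Relativistic `α`-stable heat kernel with mass parameter `m`:
`p^m(t,x,y) = (2π)^{-d} ∫ exp(-i⟨y-x,z⟩) exp(-t(|z|²+m^{2/α})^{α/2}) dz`
(the integral is real, and equals the cosine integral below). -/
def relKernel (d : ℕ) (α m t : ℝ) (x y : Ed d) : ℝ :=
  (2 * π) ^ (-(d : ℝ)) *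
    ∫ z : Ed d, Real.cos ⟪y - x, z⟫ * Real.exp (-t * (‖z‖ ^ 2 + m ^ (2 / α)) ^ (α / 2))

/-- Fractional (`α`-stable) heat kernel `p⁰(t,x,y)`. -/
def fracKernel (d : ℕ) (α t : ℝ) (x y : Ed d) : ℝ :=
  (2 * π) ^ (-(d : ℝ)) * ∫ z : Ed d, Real.cos ⟪y - x, z⟫ * Real.exp (-t * ‖z‖ ^ α)

/-- The summands of the perturbation series. -/
def pertN (d : ℕ) (k : ℝ → Ed d → Ed d → ℝ) (q : Ed d → ℝ) : ℕ → ℝ → Ed d → Ed d → ℝ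
  | 0 => k
  | n + 1 => fun t x y =>
      ∫ s in Ioo (0 : ℝ) t, ∫ z : Ed d, pertN d k q n s x z * q z * k (t - s) z y

/-- Schrödinger perturbation of a transition density `k` by a potential `q`. -/
def pert (d : ℕ) (k : ℝ → Ed d → Ed d → ℝ) (q : Ed d → ℝ) (t : ℝ) (x y : Ed d) : ℝ :=
  ∑' n : ℕ, pertN d k q n t x y

/-- Radial profile of the potential `V_β`. -/
def VProf (d : ℕ) (α β r : ℝ) : ℝ :=
  2 ^ (α / 2) * Real.Gamma (((d : ℝ) - β) / 2) / Real.Gamma (((d : ℝ) - β - α) / 2) *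
    (besselK ((β + α) / 2) r / besselK (β / 2) r) * r ^ (-(α / 2))

/-- The potential `V_β(x)`. -/
def Vbeta (d : ℕ) (α β : ℝ) (x : Ed d) : ℝ := VProf d α β ‖x‖

/-- The Hardy constant `κ_β` for the fractional Laplacian. -/
def kappa (d : ℕ) (α β : ℝ) : ℝ :=
  2 ^ α * Real.Gamma ((β + α) / 2) * Real.Gamma (((d : ℝ) - β) / 2) /
    (Real.Gamma (β / 2) * Real.Gamma (((d : ℝ) - β - α) / 2))

/-- `h^m_β(x) = ∫_0^∞ t^{(d-α-β)/α} p^m(t,x,0) dt`. -/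
def hBetaM (d : ℕ) (α m β : ℝ) (x : Ed d) : ℝ :=
  ∫ t in Ioi (0 : ℝ), t ^ (((d : ℝ) - α - β) / α) * relKernel d α m t x 0

/-- `h_β = h^1_β`. -/
def hBeta (d : ℕ) (α β : ℝ) (x : Ed d) : ℝ := hBetaM d α 1 β x

/-- `V^m_β(x) = ((d-α-β)/α) h^m_{β+α}(x)/h^m_β(x)`. -/
def VbetaM (d : ℕ) (α m β : ℝ) (x : Ed d) : ℝ :=
  (((d : ℝ) - α - β) / α) * hBetaM d α m (β + α) x / hBetaM d α m β x

/-- The function `H⁰(t,x)`. -/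
def Hzero (d : ℕ) (α δ t : ℝ) (x : Ed d) : ℝ :=
  if δ ≤ ((d : ℝ) - α) / 2 then 1 + t ^ (δ / α) * ‖x‖ ^ (-δ)
  else 1 + t ^ (((d : ℝ) - α - δ) / α) * ‖x‖ ^ (-((d : ℝ) - α - δ))

/-- Density of the Lévy measure of the relativistic `α`-stable operator (mass 1). -/
def levyNu (d : ℕ) (α : ℝ) (x : Ed d) : ℝ :=
  2 ^ ((α - (d : ℝ)) / 2 + 1) * π ^ (-(d : ℝ) / 2) * |Real.Gamma (-α / 2)|⁻¹ *
    besselK (((d : ℝ) + α) / 2) ‖x‖ / ‖x‖ ^ (((d : ℝ) + α) / 2)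


open scoped ENNReal NNReal Topology
set_option linter.unusedSectionVars false


section Abstract
variable {X : Type*} [MeasurableSpace X]

/-- triangle swap -/
lemma tri_swap (F : ℝ → ℝ → ℝ≥0∞) (hF : Measurable (Function.uncurry F)) (T : ℝ) :
    ∫⁻ t in Ioo (0:ℝ) T, ∫⁻ s in Ioo (0:ℝ) t, F s (t - s)
      = ∫⁻ s in Ioo (0:ℝ) T, ∫⁻ v in Ioo (0:ℝ) (T - s), F s v := by
  have hm : MeasurableSet {w : ℝ × ℝ | 0 < w.2 ∧ w.2 < w.1 ∧ w.1 < T} := by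
    apply MeasurableSet.inter
    · exact measurableSet_lt measurable_const measurable_snd
    apply MeasurableSet.inter
    · exact measurableSet_lt measurable_snd measurable_fst
    · exact measurableSet_lt measurable_fst measurable_const
  set G : ℝ → ℝ → ℝ≥0∞ := fun t s =>
    indicator {w : ℝ × ℝ | 0 < w.2 ∧ w.2 < w.1 ∧ w.1 < T} (fun w => F w.2 (w.1 - w.2)) (t, s) with hG
  have hGm : Measurable (Function.uncurry G) := by
    have : Function.uncurry G = indicator {w : ℝ × ℝ | 0 < w.2 ∧ w.2 < w.1 ∧ w.1 < T}
        (fun w => F w.2 (w.1 - w.2)) := by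
      ext w; rfl
    rw [this]
    apply Measurable.indicator _ hm
    exact hF.comp (measurable_snd.prodMk (measurable_fst.sub measurable_snd))
  have h1 : ∫⁻ t in Ioo (0:ℝ) T, ∫⁻ s in Ioo (0:ℝ) t, F s (t - s) = ∫⁻ t, ∫⁻ s, G t s := by
    rw [← lintegral_indicator measurableSet_Ioo]
    congr 1; ext t
    by_cases ht : t ∈ Ioo 0 T
    · rw [indicator_of_mem ht, ← lintegral_indicator measurableSet_Ioo]
      congr 1; ext s
      by_cases hs : s ∈ Ioo 0 t
      · rw [indicator_of_mem hs, hG]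
        simp only
        rw [indicator_of_mem]
        exact ⟨hs.1, hs.2, ht.2⟩
      · rw [indicator_of_notMem hs, hG]
        simp only
        rw [indicator_of_notMem]
        rintro ⟨h1, h2, h3⟩; exact hs ⟨h1, h2⟩
    · rw [indicator_of_notMem ht]
      symm
      rw [lintegral_eq_zero_iff' (by exact (hGm.of_uncurry_left).aemeasurable)]
      apply ae_of_all
      intro s
      simp only [hG, Pi.zero_apply]
      rw [indicator_of_notMem]
      rintro ⟨h1, h2, h3⟩; exact ht ⟨h1.trans h2, h3⟩
  have h2 : ∫⁻ s in Ioo (0:ℝ) T, ∫⁻ v in Ioo (0:ℝ) (T - s), F s v = ∫⁻ s, ∫⁻ t, G t s := by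
    rw [← lintegral_indicator measurableSet_Ioo]
    congr 1; ext s
    rw [← lintegral_add_right_eq_self (fun t => G t s) s]
    by_cases hs : s ∈ Ioo 0 T
    · rw [indicator_of_mem hs, ← lintegral_indicator measurableSet_Ioo]
      congr 1; ext v
      by_cases hv : v ∈ Ioo 0 (T - s)
      · rw [indicator_of_mem hv, hG]
        simp only
        rw [indicator_of_mem]
        · simp
        exact ⟨hs.1, by simpa using hv.1, by have := hv.2; simp only; linarith⟩
      · rw [indicator_of_notMem hv, hG]
        simp only
        rw [indicator_of_notMem]
        rintro ⟨h1, h2, h3⟩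
        simp only at h1 h2 h3
        exact hv ⟨by linarith, by linarith⟩
    · rw [indicator_of_notMem hs]
      symm
      have : (fun t => G (t + s) s) = fun _ => 0 := by
        ext t
        simp only [hG]
        rw [indicator_of_notMem]
        rintro ⟨h1, h2, h3⟩; exact hs ⟨h1, h2.trans h3⟩
      rw [this]; simp
  rw [h1, h2, lintegral_lintegral_swap hGm.aemeasurable]

lemma measurable_tint {Y : Type*} [MeasurableSpace Y] (F : Y → ℝ → ℝ≥0∞)
    (hF : Measurable (Function.uncurry F)) (t : Y → ℝ) (ht : Measurable t) :
    Measurable (fun y => ∫⁻ s in Ioo (0:ℝ) (t y), F y s) := by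
  have hm : MeasurableSet {w : Y × ℝ | 0 < w.2 ∧ w.2 < t w.1} := by
    apply MeasurableSet.inter
    · exact measurableSet_lt measurable_const measurable_snd
    · exact measurableSet_lt measurable_snd (ht.comp measurable_fst)
  have : (fun y => ∫⁻ s in Ioo (0:ℝ) (t y), F y s)
      = fun y => ∫⁻ s, indicator {w : Y × ℝ | 0 < w.2 ∧ w.2 < t w.1} (Function.uncurry F) (y, s) := by
    ext y
    rw [← lintegral_indicator measurableSet_Ioo]
    rfl
  rw [this]
  exact (hF.indicator hm).lintegral_prod_right'

variable (μ : Measure X)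

/-- extended-nonnegative version of the terms of the perturbation series -/
def PN (p : ℝ → X → X → ℝ≥0∞) (q : X → ℝ≥0∞) : ℕ → ℝ → X → X → ℝ≥0∞
  | 0 => p
  | n + 1 => fun t x y => ∫⁻ s in Ioo (0 : ℝ) t, ∫⁻ z, PN p q n s x z * q z * p (t - s) z y ∂μ

/-- extended-nonnegative version of the perturbation series -/
def PT (p : ℝ → X → X → ℝ≥0∞) (q : X → ℝ≥0∞) (t : ℝ) (x y : X) : ℝ≥0∞ :=
  ∑' n, PN μ p q n t x y

/-- joint measurability -/
def JM (p : ℝ → X → X → ℝ≥0∞) : Prop := Measurable (fun w : ℝ × X × X => p w.1 w.2.1 w.2.2)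

lemma JM.comp {p : ℝ → X → X → ℝ≥0∞} (hp : JM p) {Y : Type*} [MeasurableSpace Y]
    {f : Y → ℝ} {g h : Y → X} (hf : Measurable f) (hg : Measurable g) (hh : Measurable h) :
    Measurable (fun y => p (f y) (g y) (h y)) :=
  Measurable.comp hp (hf.prodMk (hg.prodMk hh))

variable [SFinite μ]
variable {p : ℝ → X → X → ℝ≥0∞} {q : X → ℝ≥0∞}

lemma PN_JM (hp : JM p) (hq : Measurable q) (n : ℕ) : JM (PN μ p q n) := by
  induction n with
  | zero => exact hp
  | succ n ih =>
    unfold JM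
    simp only [PN]
    apply measurable_tint (fun (w : ℝ × X × X) s =>
      ∫⁻ z, PN μ p q n s w.2.1 z * q z * p (w.1 - s) z w.2.2 ∂μ) _ (fun w => w.1) measurable_fst
    unfold Function.uncurry
    apply Measurable.lintegral_prod_right' (f := fun (w : ((ℝ × X × X) × ℝ) × X) =>
       PN μ p q n w.1.2 w.1.1.2.1 w.2 * q w.2 * p (w.1.1.1 - w.1.2) w.2 w.1.1.2.2)
    refine ((ih.comp ?_ ?_ ?_).mul (hq.comp ?_)).mul (hp.comp ?_ ?_ ?_) <;> fun_prop

lemma PT_JM (hp : JM p) (hq : Measurable q) : JM (PT μ p q) := by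
  unfold JM PT
  exact Measurable.tsum (fun n => PN_JM μ hp hq n)

end Abstract



section Abstract2
variable {X : Type*} [MeasurableSpace X]
variable (μ : Measure X)

/-- Chapman-Kolmogorov -/
def CK (p : ℝ → X → X → ℝ≥0∞) : Prop :=
  ∀ s t, 0 < s → 0 < t → ∀ x y, ∫⁻ z, p s x z * p t z y ∂μ = p (s + t) x y

variable {p : ℝ → X → X → ℝ≥0∞} {q : X → ℝ≥0∞}

lemma PN_succ (n : ℕ) (t : ℝ) (x y : X) : PN μ p q (n + 1) t x y
    = ∫⁻ s in Ioo (0 : ℝ) t, ∫⁻ z, PN μ p q n s x z * q z * p (t - s) z y ∂μ := rfl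

variable [SFinite μ]

lemma PN_CK (hp : JM p) (hq : Measurable q) (hck : CK μ p) (n : ℕ) : ∀ s t, 0 < s → 0 < t → ∀ x y,
    PN μ p q n (s + t) x y
      = ∑ ij ∈ Finset.HasAntidiagonal.antidiagonal n, ∫⁻ z, PN μ p q ij.1 s x z * PN μ p q ij.2 t z y ∂μ := by
  induction n with
  | zero =>
    intro s t hs ht x y
    simp [PN, hck s t hs ht]
  | succ n ih =>
    intro s t hs ht x y
    have hJ := fun n => PN_JM μ hp hq n
    rw [Finset.Nat.sum_antidiagonal_succ']
    have hsplit : Ioo (0:ℝ) (s + t) = Ioc 0 s ∪ Ioo s (s + t) := by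
      rw [Ioc_union_Ioo_eq_Ioo hs.le (by linarith)]
    rw [PN_succ]
    simp only
    rw [hsplit, lintegral_union measurableSet_Ioo (by
      rw [Set.disjoint_left]; intro a ha hb; exact absurd ha.2 (not_le.mpr hb.1))]
    congr 1
    · rw [show ∫⁻ a in Ioc 0 s, ∫⁻ z, PN μ p q n a x z * q z * p (s + t - a) z y ∂μ
          = ∫⁻ a in Ioo 0 s, ∫⁻ z, PN μ p q n a x z * q z * p (s + t - a) z y ∂μ from
          (setLIntegral_congr Ioo_ae_eq_Ioc).symm]
      have e1 : ∀ z, PN μ p q (n+1) s x z * PN μ p q 0 t z y = ∫⁻ a in Ioo 0 s, ∫⁻ w,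
          PN μ p q n a x w * q w * p (s - a) w z * p t z y ∂μ := by
        intro z
        simp only [PN]
        rw [← lintegral_mul_const]
        · apply lintegral_congr; intro a
          rw [lintegral_mul_const]
          refine (((hJ n).comp ?_ ?_ ?_).mul (hq.comp ?_)).mul (hp.comp ?_ ?_ ?_) <;> fun_prop
        · apply Measurable.lintegral_prod_right' (f := fun (w : ℝ × X) =>
            PN μ p q n w.1 x w.2 * q w.2 * p (s - w.1) w.2 z)
          refine (((hJ n).comp ?_ ?_ ?_).mul (hq.comp ?_)).mul (hp.comp ?_ ?_ ?_) <;> fun_prop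
      simp_rw [e1]
      symm
      rw [lintegral_lintegral_swap]
      · apply setLIntegral_congr_fun measurableSet_Ioo
        intro a ha
        simp only
        rw [lintegral_lintegral_swap]
        · apply lintegral_congr; intro w
          rw [show s + t - a = (s - a) + t by ring, ← hck (s - a) t (by linarith [ha.2]) ht,
            ← lintegral_const_mul]
          · apply lintegral_congr; intro z; ring
          · exact (hp.comp (by fun_prop) (by fun_prop) (by fun_prop)).mul
              (hp.comp (by fun_prop) (by fun_prop) (by fun_prop))
        · apply Measurable.aemeasurable
          unfold Function.uncurry
          refine ((((hJ n).comp ?_ ?_ ?_).mul (hq.comp ?_)).mul (hp.comp ?_ ?_ ?_)).mul (hp.comp ?_ ?_ ?_) <;> fun_prop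
      · apply Measurable.aemeasurable
        unfold Function.uncurry
        apply Measurable.lintegral_prod_right' (f := fun (w : (X × ℝ) × X) =>
            PN μ p q n w.1.2 x w.2 * q w.2 * p (s - w.1.2) w.2 w.1.1 * p t w.1.1 y)
        refine ((((hJ n).comp ?_ ?_ ?_).mul (hq.comp ?_)).mul (hp.comp ?_ ?_ ?_)).mul (hp.comp ?_ ?_ ?_) <;> fun_prop
    · have e0 : ∫⁻ a in Ioo s (s + t), ∫⁻ z, PN μ p q n a x z * q z * p (s + t - a) z y ∂μ
          = ∫⁻ a in Ioo 0 t, ∫⁻ z, PN μ p q n (s + a) x z * q z * p (t - a) z y ∂μ := by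
        rw [← lintegral_indicator measurableSet_Ioo, ← lintegral_indicator measurableSet_Ioo,
          ← lintegral_add_left_eq_self _ s]
        apply lintegral_congr; intro a
        by_cases ha : a ∈ Ioo 0 t
        · rw [indicator_of_mem ha, indicator_of_mem]
          · simp only [add_sub_add_left_eq_sub]
          · exact ⟨by linarith [ha.1], by linarith [ha.2]⟩
        · rw [indicator_of_notMem ha, indicator_of_notMem]
          intro hb
          exact ha ⟨by linarith [hb.1], by linarith [hb.2]⟩
      rw [e0]
      have e1 : ∀ ij : ℕ × ℕ, ∫⁻ z, PN μ p q ij.1 s x z * PN μ p q (ij.2+1) t z y ∂μ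
          = ∫⁻ a in Ioo 0 t, ∫⁻ w, (∫⁻ z, PN μ p q ij.1 s x z * PN μ p q ij.2 a z w ∂μ) * q w * p (t - a) w y ∂μ := by
        rintro ⟨i, j⟩
        simp only
        have e2 : ∀ z, PN μ p q i s x z * PN μ p q (j+1) t z y = ∫⁻ a in Ioo 0 t, ∫⁻ w,
            PN μ p q i s x z * (PN μ p q j a z w * q w * p (t - a) w y) ∂μ := by
          intro z
          simp only [PN]
          rw [← lintegral_const_mul]
          · apply lintegral_congr; intro a
            rw [lintegral_const_mul]
            refine (((hJ _).comp ?_ ?_ ?_).mul (hq.comp ?_)).mul (hp.comp ?_ ?_ ?_) <;> fun_prop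
          · apply Measurable.lintegral_prod_right' (f := fun (w : ℝ × X) =>
              PN μ p q j w.1 z w.2 * q w.2 * p (t - w.1) w.2 y)
            refine (((hJ _).comp ?_ ?_ ?_).mul (hq.comp ?_)).mul (hp.comp ?_ ?_ ?_) <;> fun_prop
        simp_rw [e2]
        rw [lintegral_lintegral_swap]
        · apply lintegral_congr; intro a
          rw [lintegral_lintegral_swap]
          · apply lintegral_congr; intro w
            rw [mul_assoc, ← lintegral_mul_const]
            · apply lintegral_congr; intro z; ring
            · exact ((hJ _).comp (by fun_prop) (by fun_prop) (by fun_prop)).mul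
                ((hJ _).comp (by fun_prop) (by fun_prop) (by fun_prop))
          · apply Measurable.aemeasurable
            unfold Function.uncurry
            refine ((hJ _).comp ?_ ?_ ?_).mul ((((hJ _).comp ?_ ?_ ?_).mul (hq.comp ?_)).mul (hp.comp ?_ ?_ ?_)) <;> fun_prop
        · apply Measurable.aemeasurable
          unfold Function.uncurry
          apply Measurable.lintegral_prod_right' (f := fun (w : (X × ℝ) × X) =>
              PN μ p q i s x w.1.1 * (PN μ p q j w.1.2 w.1.1 w.2 * q w.2 * p (t - w.1.2) w.2 y))
          refine ((hJ _).comp ?_ ?_ ?_).mul ((((hJ _).comp ?_ ?_ ?_).mul (hq.comp ?_)).mul (hp.comp ?_ ?_ ?_)) <;> fun_prop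
      simp_rw [e1]
      rw [← lintegral_finsetSum]
      · apply setLIntegral_congr_fun measurableSet_Ioo
        intro a ha
        simp only
        rw [← lintegral_finsetSum]
        · apply lintegral_congr; intro w
          rw [ih s a hs ha.1 x w, Finset.sum_mul, Finset.sum_mul]
        · intro ij _
          refine (Measurable.mul ?_ hq).mul (hp.comp (by fun_prop) (by fun_prop) (by fun_prop))
          apply Measurable.lintegral_prod_right' (f := fun (w : X × X) =>
            PN μ p q ij.1 s x w.2 * PN μ p q ij.2 a w.2 w.1)
          refine ((hJ _).comp ?_ ?_ ?_).mul ((hJ _).comp ?_ ?_ ?_) <;> fun_prop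
      · intro ij _
        apply Measurable.lintegral_prod_right' (f := fun (u : ℝ × X) =>
          (∫⁻ z, PN μ p q ij.1 s x z * PN μ p q ij.2 u.1 z u.2 ∂μ) * q u.2 * p (t - u.1) u.2 y)
        refine (Measurable.mul ?_ (hq.comp measurable_snd)).mul (hp.comp (by fun_prop) (by fun_prop) (by fun_prop))
        apply Measurable.lintegral_prod_right' (f := fun (w : (ℝ × X) × X) =>
            PN μ p q ij.1 s x w.2 * PN μ p q ij.2 w.1.1 w.2 w.1.2)
        refine ((hJ _).comp ?_ ?_ ?_).mul ((hJ _).comp ?_ ?_ ?_) <;> fun_prop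

lemma PT_CK (hp : JM p) (hq : Measurable q) (hck : CK μ p) : CK μ (PT μ p q) := by
  intro s t hs ht x y
  have hJ := fun n => PN_JM μ hp hq n
  unfold PT
  simp_rw [PN_CK μ hp hq hck _ s t hs ht]
  have e : ∀ z, (∑' n, PN μ p q n s x z) * (∑' n, PN μ p q n t z y)
      = ∑' i, ∑' j, PN μ p q i s x z * PN μ p q j t z y := by
    intro z
    rw [← ENNReal.tsum_mul_right]
    congr 1; ext i; rw [ENNReal.tsum_mul_left]
  simp_rw [e]
  have hm : ∀ i j, Measurable (fun z => PN μ p q i s x z * PN μ p q j t z y) := fun i j =>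
    ((hJ _).comp (by fun_prop) (by fun_prop) (by fun_prop)).mul ((hJ _).comp (by fun_prop) (by fun_prop) (by fun_prop))
  rw [lintegral_tsum (fun i => (Measurable.tsum (fun j => hm i j)).aemeasurable)]
  have e2 : ∀ i, ∫⁻ z, ∑' j, PN μ p q i s x z * PN μ p q j t z y ∂μ
      = ∑' j, ∫⁻ z, PN μ p q i s x z * PN μ p q j t z y ∂μ := fun i =>
    lintegral_tsum (fun j => (hm i j).aemeasurable)
  simp_rw [e2]
  rw [← ENNReal.tsum_prod (f := fun i j => ∫⁻ z, PN μ p q i s x z * PN μ p q j t z y ∂μ),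
    ← Finset.HasAntidiagonal.sigmaAntidiagonalEquivProd.tsum_eq, ENNReal.tsum_sigma']
  congr 1; ext n
  rw [tsum_fintype]
  exact Finset.sum_coe_sort (Finset.HasAntidiagonal.antidiagonal n)
    (fun ij => ∫⁻ z, PN μ p q ij.1 s x z * PN μ p q ij.2 t z y ∂μ)

/-- left Duhamel formula -/
lemma PN_left (hp : JM p) (hq : Measurable q) (n : ℕ) : ∀ T x y,
    PN μ p q (n+1) T x y = ∫⁻ s in Ioo (0:ℝ) T, ∫⁻ z, p s x z * q z * PN μ p q n (T - s) z y ∂μ := by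
  induction n with
  | zero => intro T x y; rfl
  | succ n ih =>
    intro T x y
    have hJ := fun n => PN_JM μ hp hq n
    rw [PN]
    have e1 : ∀ t, ∫⁻ z, PN μ p q (n+1) t x z * q z * p (T - t) z y ∂μ
        = ∫⁻ s in Ioo (0:ℝ) t, ∫⁻ z, ∫⁻ w, p s x w * q w * PN μ p q n (t - s) w z * q z * p (T - s - (t - s)) z y ∂μ ∂μ := by
      intro t
      rw [lintegral_lintegral_swap]
      · apply lintegral_congr; intro z
        rw [ih t x z, mul_assoc, ← lintegral_mul_const]
        · apply lintegral_congr; intro s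
          rw [← lintegral_mul_const]
          · apply lintegral_congr; intro w
            rw [show T - s - (t - s) = T - t by ring]; ring
          · refine ((hp.comp ?_ ?_ ?_).mul (hq.comp ?_)).mul ((hJ _).comp ?_ ?_ ?_) <;> fun_prop
        · apply Measurable.lintegral_prod_right' (f := fun (w : ℝ × X) =>
            p w.1 x w.2 * q w.2 * PN μ p q n (t - w.1) w.2 z)
          refine ((hp.comp ?_ ?_ ?_).mul (hq.comp ?_)).mul ((hJ _).comp ?_ ?_ ?_) <;> fun_prop
      · apply Measurable.aemeasurable
        unfold Function.uncurry
        apply Measurable.lintegral_prod_right' (f := fun (u : (ℝ × X) × X) =>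
            p u.1.1 x u.2 * q u.2 * PN μ p q n (t - u.1.1) u.2 u.1.2 * q u.1.2 * p (T - u.1.1 - (t - u.1.1)) u.1.2 y)
        refine ((((hp.comp ?_ ?_ ?_).mul (hq.comp ?_)).mul ((hJ _).comp ?_ ?_ ?_)).mul (hq.comp ?_)).mul (hp.comp ?_ ?_ ?_) <;> fun_prop
    simp_rw [e1]
    rw [tri_swap (fun s v => ∫⁻ z, ∫⁻ w, p s x w * q w * PN μ p q n v w z * q z * p (T - s - v) z y ∂μ ∂μ)]
    · apply lintegral_congr; intro s
      have : ∀ v, ∫⁻ z, ∫⁻ w, p s x w * q w * PN μ p q n v w z * q z * p (T - s - v) z y ∂μ ∂μ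
          = ∫⁻ w, ∫⁻ z, p s x w * q w * (PN μ p q n v w z * q z * p (T - s - v) z y) ∂μ ∂μ := by
        intro v
        rw [lintegral_lintegral_swap]
        · simp only [mul_assoc]
        · apply Measurable.aemeasurable
          unfold Function.uncurry
          refine ((((hp.comp ?_ ?_ ?_).mul (hq.comp ?_)).mul ((hJ _).comp ?_ ?_ ?_)).mul (hq.comp ?_)).mul (hp.comp ?_ ?_ ?_) <;> fun_prop
      simp_rw [this]
      rw [lintegral_lintegral_swap]
      · apply lintegral_congr; intro w
        simp only [PN]
        rw [← lintegral_const_mul]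
        · apply lintegral_congr; intro v
          rw [← lintegral_const_mul]
          refine (((hJ _).comp ?_ ?_ ?_).mul (hq.comp ?_)).mul (hp.comp ?_ ?_ ?_) <;> fun_prop
        · apply Measurable.lintegral_prod_right' (f := fun (u : ℝ × X) =>
            PN μ p q n u.1 w u.2 * q u.2 * p (T - s - u.1) u.2 y)
          refine (((hJ _).comp ?_ ?_ ?_).mul (hq.comp ?_)).mul (hp.comp ?_ ?_ ?_) <;> fun_prop
      · apply Measurable.aemeasurable
        unfold Function.uncurry
        apply Measurable.lintegral_prod_right' (f := fun (u : (ℝ × X) × X) =>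
            p s x u.1.2 * q u.1.2 * (PN μ p q n u.1.1 u.1.2 u.2 * q u.2 * p (T - s - u.1.1) u.2 y))
        refine ((hp.comp ?_ ?_ ?_).mul (hq.comp ?_)).mul ((((hJ _).comp ?_ ?_ ?_).mul (hq.comp ?_)).mul (hp.comp ?_ ?_ ?_)) <;> fun_prop
    · unfold Function.uncurry
      apply Measurable.lintegral_prod_right' (f := fun (u : (ℝ × ℝ) × X) => ∫⁻ w,
            p u.1.1 x w * q w * PN μ p q n u.1.2 w u.2 * q u.2 * p (T - u.1.1 - u.1.2) u.2 y ∂μ)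
      apply Measurable.lintegral_prod_right' (f := fun (u : ((ℝ × ℝ) × X) × X) =>
            p u.1.1.1 x u.2 * q u.2 * PN μ p q n u.1.1.2 u.2 u.1.2 * q u.1.2 * p (T - u.1.1.1 - u.1.1.2) u.1.2 y)
      refine ((((hp.comp ?_ ?_ ?_).mul (hq.comp ?_)).mul ((hJ _).comp ?_ ?_ ?_)).mul (hq.comp ?_)).mul (hp.comp ?_ ?_ ?_) <;> fun_prop

lemma lintegral_refl_Ioo (F : ℝ → ℝ≥0∞) (T : ℝ) :
    ∫⁻ s in Ioo (0:ℝ) T, F (T - s) = ∫⁻ s in Ioo (0:ℝ) T, F s := by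
  rw [← lintegral_indicator measurableSet_Ioo, ← lintegral_indicator measurableSet_Ioo,
    ← lintegral_sub_left_eq_self _ T]
  apply lintegral_congr; intro a
  by_cases ha : a ∈ Ioo 0 T
  · rw [indicator_of_mem ha, indicator_of_mem]
    · simp
    · exact ⟨by linarith [ha.2], by linarith [ha.1]⟩
  · rw [indicator_of_notMem ha, indicator_of_notMem]
    intro hb
    exact ha ⟨by linarith [hb.2], by linarith [hb.1]⟩

lemma PN_symm (hp : JM p) (hq : Measurable q) (hs : ∀ t x y, p t x y = p t y x) (n : ℕ) : ∀ t x y,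
    PN μ p q n t x y = PN μ p q n t y x := by
  induction n with
  | zero => exact hs
  | succ n ih =>
    intro t x y
    rw [PN_left μ hp hq n t y x, PN, ← lintegral_refl_Ioo]
    apply lintegral_congr; intro s
    apply lintegral_congr; intro z
    rw [sub_sub_cancel, ih s x z, hs (t - s) z y]; ring

lemma PT_symm (hp : JM p) (hq : Measurable q) (hs : ∀ t x y, p t x y = p t y x) (t : ℝ) (x y : X) :
    PT μ p q t x y = PT μ p q t y x := by
  unfold PT; simp_rw [PN_symm μ hp hq hs _ t x y]

end Abstract2



section Abstract3
variable {X : Type*} [MeasurableSpace X]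
variable (μ : Measure X)

/-- integral operator of a kernel -/
def PO (p : ℝ → X → X → ℝ≥0∞) (t : ℝ) (f : X → ℝ≥0∞) (x : X) : ℝ≥0∞ := ∫⁻ z, p t x z * f z ∂μ

/-- time-integrated operator of a kernel -/
def TI (p : ℝ → X → X → ℝ≥0∞) (t : ℝ) (g : X → ℝ≥0∞) (x : X) : ℝ≥0∞ :=
  ∫⁻ s in Ioo (0:ℝ) t, PO μ p s g x

variable {p : ℝ → X → X → ℝ≥0∞} {q : X → ℝ≥0∞}

lemma PN_mono {q' : X → ℝ≥0∞} (h : ∀ᵐ z ∂μ, q z ≤ q' z) (n : ℕ) : ∀ t x y,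
    PN μ p q n t x y ≤ PN μ p q' n t x y := by
  induction n with
  | zero => intro t x y; exact le_rfl
  | succ n ih =>
    intro t x y
    rw [PN_succ, PN_succ]
    apply lintegral_mono; intro s
    apply lintegral_mono_ae
    filter_upwards [h] with z hz
    gcongr
    exact ih s x z

lemma PT_mono {q' : X → ℝ≥0∞} (h : ∀ᵐ z ∂μ, q z ≤ q' z) (t : ℝ) (x y : X) :
    PT μ p q t x y ≤ PT μ p q' t x y :=
  ENNReal.tsum_le_tsum (fun n => PN_mono μ h n t x y)

lemma le_PT (t : ℝ) (x y : X) : p t x y ≤ PT μ p q t x y :=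
  ENNReal.le_tsum (f := fun n => PN μ p q n t x y) 0

variable [SFinite μ]

lemma PO_meas (hp : JM p) {f : X → ℝ≥0∞} (hf : Measurable f) :
    Measurable (fun w : ℝ × X => PO μ p w.1 f w.2) := by
  unfold PO
  apply Measurable.lintegral_prod_right' (f := fun (w : (ℝ × X) × X) => p w.1.1 w.1.2 w.2 * f w.2)
  exact (hp.comp (by fun_prop) (by fun_prop) (by fun_prop)).mul (hf.comp measurable_snd)

lemma TI_meas (hp : JM p) {f : X → ℝ≥0∞} (hf : Measurable f) :
    Measurable (fun w : ℝ × X => TI μ p w.1 f w.2) := by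
  unfold TI
  apply measurable_tint (fun (w : ℝ × X) s => PO μ p s f w.2) _ (fun w => w.1) measurable_fst
  exact (PO_meas μ hp hf).comp (measurable_snd.prodMk (measurable_snd.comp measurable_fst))

lemma PO_PN_succ (hp : JM p) (hq : Measurable q) {f : X → ℝ≥0∞} (hf : Measurable f) (n : ℕ)
    (t : ℝ) (x : X) : PO μ (PN μ p q (n+1)) t f x
      = ∫⁻ s in Ioo (0:ℝ) t, ∫⁻ z, PN μ p q n s x z * q z * PO μ p (t - s) f z ∂μ := by
  have hJ := PN_JM μ hp hq n
  unfold PO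
  have e1 : ∀ y, PN μ p q (n+1) t x y * f y = ∫⁻ s in Ioo (0:ℝ) t, ∫⁻ z,
      PN μ p q n s x z * q z * p (t - s) z y * f y ∂μ := by
    intro y
    rw [PN_succ, ← lintegral_mul_const]
    · apply lintegral_congr; intro a
      rw [lintegral_mul_const]
      refine ((hJ.comp ?_ ?_ ?_).mul (hq.comp ?_)).mul (hp.comp ?_ ?_ ?_) <;> fun_prop
    · apply Measurable.lintegral_prod_right' (f := fun (w : ℝ × X) =>
        PN μ p q n w.1 x w.2 * q w.2 * p (t - w.1) w.2 y)
      refine ((hJ.comp ?_ ?_ ?_).mul (hq.comp ?_)).mul (hp.comp ?_ ?_ ?_) <;> fun_prop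
  simp_rw [e1]
  rw [lintegral_lintegral_swap]
  · apply lintegral_congr; intro s
    rw [lintegral_lintegral_swap]
    · apply lintegral_congr; intro z
      rw [← lintegral_const_mul]
      · apply lintegral_congr; intro y; ring
      · exact (hp.comp (by fun_prop) (by fun_prop) (by fun_prop)).mul hf
    · apply Measurable.aemeasurable
      unfold Function.uncurry
      refine (((hJ.comp ?_ ?_ ?_).mul (hq.comp ?_)).mul (hp.comp ?_ ?_ ?_)).mul (hf.comp ?_) <;> fun_prop
  · apply Measurable.aemeasurable
    unfold Function.uncurry
    apply Measurable.lintegral_prod_right' (f := fun (w : (X × ℝ) × X) =>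
      PN μ p q n w.1.2 x w.2 * q w.2 * p (t - w.1.2) w.2 w.1.1 * f w.1.1)
    refine (((hJ.comp ?_ ?_ ?_).mul (hq.comp ?_)).mul (hp.comp ?_ ?_ ?_)).mul (hf.comp ?_) <;> fun_prop

lemma TI_PN_succ (hp : JM p) (hq : Measurable q) {f : X → ℝ≥0∞} (hf : Measurable f) (n : ℕ)
    (t : ℝ) (x : X) : TI μ (PN μ p q (n+1)) t f x
      = ∫⁻ s in Ioo (0:ℝ) t, ∫⁻ z, PN μ p q n s x z * q z * TI μ p (t - s) f z ∂μ := by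
  have hJ := PN_JM μ hp hq n
  have hPO := PO_meas μ hp hf
  unfold TI
  simp_rw [PO_PN_succ μ hp hq hf n]
  have hm : Measurable (fun (w : (ℝ × ℝ) × X) => PN μ p q n w.1.1 x w.2 * q w.2 * PO μ p w.1.2 f w.2) := by
    refine ((hJ.comp ?_ ?_ ?_).mul (hq.comp ?_)).mul (hPO.comp (Measurable.prodMk ?_ ?_)) <;> fun_prop
  rw [tri_swap (fun s v => ∫⁻ z, PN μ p q n s x z * q z * PO μ p v f z ∂μ)]
  · apply lintegral_congr; intro s
    rw [lintegral_lintegral_swap]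
    · apply lintegral_congr; intro z
      rw [lintegral_const_mul]
      exact hPO.comp (measurable_id.prodMk measurable_const)
    · apply Measurable.aemeasurable
      unfold Function.uncurry
      exact Measurable.comp hm (f := fun a : ℝ × X => ((s, a.1), a.2)) (by fun_prop)
  · unfold Function.uncurry
    exact hm.lintegral_prod_right'

lemma PO_PT (hp : JM p) (hq : Measurable q) {f : X → ℝ≥0∞} (hf : Measurable f) (t : ℝ) (x : X) :
    PO μ (PT μ p q) t f x = ∑' n, PO μ (PN μ p q n) t f x := by
  unfold PO PT
  simp_rw [← ENNReal.tsum_mul_right]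
  rw [lintegral_tsum]
  intro n
  exact (((PN_JM μ hp hq n).comp (by fun_prop) (by fun_prop) (by fun_prop)).mul hf).aemeasurable

lemma TI_PT (hp : JM p) (hq : Measurable q) {f : X → ℝ≥0∞} (hf : Measurable f) (t : ℝ) (x : X) :
    TI μ (PT μ p q) t f x = ∑' n, TI μ (PN μ p q n) t f x := by
  unfold TI
  simp_rw [PO_PT μ hp hq hf]
  rw [lintegral_tsum]
  intro n
  exact ((PO_meas μ (PN_JM μ hp hq n) hf).comp (measurable_id.prodMk measurable_const)).aemeasurable

lemma pert_identity (hp : JM p) (hq : Measurable q) {f g₁ g₂ : X → ℝ≥0∞} (hf : Measurable f)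
    (hg₁ : Measurable g₁) (hg₂ : Measurable g₂) (x : X)
    (h1 : ∀ᵐ z ∂μ, ∀ t, 0 < t → PO μ p t f z + TI μ p t g₁ z = f z + TI μ p t g₂ z)
    (h2 : ∀ t, 0 < t → PO μ p t f x + TI μ p t g₁ x = f x + TI μ p t g₂ x) (t : ℝ) (ht : 0 < t) :
    PO μ (PT μ p q) t f x + TI μ (PT μ p q) t g₁ x
      = f x + TI μ (PT μ p q) t g₂ x + TI μ (PT μ p q) t (fun z => q z * f z) x := by
  have hqf : Measurable (fun z => q z * f z) := hq.mul hf
  have key : ∀ n, PO μ (PN μ p q (n+1)) t f x + TI μ (PN μ p q (n+1)) t g₁ x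
      = TI μ (PN μ p q (n+1)) t g₂ x + TI μ (PN μ p q n) t (fun z => q z * f z) x := by
    intro n
    have hJ := PN_JM μ hp hq n
    rw [PO_PN_succ μ hp hq hf, TI_PN_succ μ hp hq hg₁, TI_PN_succ μ hp hq hg₂]
    unfold TI PO
    have mA : ∀ s, Measurable (fun z => PN μ p q n s x z * q z) := fun s =>
      (hJ.comp (by fun_prop) (by fun_prop) (by fun_prop)).mul hq
    have mT : ∀ (g : X → ℝ≥0∞), Measurable g → Measurable (fun w : ℝ × X =>
        PN μ p q n w.1 x w.2 * q w.2 * TI μ p (t - w.1) g w.2) := by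
      intro g hg
      exact ((hJ.comp (by fun_prop) (by fun_prop) (by fun_prop)).mul (hq.comp (by fun_prop))).mul
        ((TI_meas μ hp hg).comp (Measurable.prodMk (by fun_prop) (by fun_prop)))
    have mP : Measurable (fun w : ℝ × X =>
        PN μ p q n w.1 x w.2 * q w.2 * PO μ p (t - w.1) f w.2) := by
      exact ((hJ.comp (by fun_prop) (by fun_prop) (by fun_prop)).mul (hq.comp (by fun_prop))).mul
        ((PO_meas μ hp hf).comp (Measurable.prodMk (by fun_prop) (by fun_prop)))
    change (∫⁻ s in Ioo 0 t, ∫⁻ z, PN μ p q n s x z * q z * PO μ p (t - s) f z ∂μ)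
      + (∫⁻ s in Ioo 0 t, ∫⁻ z, PN μ p q n s x z * q z * TI μ p (t - s) g₁ z ∂μ)
      = (∫⁻ s in Ioo 0 t, ∫⁻ z, PN μ p q n s x z * q z * TI μ p (t - s) g₂ z ∂μ)
      + (∫⁻ s in Ioo 0 t, ∫⁻ z, PN μ p q n s x z * (q z * f z) ∂μ)
    rw [← lintegral_add_left (by exact mP.lintegral_prod_right'),
      ← lintegral_add_left (by exact (mT g₂ hg₂).lintegral_prod_right')]
    apply setLIntegral_congr_fun measurableSet_Ioo
    intro s hs
    simp only
    rw [← lintegral_add_left (by exact mP.comp (measurable_const.prodMk measurable_id)),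
      ← lintegral_add_left (by exact (mT g₂ hg₂).comp (measurable_const.prodMk measurable_id))]
    apply lintegral_congr_ae
    filter_upwards [h1] with z hz
    rw [← mul_add, hz (t - s) (by linarith [hs.2])]
    ring
  rw [PO_PT μ hp hq hf, TI_PT μ hp hq hg₁, TI_PT μ hp hq hg₂, TI_PT μ hp hq hqf,
    tsum_eq_zero_add' ENNReal.summable, tsum_eq_zero_add' (f := fun n => TI μ (PN μ p q n) t g₁ x) ENNReal.summable,
    tsum_eq_zero_add' (f := fun n => TI μ (PN μ p q n) t g₂ x) ENNReal.summable]
  have e0 : PO μ (PN μ p q 0) t f x + TI μ (PN μ p q 0) t g₁ x = f x + TI μ (PN μ p q 0) t g₂ x := h2 t ht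
  have e1 : ∑' n, PO μ (PN μ p q (n+1)) t f x + ∑' n, TI μ (PN μ p q (n+1)) t g₁ x
      = ∑' n, TI μ (PN μ p q (n+1)) t g₂ x + ∑' n, TI μ (PN μ p q n) t (fun z => q z * f z) x := by
    rw [← ENNReal.tsum_add, ← ENNReal.tsum_add]
    congr 1; ext n; exact key n
  calc _ = (PO μ (PN μ p q 0) t f x + TI μ (PN μ p q 0) t g₁ x) +
        (∑' n, PO μ (PN μ p q (n+1)) t f x + ∑' n, TI μ (PN μ p q (n+1)) t g₁ x) := by ring
    _ = _ := by rw [e0, e1]; ring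

lemma PT_duhamel (hp : JM p) (hq : Measurable q) (t : ℝ) (x y : X) :
    PT μ p q t x y = p t x y +
      ∫⁻ s in Ioo (0 : ℝ) t, ∫⁻ z, PT μ p q s x z * q z * p (t - s) z y ∂μ := by
  have hJ := fun n => PN_JM μ hp hq n
  unfold PT
  rw [tsum_eq_zero_add' ENNReal.summable]
  congr 1
  simp_rw [PN_succ, ← ENNReal.tsum_mul_right]
  have hm : ∀ n, Measurable (fun w : ℝ × X => PN μ p q n w.1 x w.2 * q w.2 * p (t - w.1) w.2 y) := by
    intro n
    refine (((hJ n).comp ?_ ?_ ?_).mul (hq.comp ?_)).mul (hp.comp ?_ ?_ ?_) <;> fun_prop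
  rw [← lintegral_tsum (fun n => (hm n).lintegral_prod_right'.aemeasurable)]
  apply lintegral_congr; intro s
  rw [← lintegral_tsum]
  intro n
  exact ((hm n).comp (measurable_const.prodMk measurable_id)).aemeasurable

lemma iSup_mul_iSup_mono {f g : ℕ → ℝ≥0∞} (hf : Monotone f) (hg : Monotone g) :
    (⨆ i, f i) * (⨆ i, g i) = ⨆ i, f i * g i := by
  apply le_antisymm
  · rw [ENNReal.iSup_mul]
    apply iSup_le; intro i
    rw [ENNReal.mul_iSup]
    apply iSup_le; intro j
    exact le_iSup_of_le (max i j) (mul_le_mul' (hf (le_max_left _ _)) (hg (le_max_right _ _)))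
  · apply iSup_le; intro i
    exact mul_le_mul' (le_iSup f i) (le_iSup g i)

lemma PN_iSup (hp : JM p) {Q : ℕ → X → ℝ≥0∞} (hQ : ∀ N, Measurable (Q N)) (hmono : Monotone Q)
    (hsup : ∀ z, q z = ⨆ N, Q N z) (n : ℕ) : ∀ t x y,
    PN μ p q n t x y = ⨆ N, PN μ p (Q N) n t x y := by
  induction n with
  | zero => intro t x y; simp [PN]
  | succ n ih =>
    intro t x y
    have hJ := fun N => PN_JM μ hp (hQ N) n
    have hPmono : ∀ n s x z, Monotone (fun N => PN μ p (Q N) n s x z) := fun n s x z i j hij =>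
      PN_mono μ (ae_of_all _ (fun z => hmono hij z)) n s x z
    have hm : ∀ N, Measurable (fun w : ℝ × X => PN μ p (Q N) n w.1 x w.2 * Q N w.2 * p (t - w.1) w.2 y) := by
      intro N
      refine (((hJ N).comp ?_ ?_ ?_).mul ((hQ N).comp ?_)).mul (hp.comp ?_ ?_ ?_) <;> fun_prop
    simp_rw [PN_succ]
    have hmm : ∀ s z, Monotone (fun N => PN μ p (Q N) n s x z * Q N z * p (t - s) z y) := by
      intro s z i j hij
      have h1 := hPmono n s x z hij
      have h2 := hmono hij z
      simp only at h1 ⊢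
      gcongr
    rw [← lintegral_iSup (fun N => (hm N).lintegral_prod_right')]
    · apply lintegral_congr; intro s
      have hm2 : ∀ N, Measurable (fun z => PN μ p (Q N) n s x z * Q N z * p (t - s) z y) :=
        fun N => (hm N).comp (measurable_const.prodMk measurable_id)
      simp only
      rw [← lintegral_iSup hm2]
      · apply lintegral_congr; intro z
        rw [ih s x z, hsup z, iSup_mul_iSup_mono (hPmono n s x z) (fun i j hij => hmono hij z),
          ENNReal.iSup_mul]
      · intro i j hij z
        exact hmm s z hij
    · intro i j hij s
      apply lintegral_mono; intro z
      exact hmm s z hij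

lemma PT_le_of_trunc (hp : JM p) {Q : ℕ → X → ℝ≥0∞} (hQ : ∀ N, Measurable (Q N)) (hmono : Monotone Q)
    (hsup : ∀ z, q z = ⨆ N, Q N z) {t : ℝ} {x y : X} {B : ℝ≥0∞} (h : ∀ N, PT μ p (Q N) t x y ≤ B) :
    PT μ p q t x y ≤ B := by
  unfold PT
  rw [ENNReal.tsum_eq_iSup_nat]
  apply iSup_le; intro M
  simp_rw [PN_iSup μ hp hQ hmono hsup]
  rw [ENNReal.finsetSum_iSup_of_monotone]
  · apply iSup_le; intro N
    exact (ENNReal.sum_le_tsum _).trans (h N)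
  · intro n i j hij
    exact PN_mono μ (ae_of_all _ (fun z => hmono hij z)) n t x y

lemma PN_le_of_bdd (hp : JM p) (hck : CK μ p) (c : ℝ) (hc : 0 ≤ c)
    (hb : ∀ z, q z ≤ ENNReal.ofReal c) (n : ℕ) : ∀ t, 0 < t → ∀ x y,
    PN μ p q n t x y ≤ ENNReal.ofReal ((c * t) ^ n / n.factorial) * p t x y := by
  induction n with
  | zero => intro t ht x y; simp [PN]
  | succ n ih =>
    intro t ht x y
    rw [PN_succ]
    calc _ ≤ ∫⁻ s in Ioo (0:ℝ) t, ENNReal.ofReal ((c * s) ^ n / n.factorial * c) * p t x y := by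
          apply setLIntegral_mono' measurableSet_Ioo
          intro s hs
          calc _ ≤ ∫⁻ z, ENNReal.ofReal ((c * s) ^ n / n.factorial * c) * (p s x z * p (t - s) z y) ∂μ := by
                apply lintegral_mono; intro z
                calc _ ≤ (ENNReal.ofReal ((c * s) ^ n / n.factorial) * p s x z) * ENNReal.ofReal c * p (t - s) z y := by
                      exact mul_le_mul' (mul_le_mul' (ih s hs.1 x z) (hb z)) le_rfl
                  _ = _ := by
                      rw [ENNReal.ofReal_mul (by have := hs.1; positivity)]; ring
            _ = _ := by
                rw [lintegral_const_mul, hck s (t - s) hs.1 (by linarith [hs.2])]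
                · simp
                · exact (hp.comp (by fun_prop) (by fun_prop) (by fun_prop)).mul
                    (hp.comp (by fun_prop) (by fun_prop) (by fun_prop))
      _ = _ := by
          rw [lintegral_mul_const _ (by fun_prop)]
          congr 1
          rw [← ofReal_integral_eq_lintegral_ofReal]
          · congr 1
            rw [← integral_Ioc_eq_integral_Ioo, ← intervalIntegral.integral_of_le ht.le]
            have : ∀ s : ℝ, (c * s) ^ n / n.factorial * c = (c ^ (n+1) / n.factorial) * s ^ n := by
              intro s; rw [mul_pow, pow_succ]; ring
            simp_rw [this]
            rw [intervalIntegral.integral_const_mul, integral_pow]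
            rw [Nat.factorial_succ]; push_cast
            simp only [ne_eq, Nat.add_eq_zero_iff, one_ne_zero, and_false, not_false_eq_true, zero_pow, sub_zero]
            field_simp
            rw [mul_pow]
          · apply Continuous.integrableOn_Ioc (f := fun s => (c * s) ^ n / n.factorial * c) (a := 0) (b := t) (by fun_prop) |>.mono_set
            exact Ioo_subset_Ioc_self
          · filter_upwards [ae_restrict_mem measurableSet_Ioo] with s hs
            have := hs.1; positivity

lemma PT_le_of_bdd (hp : JM p) (hck : CK μ p) (c : ℝ) (hc : 0 ≤ c)
    (hb : ∀ z, q z ≤ ENNReal.ofReal c) (t : ℝ) (ht : 0 < t) (x y : X) :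
    PT μ p q t x y ≤ ENNReal.ofReal (Real.exp (c * t)) * p t x y := by
  unfold PT
  calc _ ≤ ∑' n : ℕ, ENNReal.ofReal ((c * t) ^ n / n.factorial) * p t x y :=
        ENNReal.tsum_le_tsum (fun n => PN_le_of_bdd μ hp hck c hc hb n t ht x y)
    _ = _ := by
        rw [ENNReal.tsum_mul_right, ← ENNReal.ofReal_tsum_of_nonneg]
        · congr 2
          rw [Real.exp_eq_exp_ℝ, NormedSpace.exp_eq_tsum_div]
        · intro n; positivity
        · exact Real.summable_pow_div_factorial _

end Abstract3



/-- the power function -/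
def hp (d : ℕ) (γ : ℝ) (x : Ed d) : ℝ≥0∞ := ENNReal.ofReal (‖x‖ ^ (-γ))

lemma hp_meas (d : ℕ) (γ : ℝ) : Measurable (hp d γ) := by
  unfold hp; fun_prop

/-- The facts on the free kernel. -/
structure KernelHyp (d : ℕ) (α : ℝ) (κ : ℝ → ℝ) (p : ℝ → Ed d → Ed d → ℝ≥0∞) : Prop where
  hα : α ∈ Ioo 0 (min 2 (d : ℝ))
  jm : JM p
  ck : CK volume p
  symm : ∀ t x y, p t x y = p t y x
  mass : ∀ t, 0 < t → ∀ x, ∫⁻ z, p t x z = 1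
  up1 : ∃ C : ℝ, 0 < C ∧ ∀ t, 0 < t → ∀ x y, p t x y ≤ ENNReal.ofReal (C * t ^ (-(d : ℝ) / α))
  up2 : ∃ C : ℝ, 0 < C ∧ ∀ t, 0 < t → ∀ x y, x ≠ y →
    p t x y ≤ ENNReal.ofReal (C * t * ‖x - y‖ ^ (-(d : ℝ) - α))
  low : ∃ c : ℝ, 0 < c ∧ ∀ t, 1 / 3 ≤ t → t ≤ 1 → ∀ x y,
    ENNReal.ofReal (c * (1 + ‖x - y‖) ^ (-(d : ℝ) - α)) ≤ p t x y
  scal : ∀ l, 0 < l → ∀ t, 0 < t → ∀ x y,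
    p (l ^ α * t) (l • x) (l • y) = ENNReal.ofReal (l ^ (-(d : ℝ))) * p t x y
  hardy : ∀ γ, 0 < γ → γ < d - α → ∀ t, 0 < t → ∀ x, x ≠ 0 →
    PO volume p t (hp d γ) x + ENNReal.ofReal (κ γ) * TI volume p t (hp d (γ + α)) x = hp d γ x
  kmono : ∀ γ γ', 0 < γ → γ < γ' → γ' ≤ (d - α) / 2 → κ γ < κ γ'
  kpos : ∀ γ, 0 < γ → γ < d - α → 0 < κ γ

lemma young_pow {a b : ℝ} (ha : 0 ≤ a) (hab : a < b) {η : ℝ} (hη : 0 < η) :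
    ∃ C : ℝ, 0 ≤ C ∧ ∀ r : ℝ, 0 < r → r ^ (-a) ≤ η * r ^ (-b) + C := by
  refine ⟨(1 / η) ^ (a / (b - a)), by positivity, ?_⟩
  intro r hr
  have hba : 0 < b - a := by linarith
  rcases le_or_gt (1 / η) (r ^ (-(b - a))) with h | h
  · have h1 : r ^ (-b) = r ^ (-(b - a)) * r ^ (-a) := by rw [← rpow_add hr]; ring_nf
    have h2 : 1 ≤ η * r ^ (-(b - a)) := by rw [div_le_iff₀ hη] at h; linarith
    have h3 : 0 < r ^ (-a) := by positivity
    have h4 : 0 ≤ (1 / η) ^ (a / (b - a)) := by positivity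
    rw [h1]; nlinarith
  · have h1 : r ^ (-a) = (r ^ (-(b - a))) ^ (a / (b - a)) := by
      rw [← rpow_mul hr.le]; congr 1; field_simp
    have h2 : r ^ (-a) ≤ (1 / η) ^ (a / (b - a)) := by
      rw [h1]; exact rpow_le_rpow (by positivity) h.le (by positivity)
    have : 0 < η * r ^ (-b) := by positivity
    linarith

lemma gronwall_ennreal (F : ℝ → ℝ≥0∞) (a K : ℝ≥0∞) (C0 : ℝ) (hC0 : 0 < C0) (hK : K ≠ ∞)
    (hFK : ∀ t, 0 < t → t ≤ 1 → F t ≤ K)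
    (hF : ∀ t, 0 < t → t ≤ 1 → F t ≤ a + ENNReal.ofReal C0 * ∫⁻ s in Ioo 0 t, F s) :
    ∀ t, 0 < t → t ≤ 1 → F t ≤ ENNReal.ofReal (2 * Real.exp (2 * C0)) * a := by
  set M : ℝ≥0∞ := ⨆ t : {t : ℝ // 0 < t ∧ t ≤ 1}, ENNReal.ofReal (Real.exp (-(2 * C0 * t.1))) * F t.1 with hM
  have hM_le : ∀ t, 0 < t → t ≤ 1 → ENNReal.ofReal (Real.exp (-(2 * C0 * t))) * F t ≤ M :=
    fun t h1 h2 => le_iSup (fun t : {t : ℝ // 0 < t ∧ t ≤ 1} => ENNReal.ofReal (Real.exp (-(2 * C0 * t.1))) * F t.1) ⟨t, h1, h2⟩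
  have hFM : ∀ t, 0 < t → t ≤ 1 → F t ≤ ENNReal.ofReal (Real.exp (2 * C0 * t)) * M := by
    intro t h1 h2
    calc F t = ENNReal.ofReal (Real.exp (2 * C0 * t)) * (ENNReal.ofReal (Real.exp (-(2 * C0 * t))) * F t) := by
          rw [← mul_assoc, ← ENNReal.ofReal_mul (by positivity), ← Real.exp_add]; simp
      _ ≤ _ := by gcongr; exact hM_le t h1 h2
  have hMfin : M ≠ ∞ := by
    apply ne_top_of_le_ne_top hK
    apply iSup_le; rintro ⟨t, h1, h2⟩
    calc _ ≤ 1 * K := by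
          refine mul_le_mul' ?_ (hFK t h1 h2)
          rw [ENNReal.ofReal_le_one, Real.exp_le_one_iff]
          have : 0 ≤ 2 * C0 * t := by positivity
          simpa using this
      _ = K := one_mul _
  have hInt0 : ∀ t, 0 < t → t ≤ 1 → ∫⁻ s in Ioo 0 t, F s ≤ ENNReal.ofReal (Real.exp (2 * C0 * t) / (2 * C0)) * M := by
    intro t h1 h2
    calc ∫⁻ s in Ioo 0 t, F s ≤ ∫⁻ s in Ioo 0 t, ENNReal.ofReal (Real.exp (2 * C0 * s)) * M := by
          apply setLIntegral_mono' measurableSet_Ioo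
          intro s hs; exact hFM s hs.1 (by linarith [hs.2])
      _ = ENNReal.ofReal (∫ s in Ioo 0 t, Real.exp (2 * C0 * s)) * M := by
          rw [lintegral_mul_const _ (by fun_prop), ofReal_integral_eq_lintegral_ofReal]
          · exact (Continuous.integrableOn_Ioc (f := fun s => Real.exp (2 * C0 * s)) (a := 0) (b := t) (by fun_prop)).mono_set Ioo_subset_Ioc_self
          · exact ae_of_all _ (fun s => by positivity)
      _ ≤ _ := by
          gcongr
          rw [← integral_Ioc_eq_integral_Ioo, ← intervalIntegral.integral_of_le h1.le]
          rw [intervalIntegral.integral_comp_mul_left (fun s => Real.exp s) (by positivity : (2 * C0) ≠ 0)]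
          rw [integral_exp]
          simp only [mul_zero, Real.exp_zero, smul_eq_mul]
          rw [div_eq_inv_mul]
          gcongr; linarith
  have hM2 : M ≤ a + M / 2 := by
    apply iSup_le; rintro ⟨t, h1, h2⟩
    simp only
    calc _ ≤ ENNReal.ofReal (Real.exp (-(2 * C0 * t))) * (a + ENNReal.ofReal C0 * (ENNReal.ofReal (Real.exp (2 * C0 * t) / (2 * C0)) * M)) := by
          gcongr
          exact (hF t h1 h2).trans (by gcongr; exact hInt0 t h1 h2)
      _ = ENNReal.ofReal (Real.exp (-(2 * C0 * t))) * a + ENNReal.ofReal (1/2) * M := by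
          rw [mul_add]; congr 1
          rw [← mul_assoc, ← mul_assoc, ← ENNReal.ofReal_mul (by positivity), ← ENNReal.ofReal_mul (by positivity)]
          congr 2
          rw [Real.exp_neg]; field_simp
      _ ≤ 1 * a + M / 2 := by
          gcongr
          · rw [ENNReal.ofReal_le_one, Real.exp_le_one_iff]
            have : 0 ≤ 2 * C0 * t := by positivity
            simpa using this
          · rw [ENNReal.ofReal_div_of_pos (by norm_num), ENNReal.div_eq_inv_mul, ENNReal.div_eq_inv_mul]; simp
      _ = _ := by rw [one_mul]
  have hM3 : M ≤ 2 * a := by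
    have e : M / 2 + M / 2 ≤ a + M / 2 := by rwa [ENNReal.add_halves]
    have e2 : M / 2 ≤ a := (ENNReal.add_le_add_iff_right (ENNReal.div_ne_top hMfin (by norm_num))).1 e
    calc M = 2 * (M / 2) := by rw [ENNReal.mul_div_cancel (by norm_num) (by norm_num)]
      _ ≤ _ := by gcongr
  intro t h1 h2
  calc F t ≤ ENNReal.ofReal (Real.exp (2 * C0 * t)) * (2 * a) := (hFM t h1 h2).trans (by gcongr)
    _ ≤ ENNReal.ofReal (Real.exp (2 * C0)) * (2 * a) := by
        refine mul_le_mul' (ENNReal.ofReal_le_ofReal (Real.exp_le_exp.2 ?_)) le_rfl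
        nlinarith
    _ = _ := by
        rw [ENNReal.ofReal_mul (by norm_num)]; simp; ring

/-- dominating potential -/
def UU (κ0 A α ε r : ℝ) : ℝ := κ0 * r ^ (-α) + A * (r ^ (-(α - ε)) + r ^ (-(α / 2)))

/-- weight -/
def HH (d : ℕ) (δ : ℝ) (x : Ed d) : ℝ≥0∞ := 1 + hp d δ x

lemma HH_meas (d : ℕ) (δ : ℝ) : Measurable (HH d δ) := by
  unfold HH; exact measurable_const.add (hp_meas d δ)

/-- Real inequality behind the supersolution. -/
lemma supersol_real {κ0 κ1 A α ε δ : ℝ} (hα : 0 < α) (hε : 0 < ε) (hεα : ε ≤ α / 2) (hεδ : ε < δ)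
    (hκ1 : 0 < κ1) (hκ : κ1 < κ0) (hA : 0 ≤ A) :
    ∃ B D C0 : ℝ, 0 < B ∧ 1 ≤ D ∧ 0 < C0 ∧ ∀ r : ℝ, 0 < r →
      (r ^ (-δ) / 2 + 1 ≤ r ^ (-δ) - B * r ^ (-(δ - ε)) + D) ∧
      (UU κ0 A α ε r * (r ^ (-δ) - B * r ^ (-(δ - ε)) + D) + B * κ1 * r ^ (-(δ - ε + α)) + r ^ (-(δ - ε + α))
        ≤ κ0 * r ^ (-(δ + α)) + C0 * (r ^ (-δ) - B * r ^ (-(δ - ε)) + D)) := by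
  set B : ℝ := (2 * A + 2) / (κ0 - κ1) with hB
  have hk : 0 < κ0 - κ1 := by linarith
  have hBpos : 0 < B := by positivity
  obtain ⟨D0, hD0, hD⟩ := young_pow (a := δ - ε) (b := δ) (by linarith) (by linarith) (η := 1 / (2 * B)) (by positivity)
  set D : ℝ := 1 + B * D0 with hDdef
  have hD1 : 1 ≤ D := by have : 0 ≤ B * D0 := by positivity
                         linarith
  set M : ℝ := D * (κ0 + 2 * A) with hM
  have hMpos : 0 < M := by have : 0 < κ0 := by linarith
                           positivity
  obtain ⟨E0, hE0, hE⟩ := young_pow (a := α) (b := δ - ε + α) hα.le (by linarith) (η := 1 / M) (by positivity)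
  refine ⟨B, D, M * E0 + D * κ0 + 2 * A + 1, hBpos, hD1, ?_, ?_⟩
  · have : 0 < κ0 := by linarith
    positivity
  intro r hr
  have h1 : r ^ (-δ) / 2 + 1 ≤ r ^ (-δ) - B * r ^ (-(δ - ε)) + D := by
    have := mul_le_mul_of_nonneg_left (hD r hr) hBpos.le
    have e : B * (1 / (2 * B) * r ^ (-δ) + D0) = r ^ (-δ) / 2 + B * D0 := by field_simp
    rw [e] at this
    linarith
  refine ⟨h1, ?_⟩
  set Φ := r ^ (-δ) - B * r ^ (-(δ - ε)) + D with hΦ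
  have hδpos : 0 < r ^ (-δ) := by positivity
  have hΦ1 : 1 ≤ Φ := by linarith
  have hΦ2 : Φ ≤ r ^ (-δ) + D := by
    have : 0 < B * r ^ (-(δ - ε)) := by positivity
    linarith
  have eU : UU κ0 A α ε r * Φ = κ0 * r ^ (-(δ + α)) - B * κ0 * r ^ (-(δ - ε + α)) + D * κ0 * r ^ (-α)
      + A * (r ^ (-(α - ε)) + r ^ (-(α / 2))) * Φ := by
    have e1 : r ^ (-(δ + α)) = r ^ (-α) * r ^ (-δ) := by rw [← rpow_add hr]; ring_nf
    have e2 : r ^ (-(δ - ε + α)) = r ^ (-α) * r ^ (-(δ - ε)) := by rw [← rpow_add hr]; ring_nf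
    rw [e1, e2]; unfold UU; rw [hΦ]; ring
  have eB : B * κ0 = B * κ1 + (2 * A + 2) := by
    have : B * (κ0 - κ1) = 2 * A + 2 := by rw [hB]; field_simp
    linarith
  rw [eU, eB]
  suffices hs : D * κ0 * r ^ (-α) + A * (r ^ (-(α - ε)) + r ^ (-(α / 2))) * Φ
      ≤ (2 * A + 1) * r ^ (-(δ - ε + α)) + (M * E0 + D * κ0 + 2 * A + 1) * Φ by linear_combination hs
  have hgpos : 0 < r ^ (-(δ - ε + α)) := by positivity
  have hκ0 : 0 < κ0 := by linarith
  rcases le_or_gt r 1 with h | h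
  · have a1 : r ^ (-(α / 2)) ≤ r ^ (-(α - ε)) := rpow_le_rpow_of_exponent_ge hr h (by linarith)
    have a2 : r ^ (-(α - ε)) ≤ r ^ (-α) := rpow_le_rpow_of_exponent_ge hr h (by linarith)
    have a3 : A * (r ^ (-(α - ε)) + r ^ (-(α / 2))) * Φ ≤ A * (2 * r ^ (-(α - ε))) * (r ^ (-δ) + D) := by
      gcongr; linarith
    have a4 : r ^ (-(α - ε)) * r ^ (-δ) = r ^ (-(δ - ε + α)) := by rw [← rpow_add hr]; ring_nf
    have a5 : A * (2 * r ^ (-(α - ε))) * (r ^ (-δ) + D) ≤ 2 * A * r ^ (-(δ - ε + α)) + 2 * A * D * r ^ (-α) := by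
      have : A * D * r ^ (-(α - ε)) ≤ A * D * r ^ (-α) := by gcongr
      rw [← a4]; linear_combination 2 * this
    have a6 := mul_le_mul_of_nonneg_left (hE r hr) hMpos.le
    have e : M * (1 / M * r ^ (-(δ - ε + α)) + E0) = r ^ (-(δ - ε + α)) + M * E0 := by field_simp
    rw [e] at a6
    have a6' : D * (κ0 + 2 * A) * r ^ (-α) ≤ r ^ (-(δ - ε + α)) + M * E0 := a6
    have a7 : 0 ≤ D * κ0 + 2 * A + 1 := by positivity
    have a8 : 0 ≤ M * E0 := by positivity
    have a9 : M * E0 ≤ (M * E0 + D * κ0 + 2 * A + 1) * Φ := by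
      have : (M * E0 + D * κ0 + 2 * A + 1) * 1 ≤ (M * E0 + D * κ0 + 2 * A + 1) * Φ :=
        mul_le_mul_of_nonneg_left hΦ1 (by linarith)
      linarith
    linear_combination a3 + a5 + a6' + a9
  · have a1 : r ^ (-α) ≤ 1 := rpow_le_one_of_one_le_of_nonpos h.le (by linarith)
    have a2 : r ^ (-(α - ε)) ≤ 1 := rpow_le_one_of_one_le_of_nonpos h.le (by linarith)
    have a3 : r ^ (-(α / 2)) ≤ 1 := rpow_le_one_of_one_le_of_nonpos h.le (by linarith)
    have a4 : D * κ0 * r ^ (-α) ≤ D * κ0 * Φ := by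
      have : D * κ0 * r ^ (-α) ≤ D * κ0 * 1 := by gcongr
      have : D * κ0 * 1 ≤ D * κ0 * Φ := by gcongr
      linarith
    have a5 : A * (r ^ (-(α - ε)) + r ^ (-(α / 2))) * Φ ≤ A * (1 + 1) * Φ := by gcongr
    have a8 : 0 ≤ M * E0 * Φ := by positivity
    have a9 : 0 ≤ (2 * A + 1) * r ^ (-(δ - ε + α)) := by positivity
    have a10 : 0 ≤ Φ := by linarith
    linear_combination a4 + a5 + a8 + a9 + a10



section Ops
variable {X : Type*} [MeasurableSpace X] (μ : Measure X) {p : ℝ → X → X → ℝ≥0∞}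

lemma PO_mono {f g : X → ℝ≥0∞} (h : ∀ᵐ z ∂μ, f z ≤ g z) (t : ℝ) (x : X) : PO μ p t f x ≤ PO μ p t g x := by
  apply lintegral_mono_ae
  filter_upwards [h] with z hz
  gcongr

lemma TI_mono {f g : X → ℝ≥0∞} (h : ∀ᵐ z ∂μ, f z ≤ g z) (t : ℝ) (x : X) : TI μ p t f x ≤ TI μ p t g x :=
  lintegral_mono (fun s => PO_mono μ h s x)

lemma TI_mono_t {f : X → ℝ≥0∞} {t t' : ℝ} (h : t ≤ t') (x : X) : TI μ p t f x ≤ TI μ p t' f x :=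
  lintegral_mono_set (Ioo_subset_Ioo_right h)

lemma PO_mono_ker {p' : ℝ → X → X → ℝ≥0∞} {f : X → ℝ≥0∞} {t : ℝ} {x : X} {c : ℝ≥0∞} (hc : c ≠ ∞)
    (h : ∀ z, p t x z ≤ c * p' t x z) : PO μ p t f x ≤ c * PO μ p' t f x := by
  unfold PO
  rw [← lintegral_const_mul' _ _ hc]
  apply lintegral_mono; intro z
  calc _ ≤ c * p' t x z * f z := mul_le_mul' (h z) le_rfl
    _ = _ := by ring

variable [SFinite μ]

lemma JM.sec (hp : JM p) (t : ℝ) (x : X) : Measurable (fun z => p t x z) :=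
  hp.comp measurable_const measurable_const measurable_id

lemma JM.sec2 (hp : JM p) (t : ℝ) (y : X) : Measurable (fun z => p t z y) :=
  hp.comp measurable_const measurable_id measurable_const

lemma PO_add (hp : JM p) {f g : X → ℝ≥0∞} (hf : Measurable f) (t : ℝ) (x : X) :
    PO μ p t (fun z => f z + g z) x = PO μ p t f x + PO μ p t g x := by
  unfold PO
  simp_rw [mul_add]
  exact lintegral_add_left ((hp.sec t x).mul hf) _

lemma PO_cmul (hp : JM p) {f : X → ℝ≥0∞} (hf : Measurable f) (c : ℝ≥0∞) (t : ℝ) (x : X) :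
    PO μ p t (fun z => c * f z) x = c * PO μ p t f x := by
  unfold PO
  refine Eq.trans ?_ (lintegral_const_mul c ((hp.sec t x).mul hf))
  apply lintegral_congr; intro z; ring

lemma PO_sec (hp : JM p) {f : X → ℝ≥0∞} (hf : Measurable f) (x : X) :
    Measurable (fun s => PO μ p s f x) :=
  (PO_meas μ hp hf).comp (measurable_id.prodMk measurable_const)

lemma TI_add (hp : JM p) {f g : X → ℝ≥0∞} (hf : Measurable f) (t : ℝ) (x : X) :
    TI μ p t (fun z => f z + g z) x = TI μ p t f x + TI μ p t g x := by
  unfold TI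
  rw [← lintegral_add_left (PO_sec μ hp hf x)]
  simp_rw [PO_add μ hp hf]

lemma TI_cmul (hp : JM p) {f : X → ℝ≥0∞} (hf : Measurable f) (c : ℝ≥0∞) (t : ℝ) (x : X) :
    TI μ p t (fun z => c * f z) x = c * TI μ p t f x := by
  unfold TI
  rw [← lintegral_const_mul _ (PO_sec μ hp hf x)]
  simp_rw [PO_cmul μ hp hf]

end Ops

lemma ae_ne0 {d : ℕ} (hd : 0 < d) : ∀ᵐ z : Ed d, z ≠ 0 := by
  have : Nonempty (Fin d) := ⟨⟨0, hd⟩⟩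
  exact compl_mem_ae_iff.2 (measure_singleton _)

namespace KernelHyp
variable {d : ℕ} {α : ℝ} {κ : ℝ → ℝ} {p : ℝ → Ed d → Ed d → ℝ≥0∞}

lemma αpos (hK : KernelHyp d α κ p) : 0 < α := hK.hα.1
lemma αlt (hK : KernelHyp d α κ p) : α < d := lt_of_lt_of_le hK.hα.2 (min_le_right _ _)
lemma αlt2 (hK : KernelHyp d α κ p) : α < 2 := lt_of_lt_of_le hK.hα.2 (min_le_left _ _)
lemma dpos (hK : KernelHyp d α κ p) : 0 < d := by
  have := hK.αpos.trans hK.αlt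
  exact_mod_cast this

lemma sup21 (hK : KernelHyp d α κ p) {δ ε A : ℝ} (hδ : 0 < δ) (hδ2 : δ ≤ (d - α) / 2)
    (hε : 0 < ε) (hεα : ε ≤ α / 2) (hεδ : ε < δ) (hA : 0 ≤ A) :
    ∃ C1 : ℝ, 1 ≤ C1 ∧ ∀ q : Ed d → ℝ≥0∞, Measurable q →
      (∀ z, z ≠ 0 → q z ≤ ENNReal.ofReal (UU (κ δ) A α ε ‖z‖)) → ∀ c : ℝ, 0 ≤ c →
      (∀ z, q z ≤ ENNReal.ofReal c) → ∀ x, x ≠ 0 →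
      (∀ t, 0 < t → t ≤ 1 → PO volume (PT volume p q) t (HH d δ) x ≤ ENNReal.ofReal C1 * HH d δ x) ∧
      TI volume (PT volume p q) 1 (hp d (δ - ε + α)) x ≤ ENNReal.ofReal C1 * HH d δ x ∧
      TI volume (PT volume p q) 1 q x ≤ ENNReal.ofReal C1 * HH d δ x := by
  have hα := hK.αpos
  have hαd := hK.αlt
  have hκ0 : 0 < κ δ := hK.kpos δ hδ (by linarith)
  have hκ1 : 0 < κ (δ - ε) := hK.kpos _ (by linarith) (by linarith)
  have hκlt : κ (δ - ε) < κ δ := hK.kmono _ _ (by linarith) (by linarith) hδ2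
  obtain ⟨B, D, C0, hB, hD, hC0, hreal⟩ := supersol_real hα hε hεα hεδ hκ1 hκlt hA
  set G : ℝ := 2 * Real.exp (2 * C0) with hG
  have hGpos : 0 < G := by positivity
  set C2 : ℝ := (1 + C0 * G) * D with hC2
  have hG2 : 2 ≤ G := by
    have := Real.one_le_exp (x := 2 * C0) (by positivity); linarith
  have hC2pos : 1 ≤ C2 := by
    have : 0 ≤ C0 * G := by positivity
    nlinarith
  set C3 : ℝ := (κ δ + 2 * A) * (C2 + 2 * G * D) with hC3
  have hC3pos : 0 < C3 := by positivity
  clear_value C3 C2 G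
  refine ⟨C2 + 2 * G * D + C3, by nlinarith, ?_⟩
  intro q hq hqU c hc hqc x hx
  -- the supersolution
  set Φr : Ed d → ℝ := fun z => ‖z‖ ^ (-δ) - B * ‖z‖ ^ (-(δ - ε)) + D with hΦr
  set Φ : Ed d → ℝ≥0∞ := fun z => ENNReal.ofReal (Φr z) with hΦ
  have hΦm : Measurable Φ := by rw [hΦ, hΦr]; fun_prop
  have hΦrpos : ∀ z, z ≠ 0 → 1 ≤ Φr z := by
    intro z hz
    have h0 : 0 < ‖z‖ := norm_pos_iff.2 hz
    have := (hreal ‖z‖ h0).1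
    have h2 : 0 < ‖z‖ ^ (-δ) := by positivity
    simp only [hΦr]; linarith
  have hΦsum : ∀ z, z ≠ 0 → Φ z + ENNReal.ofReal B * hp d (δ - ε) z = hp d δ z + ENNReal.ofReal D := by
    intro z hz
    have h0 : 0 < ‖z‖ := norm_pos_iff.2 hz
    have h1 := hΦrpos z hz
    simp only [hΦ, hp]
    rw [← ENNReal.ofReal_mul hB.le, ← ENNReal.ofReal_add (by linarith) (by positivity),
      ← ENNReal.ofReal_add (by positivity) (by linarith)]
    congr 1; simp only [hΦr]; ring
  have hHΦ : ∀ z, z ≠ 0 → HH d δ z ≤ ENNReal.ofReal 2 * Φ z := by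
    intro z hz
    have h0 : 0 < ‖z‖ := norm_pos_iff.2 hz
    have h1 := (hreal ‖z‖ h0).1
    simp only [HH, hΦ, hp]
    rw [← ENNReal.ofReal_one, ← ENNReal.ofReal_add (by positivity) (by positivity),
      ← ENNReal.ofReal_mul (by norm_num)]
    apply ENNReal.ofReal_le_ofReal
    simp only [hΦr]; linarith
  have hΦH : ∀ z, z ≠ 0 → Φ z ≤ ENNReal.ofReal D * HH d δ z := by
    intro z hz
    have h0 : 0 < ‖z‖ := norm_pos_iff.2 hz
    simp only [HH, hΦ, hp]
    rw [← ENNReal.ofReal_one, ← ENNReal.ofReal_add (by positivity) (by positivity),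
      ← ENNReal.ofReal_mul (by linarith)]
    apply ENNReal.ofReal_le_ofReal
    simp only [hΦr]
    have h2 : 0 < ‖z‖ ^ (-δ) := by positivity
    have h3 : 0 < B * ‖z‖ ^ (-(δ - ε)) := by positivity
    nlinarith
  have hae := ae_ne0 hK.dpos
  have hmhp := hp_meas d
  set g1 : Ed d → ℝ≥0∞ := fun z => ENNReal.ofReal (κ δ) * hp d (δ + α) z with hg1
  set g2 : Ed d → ℝ≥0∞ := fun z => ENNReal.ofReal (B * κ (δ - ε)) * hp d (δ - ε + α) z with hg2
  have hg1m : Measurable g1 := (hmhp _).const_mul _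
  have hg2m : Measurable g2 := (hmhp _).const_mul _
  -- free identity
  have free : ∀ z, z ≠ 0 → ∀ t, 0 < t → PO volume p t Φ z + TI volume p t g1 z = Φ z + TI volume p t g2 z := by
    intro z hz t ht
    have e1 := hK.hardy δ hδ (by linarith) t ht z hz
    have e2 := hK.hardy (δ - ε) (by linarith) (by linarith) t ht z hz
    have e3 : PO volume p t Φ z + ENNReal.ofReal B * PO volume p t (hp d (δ - ε)) z
        = PO volume p t (hp d δ) z + ENNReal.ofReal D := by
      rw [← PO_cmul volume hK.jm (hmhp _), ← PO_add volume hK.jm hΦm]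
      have : ENNReal.ofReal D = PO volume p t (fun _ => ENNReal.ofReal D) z := by
        unfold PO
        rw [lintegral_mul_const _ (hK.jm.sec t z), hK.mass t ht z, one_mul]
      rw [this, ← PO_add volume hK.jm (hmhp _)]
      apply lintegral_congr_ae
      filter_upwards [hae] with w hw
      rw [hΦsum w hw]
    have e4 : TI volume p t g1 z = ENNReal.ofReal (κ δ) * TI volume p t (hp d (δ + α)) z :=
      TI_cmul volume hK.jm (hmhp _) _ t z
    have e5 : TI volume p t g2 z = ENNReal.ofReal B * (ENNReal.ofReal (κ (δ - ε)) * TI volume p t (hp d (δ - ε + α)) z) := by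
      rw [hg2, TI_cmul volume hK.jm (hmhp _) _ t z, ENNReal.ofReal_mul hB.le]; ring
    rw [← e4] at e1
    have hfin : ENNReal.ofReal B * hp d (δ - ε) z ≠ ∞ := by
      simp only [hp]; rw [← ENNReal.ofReal_mul hB.le]; exact ENNReal.ofReal_ne_top
    rw [← ENNReal.add_left_inj hfin]
    calc _ = PO volume p t Φ z + TI volume p t g1 z + ENNReal.ofReal B *
          (PO volume p t (hp d (δ - ε)) z + ENNReal.ofReal (κ (δ - ε)) * TI volume p t (hp d (δ - ε + α)) z) := by rw [e2]
      _ = (PO volume p t Φ z + ENNReal.ofReal B * PO volume p t (hp d (δ - ε)) z) + TI volume p t g1 z + TI volume p t g2 z := by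
          rw [e5]; ring
      _ = (PO volume p t (hp d δ) z + TI volume p t g1 z) + ENNReal.ofReal D + TI volume p t g2 z := by
          rw [e3]; ring
      _ = (Φ z + ENNReal.ofReal B * hp d (δ - ε) z) + TI volume p t g2 z := by rw [e1, hΦsum z hz]
      _ = _ := by ring
  have hJ : JM (PT volume p q) := PT_JM volume hK.jm hq
  have ident := pert_identity volume hK.jm hq hΦm hg1m hg2m x (by filter_upwards [hae] with z hz using free z hz) (free x hx)
  -- pointwise inequality
  have hpt : ∀ᵐ z : Ed d, (g2 z + q z * Φ z) + hp d (δ - ε + α) z ≤ g1 z + ENNReal.ofReal C0 * Φ z := by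
    filter_upwards [hae] with z hz
    have h0 : 0 < ‖z‖ := norm_pos_iff.2 hz
    have h1 := hΦrpos z hz
    have h2 := (hreal ‖z‖ h0).2
    have hU0 : 0 ≤ UU (κ δ) A α ε ‖z‖ := by unfold UU; positivity
    calc _ ≤ (g2 z + ENNReal.ofReal (UU (κ δ) A α ε ‖z‖) * Φ z) + hp d (δ - ε + α) z := by
          gcongr; exact hqU z hz
      _ = ENNReal.ofReal (B * κ (δ - ε) * ‖z‖ ^ (-(δ - ε + α)) + UU (κ δ) A α ε ‖z‖ * Φr z + ‖z‖ ^ (-(δ - ε + α))) := by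
          simp only [hg2, hΦ, hp]
          have hF0 : 0 ≤ Φr z := by linarith
          generalize Φr z = F at hF0
          rw [ENNReal.ofReal_add (by positivity) (by positivity), ENNReal.ofReal_add (by positivity) (by positivity),
            ENNReal.ofReal_mul (p := B * κ (δ - ε)) (by positivity), ENNReal.ofReal_mul hU0]
      _ ≤ ENNReal.ofReal (κ δ * ‖z‖ ^ (-(δ + α)) + C0 * Φr z) := by
          apply ENNReal.ofReal_le_ofReal
          simp only [hΦr]; linarith
      _ = _ := by
          simp only [hg1, hΦ, hp]
          have hF0 : 0 ≤ Φr z := by linarith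
          generalize Φr z = F at hF0
          rw [ENNReal.ofReal_add (by positivity) (by positivity), ENNReal.ofReal_mul hκ0.le, ENNReal.ofReal_mul hC0.le]
  have hker : ∀ t, 0 < t → t ≤ 1 → ∀ z w, PT volume p q t z w ≤ ENNReal.ofReal (Real.exp c) * p t z w := by
    intro t ht ht1 z w
    refine (PT_le_of_bdd volume hK.jm hK.ck c hc hqc t ht z w).trans ?_
    gcongr
    nlinarith
  have hpx : hp d δ x ≠ ∞ := ENNReal.ofReal_ne_top
  have hHx : HH d δ x ≠ ∞ := ENNReal.add_ne_top.2 ⟨by simp, hpx⟩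
  have hΦx : Φ x ≠ ∞ := ENNReal.ofReal_ne_top
  have hPOΦ : ∀ t, 0 < t → t ≤ 1 → PO volume (PT volume p q) t Φ x ≤
      ENNReal.ofReal (Real.exp c) * (ENNReal.ofReal D * HH d δ x) := by
    intro t ht ht1
    refine (PO_mono_ker volume (p' := p) ENNReal.ofReal_ne_top (hker t ht ht1 x)).trans ?_
    gcongr
    calc PO volume p t Φ x ≤ PO volume p t (fun z => ENNReal.ofReal D * HH d δ z) x := by
          apply PO_mono
          filter_upwards [hae] with z hz using hΦH z hz
      _ = ENNReal.ofReal D * PO volume p t (HH d δ) x := PO_cmul volume hK.jm (HH_meas d δ) _ t x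
      _ ≤ _ := by
          gcongr
          unfold HH
          rw [PO_add volume hK.jm measurable_const]
          gcongr
          · unfold PO; simp only [mul_one]; rw [hK.mass t ht x]
          · rw [← hK.hardy δ hδ (by linarith) t ht x hx]; exact le_self_add
  have hTIg1 : ∀ t, 0 < t → t ≤ 1 → TI volume (PT volume p q) t g1 x ≠ ∞ := by
    intro t ht ht1
    have : TI volume (PT volume p q) t g1 x ≤ ENNReal.ofReal (Real.exp c) * TI volume p t g1 x := by
      unfold TI
      rw [← lintegral_const_mul _ (PO_sec volume hK.jm hg1m x)]
      apply setLIntegral_mono' measurableSet_Ioo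
      intro s hs
      exact PO_mono_ker volume ENNReal.ofReal_ne_top (hker s hs.1 (by linarith [hs.2]) x)
    refine ne_top_of_le_ne_top ?_ this
    apply ENNReal.mul_ne_top ENNReal.ofReal_ne_top
    refine ne_top_of_le_ne_top hpx ?_
    rw [← hK.hardy δ hδ (by linarith) t ht x hx, hg1, TI_cmul volume hK.jm (hmhp _) _ t x]
    exact le_add_self
  -- main inequality
  have main : ∀ t, 0 < t → t ≤ 1 → PO volume (PT volume p q) t Φ x + TI volume (PT volume p q) t (hp d (δ - ε + α)) x
      ≤ Φ x + ENNReal.ofReal C0 * ∫⁻ s in Ioo 0 t, PO volume (PT volume p q) s Φ x := by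
    intro t ht ht1
    rw [← ENNReal.add_le_add_iff_right (hTIg1 t ht ht1)]
    calc _ = (PO volume (PT volume p q) t Φ x + TI volume (PT volume p q) t g1 x) + TI volume (PT volume p q) t (hp d (δ - ε + α)) x := by ring
      _ = Φ x + ((TI volume (PT volume p q) t g2 x + TI volume (PT volume p q) t (fun z => q z * Φ z) x) + TI volume (PT volume p q) t (hp d (δ - ε + α)) x) := by
          rw [ident t ht]; ring
      _ = Φ x + TI volume (PT volume p q) t (fun z => (g2 z + q z * Φ z) + hp d (δ - ε + α) z) x := by
          rw [TI_add volume hJ (f := fun z => g2 z + q z * Φ z) (hg2m.add (hq.mul hΦm)), TI_add volume hJ hg2m]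
      _ ≤ Φ x + TI volume (PT volume p q) t (fun z => g1 z + ENNReal.ofReal C0 * Φ z) x := by
          gcongr; exact TI_mono volume hpt t x
      _ = _ := by
          rw [TI_add volume hJ hg1m, TI_cmul volume hJ hΦm]
          unfold TI; ring
  have hgr := gronwall_ennreal (fun t => PO volume (PT volume p q) t Φ x) (Φ x) _ C0 hC0
    (ENNReal.mul_ne_top ENNReal.ofReal_ne_top (ENNReal.mul_ne_top ENNReal.ofReal_ne_top hHx)) hPOΦ
    (fun t ht ht1 => le_trans le_self_add (main t ht ht1))
  rw [← hG] at hgr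
  have hint1 : ∫⁻ s in Ioo (0:ℝ) 1, PO volume (PT volume p q) s Φ x ≤ ENNReal.ofReal G * Φ x := by
    calc _ ≤ ∫⁻ s in Ioo (0:ℝ) 1, ENNReal.ofReal G * Φ x := by
          apply setLIntegral_mono' measurableSet_Ioo
          intro s hs; exact hgr s hs.1 hs.2.le
      _ = _ := by simp
  have hDx := hΦH x hx
  have r1 : ∀ t, 0 < t → t ≤ 1 → PO volume (PT volume p q) t (HH d δ) x ≤ ENNReal.ofReal (2 * G * D) * HH d δ x := by
    intro t ht ht1
    calc _ ≤ PO volume (PT volume p q) t (fun z => ENNReal.ofReal 2 * Φ z) x := by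
          apply PO_mono
          filter_upwards [hae] with z hz using hHΦ z hz
      _ = ENNReal.ofReal 2 * PO volume (PT volume p q) t Φ x := PO_cmul volume hJ hΦm _ t x
      _ ≤ ENNReal.ofReal 2 * (ENNReal.ofReal G * (ENNReal.ofReal D * HH d δ x)) := by
          gcongr; exact (hgr t ht ht1).trans (by gcongr)
      _ = _ := by
          rw [show 2 * G * D = 2 * (G * D) by ring, ENNReal.ofReal_mul (by norm_num : (0:ℝ) ≤ 2), ENNReal.ofReal_mul hGpos.le]; ring
  have r2 : TI volume (PT volume p q) 1 (hp d (δ - ε + α)) x ≤ ENNReal.ofReal C2 * HH d δ x := by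
    calc _ ≤ Φ x + ENNReal.ofReal C0 * (ENNReal.ofReal G * Φ x) :=
          (le_trans le_add_self (main 1 one_pos le_rfl)).trans (by gcongr)
      _ = ENNReal.ofReal (1 + C0 * G) * Φ x := by
          rw [ENNReal.ofReal_add (by positivity) (by positivity), ENNReal.ofReal_mul hC0.le]; simp; ring
      _ ≤ ENNReal.ofReal (1 + C0 * G) * (ENNReal.ofReal D * HH d δ x) := by gcongr
      _ = _ := by rw [hC2, ENNReal.ofReal_mul (by positivity)]; ring
  refine ⟨fun t ht ht1 => (r1 t ht ht1).trans ?_, r2.trans ?_, ?_⟩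
  · gcongr; linarith
  · gcongr
    have : 0 ≤ 2 * G * D := by positivity
    linarith
  · have hqle : ∀ᵐ z : Ed d, q z ≤ ENNReal.ofReal (κ δ + 2 * A) * (hp d (δ - ε + α) z + HH d δ z) := by
      filter_upwards [hae] with z hz
      have h0 : 0 < ‖z‖ := norm_pos_iff.2 hz
      refine (hqU z hz).trans ?_
      simp only [HH, hp]
      rw [← ENNReal.ofReal_one, ← ENNReal.ofReal_add (by positivity) (by positivity), ← ENNReal.ofReal_add (by positivity) (by positivity),
        ← ENNReal.ofReal_mul (by positivity)]
      apply ENNReal.ofReal_le_ofReal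
      set r := ‖z‖
      have k1 : 0 < r ^ (-(δ - ε + α)) := by positivity
      have k2 : 0 < r ^ (-δ) := by positivity
      have key : ∀ a, 0 < a → a ≤ δ - ε + α → r ^ (-a) ≤ r ^ (-(δ - ε + α)) + (1 + r ^ (-δ)) := by
        intro a ha ha2
        rcases le_or_gt r 1 with h | h
        · have := rpow_le_rpow_of_exponent_ge h0 h (neg_le_neg ha2)
          linarith
        · have := rpow_le_one_of_one_le_of_nonpos h.le (neg_nonpos.2 ha.le)
          linarith
      unfold UU
      have t1 := mul_le_mul_of_nonneg_left (key α hα (by linarith)) hκ0.le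
      have t2 := mul_le_mul_of_nonneg_left (key (α - ε) (by linarith) (by linarith)) hA
      have t3 := mul_le_mul_of_nonneg_left (key (α / 2) (by linarith) (by linarith)) hA
      linarith
    calc _ ≤ TI volume (PT volume p q) 1 (fun z => ENNReal.ofReal (κ δ + 2 * A) * (hp d (δ - ε + α) z + HH d δ z)) x :=
          TI_mono volume hqle 1 x
      _ = ENNReal.ofReal (κ δ + 2 * A) * (TI volume (PT volume p q) 1 (hp d (δ - ε + α)) x + TI volume (PT volume p q) 1 (HH d δ) x) := by
          rw [TI_cmul volume hJ (f := fun z => hp d (δ - ε + α) z + HH d δ z) ((hmhp _).add (HH_meas d δ)), TI_add volume hJ (hmhp _)]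
      _ ≤ ENNReal.ofReal (κ δ + 2 * A) * (ENNReal.ofReal C2 * HH d δ x + ENNReal.ofReal (2 * G * D) * HH d δ x) := by
          gcongr
          calc TI volume (PT volume p q) 1 (HH d δ) x ≤ ∫⁻ s in Ioo (0:ℝ) 1, ENNReal.ofReal (2 * G * D) * HH d δ x := by
                apply setLIntegral_mono' measurableSet_Ioo
                intro s hs; exact r1 s hs.1 hs.2.le
            _ = _ := by simp
      _ = ENNReal.ofReal C3 * HH d δ x := by
          rw [hC3, ENNReal.ofReal_mul (p := κ δ + 2 * A) (by positivity), ENNReal.ofReal_add (p := C2) (by positivity) (by positivity)]; ring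
      _ ≤ _ := by
          gcongr
          have : 0 ≤ 2 * G * D := by positivity
          linarith

end KernelHyp



lemma lint_smul {d : ℕ} (l : ℝ) (hl : 0 < l) (f : Ed d → ℝ≥0∞) :
    ∫⁻ z, f z = ENNReal.ofReal (l ^ (d : ℝ)) * ∫⁻ z, f (l • z) := by
  have h := Measure.map_addHaar_smul (volume : Measure (Ed d)) hl.ne'
  have e : MeasurableEmbedding (fun z : Ed d => l • z) :=
    (Homeomorph.smulOfNeZero l hl.ne').measurableEmbedding
  have h2 : ∫⁻ z, f (l • z) = ∫⁻ z, f z ∂(Measure.map (fun z : Ed d => l • z) volume) := (e.lintegral_map f).symm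
  rw [h2, h, lintegral_smul_measure]
  simp only [finrank_euclideanSpace, Fintype.card_fin, smul_eq_mul]
  rw [← mul_assoc, ← ENNReal.ofReal_mul (by positivity), rpow_natCast, abs_of_pos (by positivity),
    mul_inv_cancel₀ (by positivity)]
  simp

lemma lint_time (a : ℝ) (ha : 0 < a) (t : ℝ) (f : ℝ → ℝ≥0∞) :
    ∫⁻ s in Ioo 0 (a * t), f s = ENNReal.ofReal a * ∫⁻ s in Ioo 0 t, f (a * s) := by
  have h := Measure.map_addHaar_smul (volume : Measure ℝ) ha.ne'
  have e : MeasurableEmbedding (fun z : ℝ => a • z) :=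
    (Homeomorph.smulOfNeZero a ha.ne').measurableEmbedding
  rw [← lintegral_indicator measurableSet_Ioo, ← lintegral_indicator measurableSet_Ioo]
  have h2 : ∫⁻ s, (Ioo 0 t).indicator (fun s => f (a * s)) s
      = ∫⁻ s, (Ioo 0 (a * t)).indicator f s ∂(Measure.map (fun z : ℝ => a • z) volume) := by
    rw [e.lintegral_map]
    apply lintegral_congr; intro s
    simp only [indicator, mem_Ioo, smul_eq_mul]
    have : (0 < a * s ∧ a * s < a * t) ↔ (0 < s ∧ s < t) := by
      rw [mul_pos_iff_of_pos_left ha, mul_lt_mul_iff_right₀ ha]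
    simp only [this]
  rw [h2, h, lintegral_smul_measure]
  simp only [Module.finrank_self, pow_one, smul_eq_mul]
  rw [← mul_assoc, ← ENNReal.ofReal_mul (by positivity), abs_of_pos (by positivity),
    mul_inv_cancel₀ (by positivity)]
  simp

/-- rescaled potential -/
def scq {d : ℕ} (α l : ℝ) (q : Ed d → ℝ≥0∞) (z : Ed d) : ℝ≥0∞ := ENNReal.ofReal (l ^ α) * q (l • z)

namespace KernelHyp
variable {d : ℕ} {α : ℝ} {κ : ℝ → ℝ} {p : ℝ → Ed d → Ed d → ℝ≥0∞}

lemma PN_scal (hK : KernelHyp d α κ p) {q : Ed d → ℝ≥0∞} {l : ℝ} (hl : 0 < l) (n : ℕ) :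
    ∀ t, 0 < t → ∀ x y, PN volume p q n (l ^ α * t) (l • x) (l • y)
      = ENNReal.ofReal (l ^ (-(d : ℝ))) * PN volume p (scq α l q) n t x y := by
  induction n with
  | zero => intro t ht x y; exact hK.scal l hl t ht x y
  | succ n ih =>
    intro t ht x y
    rw [PN_succ, PN_succ, lint_time _ (by positivity), ← lintegral_const_mul' _ _ ENNReal.ofReal_ne_top,
      ← lintegral_const_mul' _ _ ENNReal.ofReal_ne_top]
    apply setLIntegral_congr_fun measurableSet_Ioo
    intro s hs
    simp only
    rw [lint_smul l hl, ← mul_assoc, ← lintegral_const_mul' _ _ (ENNReal.mul_ne_top ENNReal.ofReal_ne_top ENNReal.ofReal_ne_top),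
      ← lintegral_const_mul' _ _ ENNReal.ofReal_ne_top]
    apply lintegral_congr; intro z
    rw [ih s hs.1, ← mul_sub, hK.scal l hl (t - s) (by linarith [hs.2])]
    unfold scq
    have : ENNReal.ofReal (l ^ (d : ℝ)) * ENNReal.ofReal (l ^ (-(d : ℝ))) = 1 := by
      rw [← ENNReal.ofReal_mul (by positivity), ← rpow_add hl]; simp
    calc _ = (ENNReal.ofReal (l ^ (d : ℝ)) * ENNReal.ofReal (l ^ (-(d : ℝ)))) * (ENNReal.ofReal (l ^ (-(d : ℝ))) * (PN volume p (fun z => ENNReal.ofReal (l ^ α) * q (l • z)) n s x z * (ENNReal.ofReal (l ^ α) * q (l • z)) * p (t - s) z y)) := by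
          ring
      _ = _ := by rw [this, one_mul]

lemma PT_scal (hK : KernelHyp d α κ p) {q : Ed d → ℝ≥0∞} {l : ℝ} (hl : 0 < l)
    (t : ℝ) (ht : 0 < t) (x y : Ed d) : PT volume p q (l ^ α * t) (l • x) (l • y)
      = ENNReal.ofReal (l ^ (-(d : ℝ))) * PT volume p (scq α l q) t x y := by
  unfold PT
  rw [← ENNReal.tsum_mul_left]
  congr 1; ext n; exact hK.PN_scal hl n t ht x y

lemma PT_scal' (hK : KernelHyp d α κ p) {q : Ed d → ℝ≥0∞} 
    (t : ℝ) (ht : 0 < t) (x y : Ed d) : PT volume p q t x y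
      = ENNReal.ofReal (t ^ (-(d : ℝ) / α)) * PT volume p (scq α (t ^ (1 / α)) q) 1
        ((t ^ (1 / α))⁻¹ • x) ((t ^ (1 / α))⁻¹ • y) := by
  have hα := hK.αpos
  have hl : 0 < t ^ (1 / α) := by positivity
  have := hK.PT_scal (q := q) hl 1 one_pos ((t ^ (1 / α))⁻¹ • x) ((t ^ (1 / α))⁻¹ • y)
  rw [smul_inv_smul₀ hl.ne', smul_inv_smul₀ hl.ne', mul_one, ← rpow_mul ht.le, ← rpow_mul ht.le] at this
  rw [one_div_mul_cancel hα.ne', rpow_one] at this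
  rw [this]; congr 3; ring

lemma PT_ne_top (hK : KernelHyp d α κ p) {q : Ed d → ℝ≥0∞} (c : ℝ) (hc : 0 ≤ c)
    (hqc : ∀ z, q z ≤ ENNReal.ofReal c) {t : ℝ} (ht : 0 < t) (x y : Ed d) : PT volume p q t x y ≠ ∞ := by
  obtain ⟨C, hC, h⟩ := hK.up1
  refine ne_top_of_le_ne_top ?_ (PT_le_of_bdd volume hK.jm hK.ck c hc hqc t ht x y)
  exact ENNReal.mul_ne_top ENNReal.ofReal_ne_top (ne_top_of_le_ne_top ENNReal.ofReal_ne_top (h t ht x y))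

lemma lemD (hK : KernelHyp d α κ p) : ∃ C : ℝ, 0 < C ∧ ∀ q : Ed d → ℝ≥0∞, Measurable q →
    ∀ c : ℝ, 0 ≤ c → (∀ z, q z ≤ ENNReal.ofReal c) → ∀ b : ℝ, 0 ≤ b → ∀ x y : Ed d, y ≠ 0 →
    (∀ z, ‖y‖ / 2 ≤ ‖z‖ → q z ≤ ENNReal.ofReal b) → ∀ t, 0 < t → t * b ≤ 1 / 2 →
    PT volume p q t x y ≤ 2 * p t x y +
      ENNReal.ofReal (C * t * (‖y‖ / 2) ^ (-(d : ℝ) - α)) * TI volume (PT volume p q) t q x := by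
  obtain ⟨C, hC, hup⟩ := hK.up2
  refine ⟨2 * C, by positivity, ?_⟩
  intro q hq c hc hqc b hb x y hy hqb t ht htb
  have hα := hK.αpos
  have hJ : JM (PT volume p q) := PT_JM volume hK.jm hq
  have hy0 : 0 < ‖y‖ := norm_pos_iff.2 hy
  set K : ℝ := C * t * (‖y‖ / 2) ^ (-(d : ℝ) - α) with hKdef
  have hKpos : 0 ≤ K := by positivity
  have hfin := hK.PT_ne_top c hc hqc ht x y
  have hpt : ∀ s ∈ Ioo (0:ℝ) t, ∀ z, q z * p (t - s) z y ≤ ENNReal.ofReal b * p (t - s) z y + ENNReal.ofReal K * q z := by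
    intro s hs z
    rcases le_or_gt (‖y‖ / 2) ‖z‖ with h | h
    · exact le_add_right (mul_le_mul' (hqb z h) le_rfl)
    · refine le_add_left ?_
      rw [mul_comm]
      refine mul_le_mul' ?_ le_rfl
      have hzy : ‖y‖ / 2 ≤ ‖z - y‖ := by
        have := norm_sub_norm_le y z
        rw [norm_sub_rev] at this; linarith
      have hne : z ≠ y := by
        rintro rfl; linarith
      refine (hup (t - s) (by linarith [hs.2]) z y hne).trans (ENNReal.ofReal_le_ofReal ?_)
      rw [hKdef]
      have e1 : ‖z - y‖ ^ (-(d : ℝ) - α) ≤ (‖y‖ / 2) ^ (-(d : ℝ) - α) := by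
        apply rpow_le_rpow_of_nonpos (by positivity) hzy
        have : (0:ℝ) ≤ d := Nat.cast_nonneg d
        linarith
      have e2 : C * (t - s) ≤ C * t := by
        have := hs.1; gcongr; linarith
      exact mul_le_mul e2 e1 (by positivity) (by positivity)
  have key : PT volume p q t x y ≤ p t x y + (ENNReal.ofReal (1/2) * PT volume p q t x y +
      ENNReal.ofReal K * TI volume (PT volume p q) t q x) := by
    conv_lhs => rw [PT_duhamel volume hK.jm hq t x y]
    gcongr
    calc _ ≤ ∫⁻ s in Ioo (0:ℝ) t, (ENNReal.ofReal b * PT volume p q t x y + ENNReal.ofReal K * PO volume (PT volume p q) s q x) := by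
          apply setLIntegral_mono' measurableSet_Ioo
          intro s hs
          calc _ ≤ ∫⁻ z, (ENNReal.ofReal b * (PT volume p q s x z * PT volume p q (t - s) z y) + ENNReal.ofReal K * (PT volume p q s x z * q z)) := by
                apply lintegral_mono; intro z
                calc _ = PT volume p q s x z * (q z * p (t - s) z y) := by ring
                  _ ≤ PT volume p q s x z * (ENNReal.ofReal b * PT volume p q (t - s) z y + ENNReal.ofReal K * q z) := by
                      gcongr
                      exact (hpt s hs z).trans (by gcongr; exact le_PT volume _ _ _)
                  _ = _ := by ring
            _ = _ := by
                rw [lintegral_add_left, lintegral_const_mul' _ _ ENNReal.ofReal_ne_top, lintegral_const_mul' _ _ ENNReal.ofReal_ne_top,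
                  PT_CK volume hK.jm hq hK.ck s (t - s) hs.1 (by linarith [hs.2])]
                · simp [PO]
                · exact ((hJ.sec s x).mul (hJ.sec2 (t - s) y)).const_mul _
      _ = ENNReal.ofReal t * (ENNReal.ofReal b * PT volume p q t x y) + ENNReal.ofReal K * TI volume (PT volume p q) t q x := by
          rw [lintegral_add_left measurable_const, lintegral_const_mul' (ENNReal.ofReal K) _ ENNReal.ofReal_ne_top]
          simp only [lintegral_const, MeasurableSet.univ, Measure.restrict_apply, univ_inter, Real.volume_Ioo, sub_zero]
          unfold TI; ring
      _ ≤ _ := by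
          refine add_le_add ?_ le_rfl
          rw [← mul_assoc, ← ENNReal.ofReal_mul ht.le]
          exact mul_le_mul' (ENNReal.ofReal_le_ofReal htb) le_rfl
  have e : PT volume p q t x y = ENNReal.ofReal (1/2) * PT volume p q t x y + ENNReal.ofReal (1/2) * PT volume p q t x y := by
    rw [← add_mul, ← ENNReal.ofReal_add (by norm_num) (by norm_num)]; norm_num
  have key2 : ENNReal.ofReal (1/2) * PT volume p q t x y ≤ p t x y + ENNReal.ofReal K * TI volume (PT volume p q) t q x := by
    rw [← ENNReal.add_le_add_iff_right (ENNReal.mul_ne_top ENNReal.ofReal_ne_top hfin : ENNReal.ofReal (1/2) * PT volume p q t x y ≠ ∞)]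
    rw [← e]; refine key.trans (le_of_eq ?_); ring
  calc PT volume p q t x y = 2 * (ENNReal.ofReal (1/2) * PT volume p q t x y) := by rw [two_mul, ← e]
    _ ≤ 2 * (p t x y + ENNReal.ofReal K * TI volume (PT volume p q) t q x) := by gcongr
    _ = _ := by
        rw [show 2 * C * t * (‖y‖ / 2) ^ (-(d : ℝ) - α) = 2 * K by rw [hKdef]; ring, ENNReal.ofReal_mul (p := 2) (by norm_num),
          show ENNReal.ofReal 2 = 2 by simp]
        ring
end KernelHyp



lemma exists_small_pow {a η : ℝ} (ha : 0 < a) (hη : 0 < η) : ∃ r : ℝ, 0 < r ∧ r < 1 ∧ r ^ a ≤ η := by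
  refine ⟨min (1/2) (η ^ (1 / a)), by positivity, lt_of_le_of_lt (min_le_left _ _) (by norm_num), ?_⟩
  calc (min (1/2) (η ^ (1 / a))) ^ a ≤ (η ^ (1 / a)) ^ a :=
        rpow_le_rpow (by positivity) (min_le_right _ _) ha.le
    _ = η := by rw [← rpow_mul hη.le, one_div_mul_cancel ha.ne', rpow_one]

lemma UU_anti {κ0 A α ε : ℝ} (hκ : 0 ≤ κ0) (hA : 0 ≤ A) (hα : 0 < α) (hεα : ε ≤ α / 2) {r s : ℝ} (hr : 0 < r) (hrs : r ≤ s) :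
    UU κ0 A α ε s ≤ UU κ0 A α ε r := by
  unfold UU
  have h1 := rpow_le_rpow_of_nonpos hr hrs (by linarith : -α ≤ 0)
  have h2 := rpow_le_rpow_of_nonpos hr hrs (by linarith : -(α - ε) ≤ 0)
  have h3 := rpow_le_rpow_of_nonpos hr hrs (by linarith : -(α / 2) ≤ 0)
  gcongr

lemma UU_nonneg {κ0 A α ε : ℝ} (hκ : 0 ≤ κ0) (hA : 0 ≤ A) {r : ℝ} (hr : 0 ≤ r) :
    0 ≤ UU κ0 A α ε r := by unfold UU; positivity

lemma UU_scale {κ0 A α ε : ℝ} (hA : 0 ≤ A) (hα : 0 < α) (hε : 0 < ε) {l r : ℝ} (hl : 0 < l) (hl1 : l ≤ 1) (hr : 0 ≤ r) :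
    l ^ α * UU κ0 A α ε (l * r) ≤ UU κ0 A α ε r := by
  unfold UU
  rw [mul_rpow hl.le hr, mul_rpow hl.le hr, mul_rpow hl.le hr]
  have e1 : l ^ α * l ^ (-α) = 1 := by rw [← rpow_add hl]; simp
  have e2 : l ^ α * l ^ (-(α - ε)) ≤ 1 := by
    rw [← rpow_add hl]; exact rpow_le_one hl.le hl1 (by linarith)
  have e3 : l ^ α * l ^ (-(α / 2)) ≤ 1 := by
    rw [← rpow_add hl]; exact rpow_le_one hl.le hl1 (by linarith)
  have f2 : 0 ≤ r ^ (-(α - ε)) := by positivity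
  have f3 : 0 ≤ r ^ (-(α / 2)) := by positivity
  calc _ = (l ^ α * l ^ (-α)) * (κ0 * r ^ (-α)) + A * ((l ^ α * l ^ (-(α - ε))) * r ^ (-(α - ε)) + (l ^ α * l ^ (-(α / 2))) * r ^ (-(α / 2))) := by ring
    _ ≤ 1 * (κ0 * r ^ (-α)) + A * (1 * r ^ (-(α - ε)) + 1 * r ^ (-(α / 2))) := by
        rw [e1]; gcongr
    _ = _ := by ring

/-- truncated potential -/
def UN (d : ℕ) (κ0 A α ε : ℝ) (N : ℕ) (z : Ed d) : ℝ≥0∞ := min (ENNReal.ofReal (UU κ0 A α ε ‖z‖)) N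

lemma UN_meas (d : ℕ) (κ0 A α ε : ℝ) (N : ℕ) : Measurable (UN d κ0 A α ε N) := by
  unfold UN UU; fun_prop

lemma HH_one_le (d : ℕ) (δ : ℝ) (x : Ed d) : 1 ≤ HH d δ x := le_self_add
lemma HH_ne_top (d : ℕ) (δ : ℝ) (x : Ed d) : HH d δ x ≠ ∞ :=
  ENNReal.add_ne_top.2 ⟨by simp, ENNReal.ofReal_ne_top⟩

lemma HH_scale {d : ℕ} {δ : ℝ} (hδ : 0 < δ) {l : ℝ} (hl : 1 ≤ l) {x : Ed d} (hx : x ≠ 0) : HH d δ (l • x) ≤ HH d δ x := by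
  have h0 : 0 < ‖x‖ := norm_pos_iff.2 hx
  unfold HH hp
  gcongr 1 + ?_
  apply ENNReal.ofReal_le_ofReal
  apply rpow_le_rpow_of_nonpos h0 _ (by linarith)
  rw [norm_smul, Real.norm_of_nonneg (by linarith)]
  nlinarith

namespace KernelHyp
variable {d : ℕ} {α : ℝ} {κ : ℝ → ℝ} {p : ℝ → Ed d → Ed d → ℝ≥0∞}

lemma K1bound (hK : KernelHyp d α κ p) {δ ε A : ℝ} (hδ : 0 < δ) (hδ2 : δ ≤ (d - α) / 2)
    (hε : 0 < ε) (hεα : ε ≤ α / 2) (hεδ : ε < δ) (hA : 0 ≤ A) :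
    ∃ K : ℝ, 0 < K ∧ ∀ N : ℕ, ∀ x y : Ed d, x ≠ 0 → y ≠ 0 →
      PT volume p (UN d (κ δ) A α ε N) 1 x y ≤ ENNReal.ofReal K * (HH d δ x * HH d δ y) := by
  have hα := hK.αpos
  have hαd := hK.αlt
  have hκ0 : 0 < κ δ := hK.kpos δ hδ (by linarith)
  have hdn : (0:ℝ) ≤ d := Nat.cast_nonneg d
  obtain ⟨C1, hC1, h21⟩ := hK.sup21 hδ hδ2 hε hεα hεδ hA
  obtain ⟨CD, hCD, hD⟩ := hK.lemD
  obtain ⟨Cu, hCu, hup⟩ := hK.up1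
  set F : ℝ := (4:ℝ) ^ ((d:ℝ) / α) with hF
  have hFpos : 0 < F := by positivity
  obtain ⟨r, hr, hr1, hrη⟩ := exists_small_pow (a := α - ε) (η := 1 / (8 * F * C1)) (by linarith) (by positivity)
  set b : ℝ := UU (κ δ) A α ε (r / 2) with hb
  have hbnn : 0 ≤ b := UU_nonneg hκ0.le hA (by positivity)
  set τ : ℝ := min (1/8) (1 / (2 * (b + 1))) with hτ
  have hτ0 : 0 < τ := by positivity
  have hτ1 : τ ≤ 1/8 := min_le_left _ _
  have hτb : τ * b ≤ 1/2 := by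
    calc τ * b ≤ 1 / (2 * (b + 1)) * b := by gcongr; exact min_le_right _ _
      _ ≤ 1/2 := by rw [div_mul_eq_mul_div, div_le_div_iff₀ (by positivity) (by norm_num)]; linarith
  set C' : ℝ := 2 * (Cu * τ ^ (-(d:ℝ) / α)) + CD * τ * (r / 2) ^ (-(d : ℝ) - α) * C1 with hC'
  have hC'pos : 0 < C' := by positivity
  clear_value F b τ C'
  refine ⟨2 * (C' * C1 * C1), by positivity, ?_⟩
  intro N
  set q := UN d (κ δ) A α ε N with hq
  have hqm : Measurable q := UN_meas _ _ _ _ _ _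
  have hqU : ∀ z, z ≠ 0 → q z ≤ ENNReal.ofReal (UU (κ δ) A α ε ‖z‖) := fun z _ => min_le_left _ _
  have hqN : ∀ z, q z ≤ ENNReal.ofReal (N:ℝ) := fun z => by
    rw [ENNReal.ofReal_natCast]; exact min_le_right _ _
  have h21 := h21 q hqm hqU N (Nat.cast_nonneg N) hqN
  have hD := hD q hqm N (Nat.cast_nonneg N) hqN
  have hJ : JM (PT volume p q) := PT_JM volume hK.jm hqm
  have hsymm := PT_symm volume hK.jm hqm hK.symm
  have hck := PT_CK volume hK.jm hqm hK.ck
  have hae := ae_ne0 hK.dpos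
  set P := PT volume p q with hP
  -- away from the origin
  have far : ∀ s, 1/4 ≤ s → s ≤ 3/4 → ∀ x y : Ed d, x ≠ 0 → r ≤ ‖y‖ → P s x y ≤ ENNReal.ofReal (C' * C1) * HH d δ x := by
    intro s hs1 hs2 x y hx hy
    have hy0 : y ≠ 0 := by rintro rfl; simp at hy; linarith
    have h1 : ∀ z, z ≠ 0 → P τ z y ≤ ENNReal.ofReal C' * HH d δ z := by
      intro z hz
      have e := hD b hbnn z y hy0 (fun w hw => (min_le_left _ _).trans (ENNReal.ofReal_le_ofReal (by
        rw [hb]; exact UU_anti hκ0.le hA hα hεα (by positivity) (by linarith)))) τ hτ0 hτb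
      refine e.trans ?_
      have e2 : TI volume P τ q z ≤ ENNReal.ofReal C1 * HH d δ z :=
        (TI_mono_t volume (by linarith) z).trans (h21 z hz).2.2
      have e3 : (‖y‖ / 2) ^ (-(d : ℝ) - α) ≤ (r / 2) ^ (-(d : ℝ) - α) :=
        rpow_le_rpow_of_nonpos (by positivity) (by linarith) (by linarith)
      calc _ ≤ ENNReal.ofReal 2 * ENNReal.ofReal (Cu * τ ^ (-(d:ℝ) / α)) * HH d δ z + ENNReal.ofReal (CD * τ * (r / 2) ^ (-(d : ℝ) - α)) * (ENNReal.ofReal C1 * HH d δ z) := by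
            apply add_le_add
            · rw [show ENNReal.ofReal 2 = 2 by simp]
              calc _ ≤ 2 * ENNReal.ofReal (Cu * τ ^ (-(d:ℝ) / α)) * 1 := by
                    rw [mul_one]; gcongr; exact hup τ hτ0 z y
                _ ≤ _ := by gcongr; exact HH_one_le _ _ _
            · exact mul_le_mul' (ENNReal.ofReal_le_ofReal (by gcongr)) e2
        _ = _ := by
            rw [hC', ENNReal.ofReal_add (by positivity) (by positivity), ENNReal.ofReal_mul (p := 2) (by norm_num),
              ENNReal.ofReal_mul (p := CD * τ * (r / 2) ^ (-(d : ℝ) - α)) (by positivity)]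
            ring
    calc P s x y = ∫⁻ z, P (s - τ) x z * P τ z y := by
          rw [hck (s - τ) τ (by linarith) hτ0]; congr 1; ring
      _ ≤ ∫⁻ z, P (s - τ) x z * (ENNReal.ofReal C' * HH d δ z) := by
          apply lintegral_mono_ae
          filter_upwards [hae] with z hz
          gcongr; exact h1 z hz
      _ = ENNReal.ofReal C' * PO volume P (s - τ) (HH d δ) x := PO_cmul volume hJ (HH_meas d δ) _ _ x
      _ ≤ ENNReal.ofReal C' * (ENNReal.ofReal C1 * HH d δ x) := by
          gcongr; exact (h21 x hx).1 _ (by linarith) (by linarith)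
      _ = _ := by rw [ENNReal.ofReal_mul hC'pos.le]; ring
  -- the sup
  set M : ℝ≥0∞ := ⨆ w : {x : Ed d // x ≠ 0} × {x : Ed d // x ≠ 0}, P 1 w.1.1 w.2.1 / (HH d δ w.1.1 * HH d δ w.2.1) with hM
  have hHHne : ∀ x y, HH d δ x * HH d δ y ≠ ∞ := fun x y => ENNReal.mul_ne_top (HH_ne_top _ _ _) (HH_ne_top _ _ _)
  have hHH1 : ∀ x y, 1 ≤ HH d δ x * HH d δ y := fun x y => by
    calc (1:ℝ≥0∞) = 1 * 1 := (one_mul _).symm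
      _ ≤ _ := mul_le_mul' (HH_one_le _ _ _) (HH_one_le _ _ _)
  have hHHpos : ∀ x y, HH d δ x * HH d δ y ≠ 0 := fun x y => (lt_of_lt_of_le one_pos (hHH1 x y)).ne'
  have hMle : ∀ x y, x ≠ 0 → y ≠ 0 → P 1 x y ≤ M * (HH d δ x * HH d δ y) := by
    intro x y hx hy
    rw [← ENNReal.div_le_iff (hHHpos x y) (hHHne x y)]
    exact le_iSup (fun w : {x : Ed d // x ≠ 0} × {x : Ed d // x ≠ 0} => P 1 w.1.1 w.2.1 / (HH d δ w.1.1 * HH d δ w.2.1)) ⟨⟨x, hx⟩, ⟨y, hy⟩⟩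
  have hMfin : M ≠ ∞ := by
    have : M ≤ ENNReal.ofReal (Real.exp (N * 1)) * ENNReal.ofReal (Cu * 1 ^ (-(d:ℝ) / α)) := by
      apply iSup_le; rintro ⟨⟨x, hx⟩, ⟨y, hy⟩⟩
      rw [ENNReal.div_le_iff (hHHpos x y) (hHHne x y)]
      calc P 1 x y ≤ ENNReal.ofReal (Real.exp (N * 1)) * p 1 x y := PT_le_of_bdd volume hK.jm hK.ck N (Nat.cast_nonneg N) hqN 1 one_pos x y
        _ ≤ ENNReal.ofReal (Real.exp (N * 1)) * ENNReal.ofReal (Cu * 1 ^ (-(d:ℝ) / α)) * 1 := by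
            exact (mul_le_mul' le_rfl (hup 1 one_pos x y)).trans (le_of_eq (mul_one _).symm)
        _ ≤ _ := mul_le_mul' le_rfl (hHH1 x y)
    exact ne_top_of_le_ne_top (ENNReal.mul_ne_top ENNReal.ofReal_ne_top ENNReal.ofReal_ne_top) this
  have near : ∀ s, 1/4 ≤ s → s ≤ 3/4 → ∀ x y : Ed d, x ≠ 0 → y ≠ 0 → P s x y ≤ ENNReal.ofReal F * M * (HH d δ x * HH d δ y) := by
    intro s hs1 hs2 x y hx hy
    have hs0 : 0 < s := by linarith
    have hl : 0 < s ^ (1 / α) := by positivity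
    have hl1 : s ^ (1 / α) ≤ 1 := rpow_le_one hs0.le (by linarith) (by positivity)
    rw [hP, hK.PT_scal' s hs0 x y]
    have hscq : ∀ z, scq α (s ^ (1 / α)) q z ≤ q z := by
      intro z
      have hlα : (s ^ (1 / α)) ^ α ≤ 1 := rpow_le_one hl.le hl1 hα.le
      apply le_min
      · calc _ ≤ ENNReal.ofReal ((s ^ (1 / α)) ^ α) * ENNReal.ofReal (UU (κ δ) A α ε ‖(s ^ (1 / α)) • z‖) := by
              unfold scq; gcongr; exact min_le_left _ _
          _ ≤ _ := by
              rw [← ENNReal.ofReal_mul (by positivity), norm_smul, Real.norm_of_nonneg hl.le]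
              exact ENNReal.ofReal_le_ofReal (UU_scale hA hα hε hl hl1 (norm_nonneg _))
      · calc _ ≤ 1 * (N : ℝ≥0∞) := mul_le_mul' (by simpa using hlα) (min_le_right _ _)
          _ = N := one_mul _
    have hinv : 1 ≤ (s ^ (1 / α))⁻¹ := (one_le_inv₀ hl).2 hl1
    have hne : ∀ x : Ed d, x ≠ 0 → (s ^ (1 / α))⁻¹ • x ≠ 0 := fun x hx => smul_ne_zero (by positivity) hx
    calc _ ≤ ENNReal.ofReal F * (M * (HH d δ x * HH d δ y)) := by
          apply mul_le_mul'
          · apply ENNReal.ofReal_le_ofReal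
            rw [hF, show (4:ℝ) = (1/4:ℝ)⁻¹ by norm_num, inv_rpow (by norm_num), ← rpow_neg (by norm_num), neg_div]
            apply rpow_le_rpow_of_nonpos (by norm_num) hs1
            have : 0 ≤ (d:ℝ) / α := by positivity
            linarith
          · refine (PT_mono volume (ae_of_all _ hscq) _ _ _).trans ((hMle _ _ (hne x hx) (hne y hy)).trans ?_)
            exact mul_le_mul' le_rfl (mul_le_mul' (HH_scale hδ hinv hx) (HH_scale hδ hinv hy))
      _ = _ := by ring
  have key : ∀ x y, x ≠ 0 → y ≠ 0 → P 1 x y ≤ (ENNReal.ofReal (C' * C1 * C1) + M / 2) * (HH d δ x * HH d δ y) := by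
    intro x y hx hy
    set β : ℝ≥0∞ := ENNReal.ofReal (F * (2 * r ^ (α - ε))) * M * HH d δ x with hβ
    have hβfin : β ≠ ∞ := ENNReal.mul_ne_top (ENNReal.mul_ne_top ENNReal.ofReal_ne_top hMfin) (HH_ne_top _ _ _)
    have hpt : ∀ s, 1/4 ≤ s → s ≤ 3/4 → ∀ z, z ≠ 0 → P s x z ≤ ENNReal.ofReal (C' * C1) * HH d δ x * HH d δ z + β * hp d (δ - ε + α) z := by
      intro s hs1 hs2 z hz
      rcases le_or_gt r ‖z‖ with h | h
      · refine le_add_right ((far s hs1 hs2 x z hx h).trans ?_)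
        exact le_mul_of_one_le_right (zero_le) (HH_one_le _ _ _)
      · refine le_add_left ((near s hs1 hs2 x z hx hz).trans ?_)
        have hz0 : 0 < ‖z‖ := norm_pos_iff.2 hz
        have e : HH d δ z ≤ ENNReal.ofReal (2 * r ^ (α - ε)) * hp d (δ - ε + α) z := by
          unfold HH hp
          rw [← ENNReal.ofReal_one, ← ENNReal.ofReal_add (by positivity) (by positivity), ← ENNReal.ofReal_mul (by positivity)]
          apply ENNReal.ofReal_le_ofReal
          have a1 : 1 ≤ ‖z‖ ^ (-δ) := one_le_rpow_of_pos_of_le_one_of_nonpos hz0 (by linarith) (by linarith)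
          have a2 : ‖z‖ ^ (-δ) = ‖z‖ ^ (α - ε) * ‖z‖ ^ (-(δ - ε + α)) := by rw [← rpow_add hz0]; ring_nf
          have a3 : ‖z‖ ^ (α - ε) ≤ r ^ (α - ε) := rpow_le_rpow hz0.le h.le (by linarith)
          have a4 : ‖z‖ ^ (α - ε) * ‖z‖ ^ (-(δ - ε + α)) ≤ r ^ (α - ε) * ‖z‖ ^ (-(δ - ε + α)) := by gcongr
          rw [← a2] at a4
          linarith
        calc _ ≤ ENNReal.ofReal F * M * (HH d δ x * (ENNReal.ofReal (2 * r ^ (α - ε)) * hp d (δ - ε + α) z)) := by gcongr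
          _ = _ := by rw [hβ, ENNReal.ofReal_mul hFpos.le]; ring
    have hz : ∀ s ∈ Ioo (1/4:ℝ) (3/4), P 1 x y ≤ ENNReal.ofReal (C' * C1) * HH d δ x * (ENNReal.ofReal C1 * HH d δ y) + β * PO volume P (1 - s) (hp d (δ - ε + α)) y := by
      intro s hs
      calc P 1 x y = ∫⁻ z, P s x z * P (1 - s) z y := by
            rw [hck s (1 - s) (by linarith [hs.1]) (by linarith [hs.2])]; congr 1; ring
        _ ≤ ∫⁻ z, P (1 - s) y z * (ENNReal.ofReal (C' * C1) * HH d δ x * HH d δ z + β * hp d (δ - ε + α) z) := by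
            apply lintegral_mono_ae
            filter_upwards [hae] with z hz
            rw [hsymm (1 - s) y z, mul_comm]
            gcongr
            exact hpt s hs.1.le hs.2.le z hz
        _ = ENNReal.ofReal (C' * C1) * HH d δ x * PO volume P (1 - s) (HH d δ) y + β * PO volume P (1 - s) (hp d (δ - ε + α)) y := by
            rw [← PO_cmul volume hJ (HH_meas d δ), ← PO_cmul volume hJ (hp_meas d _), ← PO_add volume hJ ((HH_meas d δ).const_mul _)]
            rfl
        _ ≤ _ := by
            gcongr; exact (h21 y hy).1 _ (by linarith [hs.2]) (by linarith [hs.1])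
    have hInt0 : ENNReal.ofReal (1/2) * P 1 x y ≤ ENNReal.ofReal (1/2) * (ENNReal.ofReal (C' * C1) * HH d δ x * (ENNReal.ofReal C1 * HH d δ y)) + β * (ENNReal.ofReal C1 * HH d δ y) := by
      calc ENNReal.ofReal (1/2) * P 1 x y = ∫⁻ s in Ioo (1/4:ℝ) (3/4), P 1 x y := by
            simp only [lintegral_const, MeasurableSet.univ, Measure.restrict_apply, univ_inter, Real.volume_Ioo]
            rw [mul_comm]; norm_num
        _ ≤ ∫⁻ s in Ioo (1/4:ℝ) (3/4), (ENNReal.ofReal (C' * C1) * HH d δ x * (ENNReal.ofReal C1 * HH d δ y) + β * PO volume P (1 - s) (hp d (δ - ε + α)) y) := by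
            apply setLIntegral_mono' measurableSet_Ioo
            intro s hs; exact hz s hs
        _ = ENNReal.ofReal (1/2) * (ENNReal.ofReal (C' * C1) * HH d δ x * (ENNReal.ofReal C1 * HH d δ y)) + β * ∫⁻ s in Ioo (1/4:ℝ) (3/4), PO volume P (1 - s) (hp d (δ - ε + α)) y := by
            rw [lintegral_add_left measurable_const, lintegral_const_mul' β _ hβfin]
            simp only [lintegral_const, MeasurableSet.univ, Measure.restrict_apply, univ_inter, Real.volume_Ioo]
            congr 1
            rw [mul_comm]; norm_num
        _ ≤ _ := by
            gcongr
            calc _ ≤ ∫⁻ s in Ioo (0:ℝ) 1, PO volume P (1 - s) (hp d (δ - ε + α)) y :=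
                  lintegral_mono_set (Ioo_subset_Ioo (by norm_num) (by norm_num))
              _ = TI volume P 1 (hp d (δ - ε + α)) y := lintegral_refl_Ioo (fun s => PO volume P s (hp d (δ - ε + α)) y) 1
              _ ≤ _ := (h21 y hy).2.1
    have hfac : F * (2 * r ^ (α - ε)) * C1 ≤ 1/4 := by
      have : F * (2 * r ^ (α - ε)) * C1 ≤ F * (2 * (1 / (8 * F * C1))) * C1 := by gcongr
      refine this.trans (le_of_eq ?_)
      field_simp; norm_num
    calc P 1 x y = ENNReal.ofReal 2 * (ENNReal.ofReal (1/2) * P 1 x y) := by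
          rw [← mul_assoc, ← ENNReal.ofReal_mul (by norm_num)]; norm_num
      _ ≤ ENNReal.ofReal 2 * (ENNReal.ofReal (1/2) * (ENNReal.ofReal (C' * C1) * HH d δ x * (ENNReal.ofReal C1 * HH d δ y)) + β * (ENNReal.ofReal C1 * HH d δ y)) := by gcongr
      _ = (ENNReal.ofReal (2 * (1/2) * (C' * C1 * C1)) + ENNReal.ofReal (2 * (F * (2 * r ^ (α - ε)) * C1)) * M) * (HH d δ x * HH d δ y) := by
          rw [ENNReal.ofReal_mul (p := 2 * (1/2)) (by norm_num), ENNReal.ofReal_mul (p := 2) (by norm_num), ENNReal.ofReal_mul (p := C' * C1) (by positivity),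
            ENNReal.ofReal_mul (p := 2) (by norm_num), ENNReal.ofReal_mul (p := F * (2 * r ^ (α - ε))) (by positivity), hβ]
          ring
      _ ≤ _ := by
          refine mul_le_mul' (add_le_add ?_ ?_) le_rfl
          · exact ENNReal.ofReal_le_ofReal (by norm_num)
          · calc ENNReal.ofReal (2 * (F * (2 * r ^ (α - ε)) * C1)) * M ≤ ENNReal.ofReal (1/2) * M :=
                  mul_le_mul' (ENNReal.ofReal_le_ofReal (by linarith)) le_rfl
              _ = M / 2 := by
                  rw [ENNReal.ofReal_div_of_pos (by norm_num), ENNReal.div_eq_inv_mul, ENNReal.div_eq_inv_mul]; simp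
  have hMb : M ≤ ENNReal.ofReal (C' * C1 * C1) + M / 2 := by
    apply iSup_le; rintro ⟨⟨x, hx⟩, ⟨y, hy⟩⟩
    rw [ENNReal.div_le_iff (hHHpos x y) (hHHne x y)]
    exact key x y hx hy
  have hMb2 : M ≤ ENNReal.ofReal (2 * (C' * C1 * C1)) := by
    have e : M / 2 + M / 2 ≤ ENNReal.ofReal (C' * C1 * C1) + M / 2 := by rwa [ENNReal.add_halves]
    have e2 := (ENNReal.add_le_add_iff_right (ENNReal.div_ne_top hMfin (by norm_num))).1 e
    calc M = 2 * (M / 2) := by rw [ENNReal.mul_div_cancel (by norm_num) (by norm_num)]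
      _ ≤ 2 * ENNReal.ofReal (C' * C1 * C1) := by gcongr
      _ = _ := by rw [ENNReal.ofReal_mul (p := 2) (by norm_num)]; simp
  intro x y hx hy
  exact (hMle x y hx hy).trans (by gcongr)

end KernelHyp



/-- decay profile -/
def JJ (d : ℕ) (α : ℝ) (x y : Ed d) : ℝ≥0∞ := ENNReal.ofReal ((1 + ‖x - y‖) ^ (-(d : ℝ) - α))

lemma JJ_symm (d : ℕ) (α : ℝ) (x y : Ed d) : JJ d α x y = JJ d α y x := by
  unfold JJ; rw [norm_sub_rev]

lemma UU_large {κ0 A α ε : ℝ} (hκ : 0 ≤ κ0) (hA : 0 ≤ A) (hα : 0 < α) (hεα : ε ≤ α / 2) :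
    ∃ R : ℝ, 1 ≤ R ∧ UU κ0 A α ε (R / 2) ≤ 1 / 2 := by
  obtain ⟨ρ, h0, h1, h2⟩ := exists_small_pow (a := α / 2) (η := 1 / (2 * (κ0 + 2 * A + 1))) (by linarith) (by positivity)
  have h1' : 1 ≤ ρ⁻¹ := (one_le_inv₀ h0).2 h1.le
  refine ⟨2 * ρ⁻¹, by linarith, ?_⟩
  rw [show 2 * ρ⁻¹ / 2 = ρ⁻¹ by ring]
  have e : (ρ⁻¹) ^ (-(α / 2)) = ρ ^ (α / 2) := by rw [inv_rpow h0.le, rpow_neg h0.le, inv_inv]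
  have f1 : (ρ⁻¹) ^ (-α) ≤ ρ ^ (α / 2) := by rw [← e]; exact rpow_le_rpow_of_exponent_le h1' (by linarith)
  have f2 : (ρ⁻¹) ^ (-(α - ε)) ≤ ρ ^ (α / 2) := by rw [← e]; exact rpow_le_rpow_of_exponent_le h1' (by linarith)
  unfold UU
  rw [e]
  calc _ ≤ κ0 * ρ ^ (α / 2) + A * (ρ ^ (α / 2) + ρ ^ (α / 2)) := by gcongr
    _ = (κ0 + 2 * A) * ρ ^ (α / 2) := by ring
    _ ≤ (κ0 + 2 * A) * (1 / (2 * (κ0 + 2 * A + 1))) := by gcongr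
    _ ≤ 1 / 2 := by rw [mul_one_div, div_le_div_iff₀ (by positivity) (by norm_num)]; linarith

lemma JJ_ge {d : ℕ} {α : ℝ} (hα : 0 < α) {K r : ℝ} (hK : 0 < K) {x y : Ed d} (h : 1 + ‖x - y‖ ≤ K * r) :
    ENNReal.ofReal (r ^ (-(d : ℝ) - α)) ≤ ENNReal.ofReal (K ^ ((d : ℝ) + α)) * JJ d α x y := by
  unfold JJ
  have hdn : (0:ℝ) ≤ d := Nat.cast_nonneg d
  have hr : 0 < r := by
    have : 0 < K * r := by linarith [norm_nonneg (x - y)]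
    exact (pos_iff_pos_of_mul_pos this).1 hK
  rw [← ENNReal.ofReal_mul (by positivity)]
  apply ENNReal.ofReal_le_ofReal
  have := rpow_le_rpow_of_nonpos (z := -(d : ℝ) - α) (by positivity) h (by linarith)
  calc r ^ (-(d : ℝ) - α) = K ^ ((d : ℝ) + α) * (K * r) ^ (-(d : ℝ) - α) := by
        rw [mul_rpow hK.le hr.le, ← mul_assoc, ← rpow_add hK]; simp
    _ ≤ _ := by gcongr

lemma JJ_le {d : ℕ} {α : ℝ} (hα : 0 < α) {K : ℝ} (hK : 0 < K) {x y x' y' : Ed d} (h : 1 + ‖x - y‖ ≤ K * (1 + ‖x' - y'‖)) :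
    JJ d α x' y' ≤ ENNReal.ofReal (K ^ ((d : ℝ) + α)) * JJ d α x y := JJ_ge hα hK h

namespace KernelHyp
variable {d : ℕ} {α : ℝ} {κ : ℝ → ℝ} {p : ℝ → Ed d → Ed d → ℝ≥0∞}

lemma p1_le (hK : KernelHyp d α κ p) : ∃ C : ℝ, 0 < C ∧ ∀ x y, p 1 x y ≤ ENNReal.ofReal C * JJ d α x y := by
  have hα := hK.αpos
  have hdn : (0:ℝ) ≤ d := Nat.cast_nonneg d
  obtain ⟨C1, hC1, h1⟩ := hK.up1
  obtain ⟨C2, hC2, h2⟩ := hK.up2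
  refine ⟨(C1 + C2) * 2 ^ ((d:ℝ) + α), by positivity, fun x y => ?_⟩
  rcases le_or_gt ‖x - y‖ 1 with h | h
  · refine (h1 1 one_pos x y).trans ?_
    have := JJ_ge (d := d) hα (K := 2) (r := 1) (by norm_num) (x := x) (y := y) (by linarith)
    calc _ = ENNReal.ofReal C1 * ENNReal.ofReal (1 ^ (-(d : ℝ) - α)) := by simp
      _ ≤ ENNReal.ofReal (C1 + C2) * (ENNReal.ofReal (2 ^ ((d:ℝ) + α)) * JJ d α x y) :=
          mul_le_mul' (ENNReal.ofReal_le_ofReal (by linarith)) this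
      _ = _ := by rw [ENNReal.ofReal_mul (by positivity)]; ring
  · have hne : x ≠ y := by rintro rfl; simp at h; linarith
    refine (h2 1 one_pos x y hne).trans ?_
    have := JJ_ge (d := d) hα (K := 2) (r := ‖x - y‖) (by norm_num) (x := x) (y := y) (by linarith)
    calc _ = ENNReal.ofReal C2 * ENNReal.ofReal (‖x - y‖ ^ (-(d : ℝ) - α)) := by
          rw [mul_one, ENNReal.ofReal_mul hC2.le]
      _ ≤ ENNReal.ofReal (C1 + C2) * (ENNReal.ofReal (2 ^ ((d:ℝ) + α)) * JJ d α x y) :=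
          mul_le_mul' (ENNReal.ofReal_le_ofReal (by linarith)) this
      _ = _ := by rw [ENNReal.ofReal_mul (by positivity)]; ring

lemma up24 (hK : KernelHyp d α κ p) {δ ε A : ℝ} (hδ : 0 < δ) (hδ2 : δ ≤ (d - α) / 2)
    (hε : 0 < ε) (hεα : ε ≤ α / 2) (hεδ : ε < δ) (hA : 0 ≤ A) :
    ∃ K : ℝ, 0 < K ∧ ∀ V : Ed d → ℝ≥0∞, (∀ z, z ≠ 0 → V z ≤ ENNReal.ofReal (UU (κ δ) A α ε ‖z‖)) →
      ∀ x y : Ed d, x ≠ 0 → y ≠ 0 →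
      PT volume p V 1 x y ≤ ENNReal.ofReal K * (HH d δ x * HH d δ y * JJ d α x y) := by
  have hα := hK.αpos
  have hαd := hK.αlt
  have hκ0 : 0 < κ δ := hK.kpos δ hδ (by linarith)
  have hdn : (0:ℝ) ≤ d := Nat.cast_nonneg d
  obtain ⟨C1, hC1, h21⟩ := hK.sup21 hδ hδ2 hε hεα hεδ hA
  obtain ⟨CD, hCD, hD⟩ := hK.lemD
  obtain ⟨K1, hK1, hKb⟩ := hK.K1bound hδ hδ2 hε hεα hεδ hA
  obtain ⟨C3, hC3, hp1⟩ := hK.p1_le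
  obtain ⟨R, hR, hUR⟩ := UU_large (κ0 := κ δ) (A := A) (α := α) (ε := ε) hκ0.le hA hα hεα
  set C4 : ℝ := 2 * C3 + CD * 6 ^ ((d:ℝ) + α) * C1 with hC4
  set C5 : ℝ := K1 * (1 + 2 * R) ^ ((d:ℝ) + α) with hC5
  have hC4p : 0 < C4 := by positivity
  have hC5p : 0 < C5 := by positivity
  have hHH1 : ∀ x y, HH d δ x ≤ HH d δ x * HH d δ y := fun x y =>
    le_mul_of_one_le_right (zero_le) (HH_one_le _ _ _)
  have main : ∀ N : ℕ, ∀ x y : Ed d, x ≠ 0 → y ≠ 0 → ‖x‖ ≤ ‖y‖ →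
      PT volume p (UN d (κ δ) A α ε N) 1 x y ≤ ENNReal.ofReal (C4 + C5) * (HH d δ x * HH d δ y * JJ d α x y) := by
    intro N x y hx hy hxy
    have hn : ‖x - y‖ ≤ 2 * ‖y‖ := (norm_sub_le _ _).trans (by linarith)
    rcases le_or_gt R ‖y‖ with h | h
    · set q := UN d (κ δ) A α ε N with hq
      have hqm : Measurable q := UN_meas _ _ _ _ _ _
      have hqU : ∀ z, z ≠ 0 → q z ≤ ENNReal.ofReal (UU (κ δ) A α ε ‖z‖) := fun z _ => min_le_left _ _
      have hqN : ∀ z, q z ≤ ENNReal.ofReal (N:ℝ) := fun z => by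
        rw [ENNReal.ofReal_natCast]; exact min_le_right _ _
      have e := hD q hqm N (Nat.cast_nonneg N) hqN (1/2) (by norm_num) x y hy (fun w hw =>
        (min_le_left _ _).trans (ENNReal.ofReal_le_ofReal
          ((UU_anti hκ0.le hA hα hεα (by positivity) (by linarith)).trans hUR))) 1 one_pos (by norm_num)
      refine e.trans ?_
      have e1 := (h21 q hqm hqU N (Nat.cast_nonneg N) hqN x hx).2.2
      have e2 := JJ_ge (d := d) hα (K := 6) (r := ‖y‖ / 2) (by norm_num) (x := x) (y := y) (by linarith)
      calc _ ≤ ENNReal.ofReal 2 * (ENNReal.ofReal C3 * JJ d α x y) * HH d δ x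
              + ENNReal.ofReal CD * (ENNReal.ofReal (6 ^ ((d:ℝ) + α)) * JJ d α x y) * (ENNReal.ofReal C1 * HH d δ x) := by
            apply add_le_add
            · rw [show ENNReal.ofReal 2 = 2 by simp]
              exact (mul_le_mul' le_rfl (hp1 x y)).trans (le_mul_of_one_le_right zero_le (HH_one_le _ _ _))
            · refine mul_le_mul' ?_ e1
              rw [mul_one, ENNReal.ofReal_mul hCD.le]
              exact mul_le_mul' le_rfl e2
        _ = ENNReal.ofReal C4 * (HH d δ x * JJ d α x y) := by
            rw [hC4, ENNReal.ofReal_add (by positivity) (by positivity), ENNReal.ofReal_mul (p := 2) (by norm_num),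
              ENNReal.ofReal_mul (p := CD * 6 ^ ((d:ℝ) + α)) (by positivity), ENNReal.ofReal_mul (p := CD) (by positivity)]
            ring
        _ ≤ _ := mul_le_mul' (ENNReal.ofReal_le_ofReal (by linarith)) (mul_le_mul' (hHH1 x y) le_rfl)
    · refine (hKb N x y hx hy).trans ?_
      have e2 := JJ_ge (d := d) hα (K := 1 + 2 * R) (r := 1) (by linarith) (x := x) (y := y) (by linarith)
      rw [one_rpow, ENNReal.ofReal_one] at e2
      calc _ ≤ ENNReal.ofReal K1 * (HH d δ x * HH d δ y) * (ENNReal.ofReal ((1 + 2 * R) ^ ((d:ℝ) + α)) * JJ d α x y) :=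
            le_mul_of_one_le_right zero_le e2
        _ = ENNReal.ofReal C5 * (HH d δ x * HH d δ y * JJ d α x y) := by
            rw [hC5, ENNReal.ofReal_mul hK1.le]; ring
        _ ≤ _ := mul_le_mul' (ENNReal.ofReal_le_ofReal (by linarith)) le_rfl
  refine ⟨C4 + C5, by positivity, ?_⟩
  intro V hV x y hx hy
  have hmono : PT volume p V 1 x y ≤ PT volume p (fun z => ENNReal.ofReal (UU (κ δ) A α ε ‖z‖)) 1 x y := by
    apply PT_mono
    filter_upwards [ae_ne0 hK.dpos] with z hz using hV z hz
  refine hmono.trans ?_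
  apply PT_le_of_trunc volume hK.jm (Q := UN d (κ δ) A α ε) (fun N => UN_meas _ _ _ _ _ N)
  · intro i j hij z
    exact min_le_min le_rfl (by exact_mod_cast hij)
  · intro z
    unfold UN
    obtain ⟨n, hn⟩ := exists_nat_ge (UU (κ δ) A α ε ‖z‖)
    apply le_antisymm
    · refine le_iSup_of_le n (le_min le_rfl ?_)
      rw [← ENNReal.ofReal_natCast]; exact ENNReal.ofReal_le_ofReal hn
    · exact iSup_le fun n => min_le_left _ _
  · intro N
    rcases le_total ‖x‖ ‖y‖ with h | h
    · exact main N x y hx hy h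
    · rw [PT_symm volume hK.jm (UN_meas _ _ _ _ _ _) hK.symm, JJ_symm, mul_comm (HH d δ x)]
      exact main N y x hy hx h

end KernelHyp



section Abs6
variable {X : Type*} [MeasurableSpace X] (μ : Measure X) [SFinite μ] {p : ℝ → X → X → ℝ≥0∞} {q : X → ℝ≥0∞}

lemma PT_iSup (hp : JM p) {Q : ℕ → X → ℝ≥0∞} (hQ : ∀ N, Measurable (Q N)) (hmono : Monotone Q)
    (hsup : ∀ z, q z = ⨆ N, Q N z) (t : ℝ) (x y : X) : PT μ p q t x y = ⨆ N, PT μ p (Q N) t x y := by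
  apply le_antisymm
  · exact PT_le_of_trunc μ hp hQ hmono hsup (fun N => le_iSup (fun N => PT μ p (Q N) t x y) N)
  · exact iSup_le fun N => PT_mono μ (ae_of_all _ fun z => by rw [hsup z]; exact le_iSup (fun N => Q N z) N) t x y

lemma PO_iSup (hp : JM p) {Q : ℕ → X → ℝ≥0∞} (hQ : ∀ N, Measurable (Q N)) (hmono : Monotone Q)
    (hsup : ∀ z, q z = ⨆ N, Q N z) {f : X → ℝ≥0∞} (hf : Measurable f) (t : ℝ) (x : X) :
    PO μ (PT μ p q) t f x = ⨆ N, PO μ (PT μ p (Q N)) t f x := by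
  unfold PO
  rw [← lintegral_iSup]
  · apply lintegral_congr; intro z
    rw [PT_iSup μ hp hQ hmono hsup, ENNReal.iSup_mul]
  · intro N; exact ((PT_JM μ hp (hQ N)).sec t x).mul hf
  · intro i j hij z
    exact mul_le_mul' (PT_mono μ (ae_of_all _ fun z => hmono hij z) t x z) le_rfl

lemma TI_iSup (hp : JM p) {Q : ℕ → X → ℝ≥0∞} (hQ : ∀ N, Measurable (Q N)) (hmono : Monotone Q)
    (hsup : ∀ z, q z = ⨆ N, Q N z) {f : X → ℝ≥0∞} (hf : Measurable f) (t : ℝ) (x : X) :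
    TI μ (PT μ p q) t f x = ⨆ N, TI μ (PT μ p (Q N)) t f x := by
  have e : ∀ p' : ℝ → X → X → ℝ≥0∞, TI μ p' t f x = ∫⁻ s in Ioo (0:ℝ) t, PO μ p' s f x := fun _ => rfl
  simp_rw [e]
  rw [← lintegral_iSup]
  · apply lintegral_congr; intro s
    rw [PO_iSup μ hp hQ hmono hsup hf]
  · intro N; exact PO_sec μ (PT_JM μ hp (hQ N)) hf x
  · intro i j hij s
    apply lintegral_mono; intro z
    exact mul_le_mul' (PT_mono μ (ae_of_all _ fun z => hmono hij z) s x z) le_rfl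

end Abs6

/-- critical potential -/
def q0 (d : ℕ) (α c : ℝ) (z : Ed d) : ℝ≥0∞ := ENNReal.ofReal c * hp d α z

lemma q0_meas (d : ℕ) (α c : ℝ) : Measurable (q0 d α c) := (hp_meas d α).const_mul _

lemma q0_le {d : ℕ} {α c A ε : ℝ} (hc : 0 ≤ c) (hA : 0 ≤ A) (z : Ed d) : q0 d α c z ≤ ENNReal.ofReal (UU c A α ε ‖z‖) := by
  unfold q0 hp UU
  rw [← ENNReal.ofReal_mul hc]
  apply ENNReal.ofReal_le_ofReal
  have : 0 ≤ A * (‖z‖ ^ (-(α - ε)) + ‖z‖ ^ (-(α / 2))) := by positivity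
  linarith

lemma hp_mul {d : ℕ} {a b : ℝ} {z : Ed d} (hz : z ≠ 0) : hp d a z * hp d b z = hp d (b + a) z := by
  have : 0 < ‖z‖ := norm_pos_iff.2 hz
  unfold hp
  rw [← ENNReal.ofReal_mul (by positivity), ← rpow_add this]; congr 2; ring

namespace KernelHyp
variable {d : ℕ} {α : ℝ} {κ : ℝ → ℝ} {p : ℝ → Ed d → Ed d → ℝ≥0∞}

lemma sup21' (hK : KernelHyp d α κ p) {δ ε : ℝ} (hδ : 0 < δ) (hδ2 : δ ≤ (d - α) / 2)
    (hε : 0 < ε) (hεα : ε ≤ α / 2) (hεδ : ε < δ) :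
    ∃ C1 : ℝ, 1 ≤ C1 ∧ ∀ x, x ≠ 0 →
      (∀ t, 0 < t → t ≤ 1 → PO volume (PT volume p (q0 d α (κ δ))) t (HH d δ) x ≤ ENNReal.ofReal C1 * HH d δ x) ∧
      TI volume (PT volume p (q0 d α (κ δ))) 1 (hp d (δ - ε + α)) x ≤ ENNReal.ofReal C1 * HH d δ x := by
  have hα := hK.αpos
  have hαd := hK.αlt
  have hκ0 : 0 < κ δ := hK.kpos δ hδ (by linarith)
  obtain ⟨C1, hC1, h⟩ := hK.sup21 hδ hδ2 hε hεα hεδ (le_refl 0)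
  refine ⟨C1, hC1, fun x hx => ?_⟩
  set Q : ℕ → Ed d → ℝ≥0∞ := fun N z => min (q0 d α (κ δ) z) N with hQ
  have hQm : ∀ N, Measurable (Q N) := fun N => (q0_meas _ _ _).min measurable_const
  have hmono : Monotone Q := fun i j hij z => min_le_min le_rfl (by exact_mod_cast hij)
  have hsup : ∀ z, q0 d α (κ δ) z = ⨆ N, Q N z := by
    intro z
    have hfin : q0 d α (κ δ) z ≠ ∞ := ENNReal.mul_ne_top ENNReal.ofReal_ne_top ENNReal.ofReal_ne_top
    obtain ⟨n, hn⟩ := ENNReal.exists_nat_gt hfin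
    apply le_antisymm
    · exact le_iSup_of_le n (le_min le_rfl hn.le)
    · exact iSup_le fun n => min_le_left _ _
  have h' := fun N : ℕ => h (Q N) (hQm N) (fun z _ => (min_le_left _ _).trans (q0_le hκ0.le le_rfl z)) N (Nat.cast_nonneg N)
    (fun z => by rw [ENNReal.ofReal_natCast]; exact min_le_right _ _) x hx
  constructor
  · intro t ht ht1
    rw [PO_iSup volume hK.jm hQm hmono hsup (HH_meas d δ)]
    exact iSup_le fun N => (h' N).1 t ht ht1
  · rw [TI_iSup volume hK.jm hQm hmono hsup (hp_meas d _)]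
    exact iSup_le fun N => (h' N).2.1

lemma hardy_low (hK : KernelHyp d α κ p) {δ ε : ℝ} (hδ : 0 < δ) (hδ2 : δ ≤ (d - α) / 2)
    (hε : 0 < ε) (hεα : ε ≤ α / 2) (hεδ : ε < δ) {x : Ed d} (hx : x ≠ 0) {t : ℝ} (ht : 0 < t) (ht1 : t ≤ 1) :
    hp d (δ - ε) x ≤ PO volume (PT volume p (q0 d α (κ δ))) t (hp d (δ - ε)) x := by
  have hα := hK.αpos
  have hαd := hK.αlt
  obtain ⟨C1, hC1, h⟩ := hK.sup21' hδ hδ2 hε hεα hεδ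
  have hκlt : κ (δ - ε) < κ δ := hK.kmono _ _ (by linarith) (by linarith) hδ2
  have hq := q0_meas d α (κ δ)
  have hJ := PT_JM volume hK.jm hq
  have hh : ∀ z : Ed d, z ≠ 0 → ∀ t, 0 < t → PO volume p t (hp d (δ - ε)) z + TI volume p t (fun z => ENNReal.ofReal (κ (δ - ε)) * hp d (δ - ε + α) z) z
      = hp d (δ - ε) z + TI volume p t (fun _ => 0) z := by
    intro z hz t ht
    have e : TI volume p t (fun _ => 0) z = 0 := by simp [TI, PO]
    rw [TI_cmul volume hK.jm (hp_meas d _), e, add_zero]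
    exact hK.hardy _ (by linarith) (by linarith) t ht z hz
  have key := pert_identity volume hK.jm hq (hp_meas d (δ - ε)) ((hp_meas d (δ - ε + α)).const_mul _) measurable_const x
    (by filter_upwards [ae_ne0 hK.dpos] with z hz using hh z hz) (hh x hx) t ht
  have e : TI volume (PT volume p (q0 d α (κ δ))) t (fun _ => 0) x = 0 := by simp [TI, PO]
  rw [e, add_zero, TI_cmul volume hJ (hp_meas d _)] at key
  set Tt := TI volume (PT volume p (q0 d α (κ δ))) t (hp d (δ - ε + α)) x with hT
  have e2 : ENNReal.ofReal (κ (δ - ε)) * Tt ≤ TI volume (PT volume p (q0 d α (κ δ))) t (fun z => q0 d α (κ δ) z * hp d (δ - ε) z) x := by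
    calc _ ≤ ENNReal.ofReal (κ δ) * Tt := mul_le_mul' (ENNReal.ofReal_le_ofReal hκlt.le) le_rfl
      _ = TI volume (PT volume p (q0 d α (κ δ))) t (fun z => ENNReal.ofReal (κ δ) * hp d (δ - ε + α) z) x :=
          (TI_cmul volume hJ (hp_meas d _) _ _ _).symm
      _ ≤ _ := by
          apply TI_mono
          filter_upwards [ae_ne0 hK.dpos] with z hz
          unfold q0
          rw [mul_assoc, hp_mul hz]
  have hfin : ENNReal.ofReal (κ (δ - ε)) * Tt ≠ ∞ := by
    apply ENNReal.mul_ne_top ENNReal.ofReal_ne_top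
    refine ne_top_of_le_ne_top ?_ ((TI_mono_t volume ht1 x).trans (h x hx).2)
    exact ENNReal.mul_ne_top ENNReal.ofReal_ne_top (HH_ne_top _ _ _)
  rw [← ENNReal.add_le_add_iff_right hfin, key]
  gcongr

/-- the middle region mass -/
lemma mid_low (hK : KernelHyp d α κ p) {δ : ℝ} (hδ : 0 < δ) (hδ2 : δ ≤ (d - α) / 2) :
    ∃ c R : ℝ, 0 < c ∧ 0 < R ∧ ∀ x : Ed d, x ≠ 0 → ‖x‖ ≤ 1 →
      ENNReal.ofReal c * HH d δ x ≤ TI volume (PT volume p (q0 d α (κ δ))) (1/3) ((Metric.closedBall (0 : Ed d) R).indicator 1) x := by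
  have hα := hK.αpos
  have hαd := hK.αlt
  set ε0 : ℝ := min (α / 2) (δ / 2) with hε0
  have hε0p : 0 < ε0 := by positivity
  have hε0α : ε0 ≤ α / 2 := min_le_left _ _
  have hε0δ : ε0 ≤ δ / 2 := min_le_right _ _
  clear_value ε0
  obtain ⟨C1, hC1, h21⟩ := hK.sup21' hδ hδ2 hε0p hε0α (by linarith)
  obtain ⟨r, hr, hr1, hrη⟩ := exists_small_pow (a := α - ε0) (η := 1 / (24 * C1)) (by linarith) (by positivity)
  obtain ⟨ρ, hρ, hρ1, hρη⟩ := exists_small_pow (a := δ / 2) (η := 1 / (24 * C1)) (by linarith) (by positivity)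
  refine ⟨r ^ δ / 12, ρ⁻¹, by positivity, by positivity, ?_⟩
  intro x hx hx1
  set R := ρ⁻¹ with hR
  have hR1 : 1 ≤ R := (one_le_inv₀ hρ).2 hρ1.le
  have hRη : R ^ (-(δ / 2)) ≤ 1 / (24 * C1) := by
    rw [hR, inv_rpow hρ.le, rpow_neg hρ.le, inv_inv]; exact hρη
  have hq := q0_meas d α (κ δ)
  have hJ := PT_JM volume hK.jm hq
  set P := PT volume p (q0 d α (κ δ)) with hP
  set I : Ed d → ℝ≥0∞ := (Metric.closedBall (0 : Ed d) R).indicator 1 with hI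
  have hIm : Measurable I := measurable_one.indicator Metric.isClosed_closedBall.measurableSet
  have step : ∀ ε, 0 < ε → ε < ε0 → ENNReal.ofReal (1/3) * hp d (δ - ε) x ≤
      ENNReal.ofReal (r ^ (α - ε0) * C1 + R ^ (-(δ / 2)) * C1) * HH d δ x + ENNReal.ofReal (r ^ (-δ)) * TI volume P (1/3) I x := by
    intro ε hε hεε
    have hpt : ∀ z : Ed d, z ≠ 0 → hp d (δ - ε) z ≤ ENNReal.ofReal (r ^ (α - ε0)) * hp d (δ - ε0 + α) z +
        (ENNReal.ofReal (R ^ (-(δ / 2))) * HH d δ z + ENNReal.ofReal (r ^ (-δ)) * I z) := by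
      intro z hz
      have hz0 : 0 < ‖z‖ := norm_pos_iff.2 hz
      rcases lt_or_ge ‖z‖ r with h | h
      · refine le_add_right ?_
        unfold hp
        rw [← ENNReal.ofReal_mul (by positivity)]
        apply ENNReal.ofReal_le_ofReal
        calc ‖z‖ ^ (-(δ - ε)) ≤ ‖z‖ ^ (-δ) := rpow_le_rpow_of_exponent_ge hz0 (by linarith) (by linarith)
          _ = ‖z‖ ^ (α - ε0) * ‖z‖ ^ (-(δ - ε0 + α)) := by rw [← rpow_add hz0]; ring_nf
          _ ≤ _ := by gcongr; linarith
      · refine le_add_left ?_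
        rcases lt_or_ge R ‖z‖ with h2 | h2
        · refine le_add_right ?_
          calc hp d (δ - ε) z ≤ ENNReal.ofReal (R ^ (-(δ / 2))) * 1 := by
                rw [mul_one]; apply ENNReal.ofReal_le_ofReal
                calc ‖z‖ ^ (-(δ - ε)) ≤ R ^ (-(δ - ε)) := rpow_le_rpow_of_nonpos (by linarith) h2.le (by linarith)
                  _ ≤ _ := rpow_le_rpow_of_exponent_le hR1 (by linarith)
            _ ≤ _ := mul_le_mul' le_rfl (HH_one_le _ _ _)
        · refine le_add_left ?_
          have : I z = 1 := by
            rw [hI, indicator_of_mem]; · rfl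
            · simpa using h2
          rw [this, mul_one]
          apply ENNReal.ofReal_le_ofReal
          calc ‖z‖ ^ (-(δ - ε)) ≤ r ^ (-(δ - ε)) := rpow_le_rpow_of_nonpos hr h (by linarith)
            _ ≤ _ := rpow_le_rpow_of_exponent_ge hr hr1.le (by linarith)
    have hs : ∀ s ∈ Ioo (0:ℝ) (1/3), hp d (δ - ε) x ≤ ENNReal.ofReal (r ^ (α - ε0)) * PO volume P s (hp d (δ - ε0 + α)) x +
        (ENNReal.ofReal (R ^ (-(δ / 2))) * (ENNReal.ofReal C1 * HH d δ x) + ENNReal.ofReal (r ^ (-δ)) * PO volume P s I x) := by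
      intro s hs
      refine (hK.hardy_low hδ hδ2 hε (by linarith) (by linarith) hx hs.1 (by linarith [hs.2])).trans ?_
      calc _ ≤ PO volume P s (fun z => ENNReal.ofReal (r ^ (α - ε0)) * hp d (δ - ε0 + α) z +
              (ENNReal.ofReal (R ^ (-(δ / 2))) * HH d δ z + ENNReal.ofReal (r ^ (-δ)) * I z)) x := by
            apply PO_mono
            filter_upwards [ae_ne0 hK.dpos] with z hz using hpt z hz
        _ = ENNReal.ofReal (r ^ (α - ε0)) * PO volume P s (hp d (δ - ε0 + α)) x +
            (ENNReal.ofReal (R ^ (-(δ / 2))) * PO volume P s (HH d δ) x + ENNReal.ofReal (r ^ (-δ)) * PO volume P s I x) := by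
            rw [PO_add volume hJ ((hp_meas d _).const_mul _), PO_add volume hJ ((HH_meas d _).const_mul _),
              PO_cmul volume hJ (hp_meas d _), PO_cmul volume hJ (HH_meas d _), PO_cmul volume hJ hIm]
        _ ≤ _ := by
            refine add_le_add le_rfl (add_le_add (mul_le_mul' le_rfl ?_) le_rfl)
            exact (h21 x hx).1 s hs.1 (by linarith [hs.2])
    have vol : ∀ a : ℝ≥0∞, ∫⁻ _ in Ioo (0:ℝ) (1/3), a = ENNReal.ofReal (1/3) * a := by
      intro a
      simp only [lintegral_const, MeasurableSet.univ, Measure.restrict_apply, univ_inter, Real.volume_Ioo]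
      rw [mul_comm]; norm_num
    calc _ = ∫⁻ s in Ioo (0:ℝ) (1/3), hp d (δ - ε) x := (vol _).symm
      _ ≤ ∫⁻ s in Ioo (0:ℝ) (1/3), (ENNReal.ofReal (r ^ (α - ε0)) * PO volume P s (hp d (δ - ε0 + α)) x +
        (ENNReal.ofReal (R ^ (-(δ / 2))) * (ENNReal.ofReal C1 * HH d δ x) + ENNReal.ofReal (r ^ (-δ)) * PO volume P s I x)) :=
          setLIntegral_mono' measurableSet_Ioo hs
      _ = ENNReal.ofReal (r ^ (α - ε0)) * TI volume P (1/3) (hp d (δ - ε0 + α)) x +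
          (ENNReal.ofReal (1/3) * (ENNReal.ofReal (R ^ (-(δ / 2))) * (ENNReal.ofReal C1 * HH d δ x)) + ENNReal.ofReal (r ^ (-δ)) * TI volume P (1/3) I x) := by
          rw [lintegral_add_left ((PO_sec volume hJ (hp_meas d _) x).const_mul _), lintegral_add_left measurable_const,
            lintegral_const_mul _ (PO_sec volume hJ (hp_meas d _) x), lintegral_const_mul _ (PO_sec volume hJ hIm x), vol]
          rfl
      _ ≤ ENNReal.ofReal (r ^ (α - ε0)) * (ENNReal.ofReal C1 * HH d δ x) +
          (1 * (ENNReal.ofReal (R ^ (-(δ / 2))) * (ENNReal.ofReal C1 * HH d δ x)) + ENNReal.ofReal (r ^ (-δ)) * TI volume P (1/3) I x) := by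
          refine add_le_add (mul_le_mul' le_rfl ?_) (add_le_add (mul_le_mul' ?_ le_rfl) le_rfl)
          · exact (TI_mono_t volume (by norm_num) x).trans (h21 x hx).2
          · rw [← ENNReal.ofReal_one]; exact ENNReal.ofReal_le_ofReal (by norm_num)
      _ = _ := by
          rw [ENNReal.ofReal_add (by positivity) (by positivity), ENNReal.ofReal_mul (p := r ^ (α - ε0)) (by positivity),
            ENNReal.ofReal_mul (p := R ^ (-(δ / 2))) (by positivity)]
          ring
  have hx0 : 0 < ‖x‖ := norm_pos_iff.2 hx
  have lim : ENNReal.ofReal (1/3) * hp d δ x ≤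
      ENNReal.ofReal (r ^ (α - ε0) * C1 + R ^ (-(δ / 2)) * C1) * HH d δ x + ENNReal.ofReal (r ^ (-δ)) * TI volume P (1/3) I x := by
    have ht : Tendsto (fun ε : ℝ => ENNReal.ofReal (1/3) * hp d (δ - ε) x) (𝓝[>] 0) (𝓝 (ENNReal.ofReal (1/3) * hp d δ x)) := by
      apply ENNReal.Tendsto.const_mul _ (Or.inr ENNReal.ofReal_ne_top)
      unfold hp
      apply ENNReal.tendsto_ofReal
      have : Continuous (fun ε : ℝ => ‖x‖ ^ (-(δ - ε))) :=
        Continuous.rpow continuous_const (by fun_prop) (fun _ => Or.inl hx0.ne')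
      have h0 := this.tendsto 0
      simp only [sub_zero] at h0
      exact h0.mono_left nhdsWithin_le_nhds
    apply le_of_tendsto ht
    filter_upwards [Ioo_mem_nhdsGT hε0p] with ε hε using step ε hε.1 hε.2
  have hH : HH d δ x = ENNReal.ofReal (1 + ‖x‖ ^ (-δ)) := by
    unfold HH hp; rw [ENNReal.ofReal_add (by norm_num) (by positivity), ENNReal.ofReal_one]
  have hge1 : 1 ≤ ‖x‖ ^ (-δ) := one_le_rpow_of_pos_of_le_one_of_nonpos hx0 hx1 (by linarith)
  -- conclude
  have a1 : ENNReal.ofReal (1/6) * HH d δ x ≤ ENNReal.ofReal (1/3) * hp d δ x := by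
    rw [hH]; unfold hp
    rw [← ENNReal.ofReal_mul (by norm_num), ← ENNReal.ofReal_mul (by norm_num)]
    exact ENNReal.ofReal_le_ofReal (by linarith)
  have a2 : ENNReal.ofReal (r ^ (α - ε0) * C1 + R ^ (-(δ / 2)) * C1) * HH d δ x ≤ ENNReal.ofReal (1/12) * HH d δ x := by
    refine mul_le_mul' (ENNReal.ofReal_le_ofReal ?_) le_rfl
    have : 1 / (24 * C1) * C1 = 1/24 := by field_simp
    calc _ ≤ 1 / (24 * C1) * C1 + 1 / (24 * C1) * C1 := by gcongr
      _ = _ := by rw [this]; norm_num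
  have a3 : ENNReal.ofReal (1/12) * HH d δ x ≤ ENNReal.ofReal (r ^ (-δ)) * TI volume P (1/3) I x := by
    have hf : ENNReal.ofReal (1/12) * HH d δ x ≠ ∞ := ENNReal.mul_ne_top ENNReal.ofReal_ne_top (HH_ne_top _ _ _)
    rw [← ENNReal.add_le_add_iff_left hf]
    calc _ = ENNReal.ofReal (1/6) * HH d δ x := by
          rw [← add_mul, ← ENNReal.ofReal_add (by norm_num) (by norm_num)]; norm_num
      _ ≤ _ := a1.trans (lim.trans (add_le_add a2 le_rfl))
  calc ENNReal.ofReal (r ^ δ / 12) * HH d δ x = ENNReal.ofReal (r ^ δ) * (ENNReal.ofReal (1/12) * HH d δ x) := by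
        rw [← mul_assoc, ← ENNReal.ofReal_mul (by positivity)]; congr 2; ring
    _ ≤ ENNReal.ofReal (r ^ δ) * (ENNReal.ofReal (r ^ (-δ)) * TI volume P (1/3) I x) := mul_le_mul' le_rfl a3
    _ = _ := by
        rw [← mul_assoc, ← ENNReal.ofReal_mul (by positivity), ← rpow_add hr]; simp

end KernelHyp



namespace KernelHyp
variable {d : ℕ} {α : ℝ} {κ : ℝ → ℝ} {p : ℝ → Ed d → Ed d → ℝ≥0∞}

lemma avg_low (hK : KernelHyp d α κ p) {q : Ed d → ℝ≥0∞} (hq : Measurable q) {R : ℝ} {t : ℝ} (ht : 2/3 ≤ t)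
    {x y : Ed d} {B : ℝ≥0∞} (hB : ∀ s ∈ Ioo (0:ℝ) (1/3), ∀ z : Ed d, z ≠ 0 → ‖z‖ ≤ R → B ≤ PT volume p q (t - s) z y) :
    TI volume (PT volume p q) (1/3) ((Metric.closedBall (0 : Ed d) R).indicator 1) x * B ≤ PT volume p q t x y := by
  have hJ := PT_JM volume hK.jm hq
  have hck := PT_CK volume hK.jm hq hK.ck
  set P := PT volume p q with hP
  set I : Ed d → ℝ≥0∞ := (Metric.closedBall (0 : Ed d) R).indicator 1 with hI
  have hIm : Measurable I := measurable_one.indicator Metric.isClosed_closedBall.measurableSet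
  have hs : ∀ s ∈ Ioo (0:ℝ) (1/3), PO volume P s I x * B ≤ P t x y := by
    intro s hs
    calc PO volume P s I x * B = ∫⁻ z, P s x z * I z * B := by
          exact (lintegral_mul_const (μ := volume) (f := fun z => P s x z * I z) B ((hJ.sec s x).mul hIm)).symm
      _ ≤ ∫⁻ z, P s x z * P (t - s) z y := by
          apply lintegral_mono_ae
          filter_upwards [ae_ne0 hK.dpos] with z hz
          rw [mul_assoc]
          refine mul_le_mul' le_rfl ?_
          rcases le_or_gt ‖z‖ R with h | h
          · have : I z = 1 := by
              rw [hI, indicator_of_mem]; · rfl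
              · simpa using h
            rw [this, one_mul]; exact hB s hs z hz h
          · have : I z = 0 := by
              rw [hI, indicator_of_notMem]; simpa using h
            rw [this, zero_mul]; exact zero_le
      _ = P t x y := by
          rw [hck s (t - s) hs.1 (by linarith [hs.2])]; congr 1; ring
  calc _ = ∫⁻ s in Ioo (0:ℝ) (1/3), PO volume P s I x * B := by
        rw [lintegral_mul_const _ (PO_sec volume hJ hIm x)]; rfl
    _ ≤ ∫⁻ s in Ioo (0:ℝ) (1/3), P t x y := setLIntegral_mono' measurableSet_Ioo hs
    _ = ENNReal.ofReal (1/3) * P t x y := by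
        simp only [lintegral_const, MeasurableSet.univ, Measure.restrict_apply, univ_inter, Real.volume_Ioo]
        rw [mul_comm]; norm_num
    _ ≤ 1 * P t x y := by
        refine mul_le_mul' ?_ le_rfl
        rw [← ENNReal.ofReal_one]; exact ENNReal.ofReal_le_ofReal (by norm_num)
    _ = _ := one_mul _

lemma low25 (hK : KernelHyp d α κ p) {δ : ℝ} (hδ : 0 < δ) (hδ2 : δ ≤ (d - α) / 2) :
    ∃ c : ℝ, 0 < c ∧ ∀ x y : Ed d, x ≠ 0 → y ≠ 0 →
      ENNReal.ofReal c * (HH d δ x * HH d δ y * JJ d α x y) ≤ PT volume p (q0 d α (κ δ)) 1 x y := by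
  have hα := hK.αpos
  obtain ⟨c1, R, hc1, hR, hmid⟩ := hK.mid_low hδ hδ2
  obtain ⟨c2, hc2, hlow⟩ := hK.low
  have hq := q0_meas d α (κ δ)
  have hsymm := PT_symm volume hK.jm hq hK.symm
  set P := PT volume p (q0 d α (κ δ)) with hP
  set L : ℝ := (R + 2) ^ ((d:ℝ) + α) with hL
  have hLp : 0 < L := by positivity
  have hJJ : ∀ x y z : Ed d, ‖x‖ ≤ 1 → ‖z‖ ≤ R → ENNReal.ofReal L⁻¹ * JJ d α x y ≤ JJ d α z y := by
    intro x y z hx hz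
    have h : 1 + ‖z - y‖ ≤ (R + 2) * (1 + ‖x - y‖) := by
      have : ‖z - y‖ ≤ ‖z - x‖ + ‖x - y‖ := norm_sub_le_norm_sub_add_norm_sub _ _ _
      have h2 : ‖z - x‖ ≤ R + 1 := (norm_sub_le _ _).trans (by linarith)
      nlinarith [norm_nonneg (x - y)]
    calc _ ≤ ENNReal.ofReal L⁻¹ * (ENNReal.ofReal L * JJ d α z y) := mul_le_mul' le_rfl (JJ_le hα (by linarith) h)
      _ = _ := by rw [← mul_assoc, ← ENNReal.ofReal_mul (by positivity), inv_mul_cancel₀ hLp.ne']; simp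
  have hlow' : ∀ t, 1/3 ≤ t → t ≤ 1 → ∀ x y, ENNReal.ofReal c2 * JJ d α x y ≤ P t x y := by
    intro t h1 h2 x y
    refine le_trans ?_ ((hlow t h1 h2 x y).trans (le_PT volume t x y))
    unfold JJ; rw [ENNReal.ofReal_mul hc2.le]
  have one : ∀ x y : Ed d, x ≠ 0 → ‖x‖ ≤ 1 → ∀ t, 2/3 ≤ t → t ≤ 1 → ENNReal.ofReal (c1 * c2 * L⁻¹) * (HH d δ x * JJ d α x y) ≤ P t x y := by
    intro x y hx hx1 t ht1 ht2
    have := hK.avg_low hq (R := R) ht1 (x := x) (y := y) (B := ENNReal.ofReal c2 * (ENNReal.ofReal L⁻¹ * JJ d α x y))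
      (fun s hs z hz hzR => (mul_le_mul' le_rfl (hJJ x y z hx1 hzR)).trans (hlow' (t - s) (by linarith [hs.2]) (by linarith [hs.1]) z y))
    refine le_trans ?_ this
    calc _ = (ENNReal.ofReal c1 * HH d δ x) * (ENNReal.ofReal c2 * (ENNReal.ofReal L⁻¹ * JJ d α x y)) := by
          rw [ENNReal.ofReal_mul (by positivity), ENNReal.ofReal_mul (by positivity)]; ring
      _ ≤ _ := mul_le_mul' (hmid x hx hx1) le_rfl
  have HH2 : ∀ x : Ed d, 1 ≤ ‖x‖ → HH d δ x ≤ ENNReal.ofReal 2 := by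
    intro x hx
    unfold HH hp
    rw [← ENNReal.ofReal_one, ← ENNReal.ofReal_add (by norm_num) (by positivity)]
    apply ENNReal.ofReal_le_ofReal
    have : ‖x‖ ^ (-δ) ≤ 1 := rpow_le_one_of_one_le_of_nonpos hx (by linarith)
    linarith
  -- constants
  set k1 := c1 * (c1 * c2 * L⁻¹ * L⁻¹) with hk1
  set k2 := c1 * c2 * L⁻¹ / 2 with hk2
  set k3 := c2 / 4 with hk3
  have hk1p : 0 < k1 := by positivity
  have hk2p : 0 < k2 := by positivity
  have hk3p : 0 < k3 := by positivity
  set c := min k1 (min k2 k3) with hc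
  have hcp : 0 < c := by positivity
  have hck1 : c ≤ k1 := min_le_left _ _
  have hck2 : c ≤ k2 := (min_le_right _ _).trans (min_le_left _ _)
  have hck3 : c ≤ k3 := (min_le_right _ _).trans (min_le_right _ _)
  clear_value c
  have mixed : ∀ x y : Ed d, x ≠ 0 → ‖x‖ ≤ 1 → 1 ≤ ‖y‖ → ENNReal.ofReal c * (HH d δ x * HH d δ y * JJ d α x y) ≤ P 1 x y := by
    intro x y hx hx1 hy1
    refine le_trans ?_ (one x y hx hx1 1 (by norm_num) le_rfl)
    calc _ ≤ ENNReal.ofReal k2 * (HH d δ x * ENNReal.ofReal 2 * JJ d α x y) :=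
          mul_le_mul' (ENNReal.ofReal_le_ofReal hck2) (mul_le_mul' (mul_le_mul' le_rfl (HH2 y hy1)) le_rfl)
      _ = ENNReal.ofReal (k2 * 2) * (HH d δ x * JJ d α x y) := by rw [ENNReal.ofReal_mul hk2p.le]; ring
      _ = _ := by rw [hk2]; congr 2; ring
  refine ⟨c, hcp, fun x y hx hy => ?_⟩
  rcases le_total ‖x‖ 1 with hx1 | hx1
  · rcases le_total ‖y‖ 1 with hy1 | hy1
    · have := hK.avg_low hq (R := R) (t := 1) (by norm_num) (x := x) (y := y)
        (B := ENNReal.ofReal (c1 * c2 * L⁻¹) * (HH d δ y * (ENNReal.ofReal L⁻¹ * JJ d α x y)))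
        (fun s hs z hz hzR => by
          rw [PT_symm volume hK.jm hq hK.symm]
          refine le_trans ?_ (one y z hy hy1 (1 - s) (by linarith [hs.2]) (by linarith [hs.1]))
          rw [JJ_symm d α y z]
          exact mul_le_mul' le_rfl (mul_le_mul' le_rfl (hJJ x y z hx1 hzR)))
      refine le_trans ?_ this
      calc _ ≤ ENNReal.ofReal k1 * (HH d δ x * HH d δ y * JJ d α x y) := mul_le_mul' (ENNReal.ofReal_le_ofReal hck1) le_rfl
        _ = (ENNReal.ofReal c1 * HH d δ x) * (ENNReal.ofReal (c1 * c2 * L⁻¹) * (HH d δ y * (ENNReal.ofReal L⁻¹ * JJ d α x y))) := by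
            rw [hk1, ENNReal.ofReal_mul (p := c1) (by positivity), ENNReal.ofReal_mul (p := c1 * c2 * L⁻¹) (by positivity)]; ring
        _ ≤ _ := mul_le_mul' (hmid x hx hx1) le_rfl
    · exact mixed x y hx hx1 hy1
  · rcases le_total ‖y‖ 1 with hy1 | hy1
    · rw [hsymm, JJ_symm, mul_comm (HH d δ x)]
      exact mixed y x hy hy1 hx1
    · refine le_trans ?_ (hlow' 1 (by norm_num) le_rfl x y)
      calc _ ≤ ENNReal.ofReal k3 * (ENNReal.ofReal 2 * ENNReal.ofReal 2 * JJ d α x y) :=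
            mul_le_mul' (ENNReal.ofReal_le_ofReal hck3) (mul_le_mul' (mul_le_mul' (HH2 x hx1) (HH2 y hy1)) le_rfl)
        _ = ENNReal.ofReal (k3 * 2 * 2) * JJ d α x y := by
            rw [ENNReal.ofReal_mul (by positivity), ENNReal.ofReal_mul (by positivity)]; ring
        _ = _ := by rw [hk3]; congr 2; ring

theorem part2 (hK : KernelHyp d α κ p) {δ ε A T : ℝ} (hδ : 0 < δ) (hδ2 : δ ≤ (d - α) / 2)
    (hε : 0 < ε) (hεα : ε ≤ α / 2) (hεδ : ε < δ) (hA : 0 ≤ A) (hT : 0 < T) :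
    ∃ c : ℝ, 0 < c ∧ ∀ V : Ed d → ℝ≥0∞, (∀ z, z ≠ 0 → V z ≤ ENNReal.ofReal (UU (κ δ) A α ε ‖z‖)) →
      ∀ t, 0 < t → t ≤ T → ∀ x y : Ed d, x ≠ 0 → y ≠ 0 →
      PT volume p V t x y ≤ ENNReal.ofReal c * PT volume p (q0 d α (κ δ)) t x y ∧ PT volume p V t x y ≠ ∞ := by
  have hα := hK.αpos
  have hαd := hK.αlt
  have hκ0 : 0 < κ δ := hK.kpos δ hδ (by linarith)
  set m : ℝ := max 1 T with hm
  have hm1 : 1 ≤ m := le_max_left _ _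
  have hm0 : 0 < m := by linarith
  set AT : ℝ := A * m with hAT
  have hATn : 0 ≤ AT := by positivity
  obtain ⟨K, hKp, hup⟩ := hK.up24 hδ hδ2 hε hεα hεδ hATn
  obtain ⟨c, hc, hlow⟩ := hK.low25 hδ hδ2
  refine ⟨K / c, by positivity, ?_⟩
  intro V hV t ht htT x y hx hy
  set l : ℝ := t ^ (1 / α) with hl
  have hlp : 0 < l := by positivity
  have hlα : l ^ α = t := by rw [hl, ← rpow_mul ht.le, one_div_mul_cancel hα.ne', rpow_one]
  have hVs : ∀ z, z ≠ 0 → scq α l V z ≤ ENNReal.ofReal (UU (κ δ) AT α ε ‖z‖) := by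
    intro z hz
    have hz0 : 0 < ‖z‖ := norm_pos_iff.2 hz
    unfold scq
    calc _ ≤ ENNReal.ofReal (l ^ α) * ENNReal.ofReal (UU (κ δ) A α ε ‖l • z‖) :=
          mul_le_mul' le_rfl (hV _ (smul_ne_zero hlp.ne' hz))
      _ ≤ _ := by
          rw [← ENNReal.ofReal_mul (by positivity), norm_smul, Real.norm_of_nonneg hlp.le]
          apply ENNReal.ofReal_le_ofReal
          unfold UU
          rw [mul_rpow hlp.le hz0.le, mul_rpow hlp.le hz0.le, mul_rpow hlp.le hz0.le]
          have e1 : l ^ α * l ^ (-α) = 1 := by rw [← rpow_add hlp]; simp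
          have pw : ∀ e, 0 ≤ e → e ≤ α → l ^ e ≤ m := by
            intro e he1 he2
            rcases le_total l 1 with h | h
            · exact (rpow_le_one hlp.le h he1).trans hm1
            · calc l ^ e ≤ l ^ α := rpow_le_rpow_of_exponent_le h he2
                _ ≤ m := by rw [hlα]; exact htT.trans (le_max_right _ _)
          have e2 : l ^ α * l ^ (-(α - ε)) ≤ m := by
            rw [← rpow_add hlp]; exact pw _ (by linarith) (by linarith)
          have e3 : l ^ α * l ^ (-(α / 2)) ≤ m := by
            rw [← rpow_add hlp]; exact pw _ (by linarith) (by linarith)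
          calc _ = (l ^ α * l ^ (-α)) * (κ δ * ‖z‖ ^ (-α)) + A * ((l ^ α * l ^ (-(α - ε))) * ‖z‖ ^ (-(α - ε)) + (l ^ α * l ^ (-(α / 2))) * ‖z‖ ^ (-(α / 2))) := by ring
            _ ≤ 1 * (κ δ * ‖z‖ ^ (-α)) + A * (m * ‖z‖ ^ (-(α - ε)) + m * ‖z‖ ^ (-(α / 2))) := by
                rw [e1]; gcongr
            _ = _ := by rw [hAT]; ring
  have hq0s : PT volume p (q0 d α (κ δ)) 1 (l⁻¹ • x) (l⁻¹ • y) ≤ PT volume p (scq α l (q0 d α (κ δ))) 1 (l⁻¹ • x) (l⁻¹ • y) := by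
    apply PT_mono
    filter_upwards [ae_ne0 hK.dpos] with z hz
    have hz0 : 0 < ‖z‖ := norm_pos_iff.2 hz
    unfold scq q0 hp
    rw [norm_smul, Real.norm_of_nonneg hlp.le, mul_rpow hlp.le hz0.le, ENNReal.ofReal_mul (p := l ^ (-α)) (by positivity)]
    have : ENNReal.ofReal (l ^ α) * ENNReal.ofReal (l ^ (-α)) = 1 := by
      rw [← ENNReal.ofReal_mul (by positivity), ← rpow_add hlp]; simp
    calc _ = (ENNReal.ofReal (l ^ α) * ENNReal.ofReal (l ^ (-α))) * (ENNReal.ofReal (κ δ) * ENNReal.ofReal (‖z‖ ^ (-α))) := by rw [this, one_mul]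
      _ ≤ _ := le_of_eq (by ring)
  have hne : ∀ x : Ed d, x ≠ 0 → l⁻¹ • x ≠ 0 := fun x hx => smul_ne_zero (by positivity) hx
  have hu := hup _ hVs _ _ (hne x hx) (hne y hy)
  have hlo := hlow _ _ (hne x hx) (hne y hy)
  set G := HH d δ (l⁻¹ • x) * HH d δ (l⁻¹ • y) * JJ d α (l⁻¹ • x) (l⁻¹ • y) with hG
  rw [hK.PT_scal' t ht x y, hK.PT_scal' (q := q0 d α (κ δ)) t ht x y]
  constructor
  · calc _ ≤ ENNReal.ofReal (t ^ (-(d:ℝ) / α)) * (ENNReal.ofReal K * G) := mul_le_mul' le_rfl hu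
      _ = ENNReal.ofReal (t ^ (-(d:ℝ) / α)) * (ENNReal.ofReal (K / c) * (ENNReal.ofReal c * G)) := by
          congr 1
          rw [← mul_assoc (ENNReal.ofReal (K / c)), ← ENNReal.ofReal_mul (by positivity), div_mul_cancel₀ _ hc.ne']
      _ ≤ ENNReal.ofReal (t ^ (-(d:ℝ) / α)) * (ENNReal.ofReal (K / c) * PT volume p (scq α l (q0 d α (κ δ))) 1 (l⁻¹ • x) (l⁻¹ • y)) :=
          mul_le_mul' le_rfl (mul_le_mul' le_rfl (hlo.trans hq0s))
      _ = _ := by ring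
  · apply ENNReal.mul_ne_top ENNReal.ofReal_ne_top
    refine ne_top_of_le_ne_top ?_ hu
    exact ENNReal.mul_ne_top ENNReal.ofReal_ne_top (ENNReal.mul_ne_top (ENNReal.mul_ne_top (HH_ne_top _ _ _) (HH_ne_top _ _ _)) ENNReal.ofReal_ne_top)

end KernelHyp



section GoodSec
variable {d : ℕ}

/-- Gaussian-regularized cosine transform -/
def II (η : ℝ) (g : Ed d → ℝ) (x : Ed d) : ℝ := ∫ z : Ed d, Real.cos ⟪x, z⟫ * (Real.exp (-η * ‖z‖ ^ 2) * g z)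

/-- nonnegative, radially decreasing transforms -/
def Good (g : Ed d → ℝ) : Prop := ∀ η : ℝ, 0 < η → ∀ x y : Ed d, ‖x‖ ≤ ‖y‖ → 0 ≤ II η g y ∧ II η g y ≤ II η g x

lemma gauss_int {η : ℝ} (hη : 0 < η) : Integrable (fun z : Ed d => Real.exp (-η * ‖z‖ ^ 2)) := by
  have := (GaussianFourier.integrable_cexp_neg_mul_sq_norm_add (b := (η : ℂ)) (V := Ed d) (by simpa using hη) 0 0).re
  refine this.congr (ae_of_all _ fun z => ?_)
  simp only [zero_mul, add_zero]
  have : (-(η:ℂ) * (‖z‖:ℂ) ^ 2) = ((-η * ‖z‖ ^ 2 : ℝ) : ℂ) := by push_cast; ring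
  rw [this, ← Complex.ofReal_exp]; exact Complex.ofReal_re _

lemma gauss_cos {η : ℝ} (hη : 0 < η) (x : Ed d) : ∫ z : Ed d, Real.cos ⟪x, z⟫ * Real.exp (-η * ‖z‖ ^ 2)
    = (π / η) ^ ((d:ℝ) / 2) * Real.exp (-‖x‖ ^ 2 / (4 * η)) := by
  have h := GaussianFourier.integral_cexp_neg_mul_sq_norm_add (b := (η : ℂ)) (V := Ed d) (by simpa using hη) Complex.I x
  have hi := GaussianFourier.integrable_cexp_neg_mul_sq_norm_add (b := (η : ℂ)) (V := Ed d) (by simpa using hη) Complex.I x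
  have h2 := congrArg Complex.re h
  have h3 := integral_re hi
  simp only [RCLike.re_eq_complex_re] at h3
  rw [← h3] at h2
  calc _ = ∫ z : Ed d, (Complex.exp (-(η:ℂ) * (‖z‖:ℂ) ^ 2 + Complex.I * (⟪x, z⟫ : ℝ))).re := by
        apply integral_congr_ae; refine ae_of_all _ fun z => ?_
        simp only
        rw [Complex.exp_re]
        have e1 : (-(η:ℂ) * (‖z‖:ℂ) ^ 2 + Complex.I * (⟪x, z⟫ : ℝ)).re = -η * ‖z‖ ^ 2 := by
          have : -(η:ℂ) * (‖z‖:ℂ) ^ 2 = ((-η * ‖z‖ ^ 2 : ℝ) : ℂ) := by push_cast; ring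
          rw [this, Complex.add_re, Complex.ofReal_re, Complex.I_mul_re, Complex.ofReal_im]; ring
        have e2 : (-(η:ℂ) * (‖z‖:ℂ) ^ 2 + Complex.I * (⟪x, z⟫ : ℝ)).im = ⟪x, z⟫ := by
          have : -(η:ℂ) * (‖z‖:ℂ) ^ 2 = ((-η * ‖z‖ ^ 2 : ℝ) : ℂ) := by push_cast; ring
          rw [this, Complex.add_im, Complex.ofReal_im, Complex.I_mul_im, Complex.ofReal_re]; ring
        rw [e1, e2]; ring
    _ = _ := h2
    _ = _ := by
        have f1 : ((π:ℂ) / (η:ℂ)) ^ ((Module.finrank ℝ (Ed d) : ℂ) / 2) = (((π / η) ^ ((d:ℝ) / 2) : ℝ) : ℂ) := by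
          rw [Complex.ofReal_cpow (by positivity)]
          simp
        have f2 : Complex.exp (Complex.I ^ 2 * (‖x‖:ℂ) ^ 2 / (4 * (η:ℂ))) = ((Real.exp (-‖x‖ ^ 2 / (4 * η)) : ℝ) : ℂ) := by
          rw [Complex.ofReal_exp]; congr 1; push_cast; rw [Complex.I_sq]; ring
        rw [f1, f2, ← Complex.ofReal_mul, Complex.ofReal_re]

lemma good_one : Good (fun _ : Ed d => (1:ℝ)) := by
  intro η hη x y hxy
  have e : ∀ x : Ed d, II η (fun _ => 1) x = (π / η) ^ ((d:ℝ) / 2) * Real.exp (-‖x‖ ^ 2 / (4 * η)) := by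
    intro x; rw [← gauss_cos hη]; simp [II]
  rw [e, e]
  refine ⟨by positivity, ?_⟩
  gcongr

lemma II_bound_int {η : ℝ} (hη : 0 < η) {g : Ed d → ℝ} (hg : Measurable g) {M : ℝ} (hM : ∀ z, |g z| ≤ M) (x : Ed d) :
    Integrable (fun z => Real.cos ⟪x, z⟫ * (Real.exp (-η * ‖z‖ ^ 2) * g z)) := by
  refine Integrable.mono' ((gauss_int hη).mul_const M) (by fun_prop) (ae_of_all _ fun z => ?_)
  rw [norm_mul, norm_mul, Real.norm_eq_abs, Real.norm_eq_abs, Real.norm_eq_abs, abs_of_pos (Real.exp_pos _)]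
  calc _ ≤ 1 * (Real.exp (-η * ‖z‖ ^ 2) * M) := by
        gcongr
        · exact Real.abs_cos_le_one _
        · exact hM z
    _ = _ := one_mul _

lemma good_add {g h : Ed d → ℝ} (hg : Measurable g) {M : ℝ} (hM : ∀ z, |g z| ≤ M) (hh : Measurable h) {M' : ℝ}
    (hM' : ∀ z, |h z| ≤ M') (h1 : Good g) (h2 : Good h) : Good (fun z => g z + h z) := by
  intro η hη x y hxy
  have e : ∀ x, II η (fun z => g z + h z) x = II η g x + II η h x := by
    intro x
    unfold II
    rw [← integral_add (II_bound_int hη hg hM x) (II_bound_int hη hh hM' x)]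
    congr 1; ext z; ring
  have a := h1 η hη x y hxy
  have b := h2 η hη x y hxy
  rw [e, e]; constructor <;> linarith

lemma good_cmul {g : Ed d → ℝ} {c : ℝ} (hc : 0 ≤ c) (h1 : Good g) : Good (fun z => c * g z) := by
  intro η hη x y hxy
  have e : ∀ x, II η (fun z => c * g z) x = c * II η g x := by
    intro x
    unfold II
    rw [← integral_const_mul]
    congr 1; ext z; ring
  have a := h1 η hη x y hxy
  rw [e, e]; exact ⟨mul_nonneg hc a.1, mul_le_mul_of_nonneg_left a.2 hc⟩

lemma good_lim {G : ℕ → Ed d → ℝ} {g : Ed d → ℝ} (hG : ∀ n, Measurable (G n)) {M : ℝ} (hM : ∀ n z, |G n z| ≤ M)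
    (hgood : ∀ n, Good (G n)) (hlim : ∀ z, Tendsto (fun n => G n z) atTop (𝓝 (g z))) : Good g := by
  intro η hη x y hxy
  have e : ∀ x, Tendsto (fun n => II η (G n) x) atTop (𝓝 (II η g x)) := by
    intro x
    apply tendsto_integral_of_dominated_convergence (fun z => Real.exp (-η * ‖z‖ ^ 2) * M)
    · intro n; have := hG n; fun_prop
    · exact (gauss_int hη).mul_const M
    · intro n; refine ae_of_all _ fun z => ?_
      rw [norm_mul, norm_mul, Real.norm_eq_abs, Real.norm_eq_abs, Real.norm_eq_abs, abs_of_pos (Real.exp_pos _)]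
      calc _ ≤ 1 * (Real.exp (-η * ‖z‖ ^ 2) * M) := by
            gcongr
            · exact Real.abs_cos_le_one _
            · exact hM n z
        _ = _ := one_mul _
    · exact ae_of_all _ fun z => (((hlim z).const_mul _).const_mul _)
  exact ⟨ge_of_tendsto' (e y) fun n => (hgood n η hη x y hxy).1,
    le_of_tendsto_of_tendsto' (e y) (e x) fun n => (hgood n η hη x y hxy).2⟩

/-- truncated subordinator exponent -/
def kk (e β : ℝ) (z : Ed d) : ℝ := ∫ u in Ioi e, Real.exp (-u * ‖z‖ ^ 2) * u ^ (-1 - β)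

lemma kk_meas (e β : ℝ) : Measurable (kk e β : Ed d → ℝ) := by
  unfold kk
  apply StronglyMeasurable.measurable
  have : StronglyMeasurable (fun w : Ed d × ℝ => Real.exp (-w.2 * ‖w.1‖ ^ 2) * w.2 ^ (-1 - β)) :=
    Measurable.stronglyMeasurable (by fun_prop)
  exact this.integral_prod_right'

lemma kk_int0 {e β : ℝ} (he : 0 < e) (hβ : 0 < β) : IntegrableOn (fun u : ℝ => u ^ (-1 - β)) (Ioi e) :=
  integrableOn_Ioi_rpow_of_lt (by linarith) he

lemma kk_int {e β : ℝ} (he : 0 < e) (hβ : 0 < β) {l : ℝ} (hl : 0 ≤ l) :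
    IntegrableOn (fun u : ℝ => Real.exp (-u * l) * u ^ (-1 - β)) (Ioi e) := by
  refine Integrable.mono' (kk_int0 he hβ) (by fun_prop) ?_
  filter_upwards [ae_restrict_mem measurableSet_Ioi] with u hu
  have hu0 : 0 < u := he.trans hu
  rw [Real.norm_of_nonneg (by positivity)]
  have : Real.exp (-u * l) ≤ 1 := Real.exp_le_one_iff.2 (by nlinarith)
  calc _ ≤ 1 * u ^ (-1 - β) := by gcongr
    _ = _ := one_mul _

lemma kk_nonneg {e β : ℝ} (he : 0 < e) (z : Ed d) : 0 ≤ kk e β z := by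
  apply setIntegral_nonneg measurableSet_Ioi
  intro u hu
  have : 0 < u := he.trans hu
  positivity

lemma kk_le {e β : ℝ} (he : 0 < e) (hβ : 0 < β) (z : Ed d) : kk e β z ≤ kk e β (0 : Ed d) := by
  apply setIntegral_mono_on (kk_int he hβ (by positivity)) (kk_int he hβ (by positivity)) measurableSet_Ioi
  intro u hu
  have hu0 : 0 < u := he.trans hu
  gcongr ?_ * _
  apply Real.exp_le_exp.2
  simp
  positivity

lemma good_mul_kk {e β : ℝ} (he : 0 < e) (hβ : 0 < β) {g : Ed d → ℝ} (hg : Measurable g) {M : ℝ} (hM : ∀ z, |g z| ≤ M)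
    (h : Good g) : Good (fun z => kk e β z * g z) := by
  intro η hη x y hxy
  have key : ∀ x, II η (fun z => kk e β z * g z) x = ∫ u in Ioi e, u ^ (-1 - β) * II (η + u) g x := by
    intro x
    unfold II kk
    calc _ = ∫ z : Ed d, ∫ u in Ioi e, Real.cos ⟪x, z⟫ * (Real.exp (-η * ‖z‖ ^ 2) * (Real.exp (-u * ‖z‖ ^ 2) * u ^ (-1 - β) * g z)) := by
          congr 1; ext z
          rw [integral_const_mul, integral_const_mul, integral_mul_const]
      _ = ∫ u in Ioi e, ∫ z : Ed d, Real.cos ⟪x, z⟫ * (Real.exp (-η * ‖z‖ ^ 2) * (Real.exp (-u * ‖z‖ ^ 2) * u ^ (-1 - β) * g z)) := by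
          apply integral_integral_swap
          refine Integrable.mono' (g := fun w : Ed d × ℝ => (Real.exp (-η * ‖w.1‖ ^ 2) * M) * w.2 ^ (-1 - β))
            (((gauss_int hη).mul_const M).mul_prod (kk_int0 he hβ)) ?_ ?_
          · unfold Function.uncurry
            apply Measurable.aestronglyMeasurable
            fun_prop
          · have hset : ∀ᵐ w : Ed d × ℝ ∂((volume : Measure (Ed d)).prod (volume.restrict (Ioi e))), e < w.2 := by
              have : ∀ᵐ u ∂(volume.restrict (Ioi e)), e < u := ae_restrict_mem measurableSet_Ioi
              exact Measure.quasiMeasurePreserving_snd.ae this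
            filter_upwards [hset] with w hw
            have hu0 : 0 < w.2 := he.trans hw
            simp only [Function.uncurry]
            have h1 : Real.exp (-w.2 * ‖w.1‖ ^ 2) ≤ 1 := Real.exp_le_one_iff.2 (by nlinarith [sq_nonneg ‖w.1‖])
            have h2 : 0 ≤ M := (abs_nonneg _).trans (hM w.1)
            rw [norm_mul, norm_mul, norm_mul, norm_mul, Real.norm_eq_abs, Real.norm_eq_abs, abs_of_pos (Real.exp_pos _),
              Real.norm_eq_abs, abs_of_pos (Real.exp_pos _), Real.norm_of_nonneg (by positivity), Real.norm_eq_abs]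
            calc _ ≤ 1 * (Real.exp (-η * ‖w.1‖ ^ 2) * (1 * w.2 ^ (-1 - β) * M)) := by
                  gcongr
                  · exact Real.abs_cos_le_one _
                  · exact hM _
              _ = _ := by ring
      _ = _ := by
          congr 1; ext u
          rw [← integral_const_mul]
          congr 1; ext z
          have : Real.exp (-(η + u) * ‖z‖ ^ 2) = Real.exp (-η * ‖z‖ ^ 2) * Real.exp (-u * ‖z‖ ^ 2) := by
            rw [← Real.exp_add]; ring_nf
          rw [this]; ring
  have hInt0 : ∀ x, IntegrableOn (fun u => u ^ (-1 - β) * II (η + u) g x) (Ioi e) := by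
    intro x
    have hmeas : StronglyMeasurable (fun u : ℝ => II (η + u) g x) := by
      unfold II
      have : StronglyMeasurable (fun w : ℝ × Ed d => Real.cos ⟪x, w.2⟫ * (Real.exp (-(η + w.1) * ‖w.2‖ ^ 2) * g w.2)) := by
        apply Measurable.stronglyMeasurable; fun_prop
      exact this.integral_prod_right'
    refine Integrable.mono' ((kk_int0 he hβ).mul_const (II η (fun _ : Ed d => (1:ℝ)) 0 * M)) ?_ ?_
    · exact (Measurable.aestronglyMeasurable (by fun_prop)).mul hmeas.aestronglyMeasurable
    · filter_upwards [ae_restrict_mem measurableSet_Ioi] with u hu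
      have hu0 : 0 < u := he.trans hu
      rw [norm_mul, Real.norm_of_nonneg (by positivity)]
      gcongr
      unfold II
      rw [← integral_mul_const]
      refine norm_integral_le_of_norm_le ?_ (ae_of_all _ fun z => ?_)
      · have := ((gauss_int (d := d) hη).mul_const M)
        simpa using this
      · rw [norm_mul, norm_mul, Real.norm_eq_abs, Real.norm_eq_abs, Real.norm_eq_abs, abs_of_pos (Real.exp_pos _)]
        simp only [inner_zero_left, Real.cos_zero, mul_one, one_mul]
        have h2 : 0 ≤ M := (abs_nonneg _).trans (hM 0)
        calc _ ≤ 1 * (Real.exp (-η * ‖z‖ ^ 2) * M) := by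
              gcongr
              · exact Real.abs_cos_le_one _
              · linarith
              · exact hM z
          _ = _ := one_mul _
  rw [key, key]
  constructor
  · apply setIntegral_nonneg measurableSet_Ioi
    intro u hu
    have hu0 : 0 < u := he.trans hu
    exact mul_nonneg (by positivity) (h (η + u) (by linarith) x y hxy).1
  · apply setIntegral_mono_on (hInt0 y) (hInt0 x) measurableSet_Ioi
    intro u hu
    have hu0 : 0 < u := he.trans hu
    exact mul_le_mul_of_nonneg_left (h (η + u) (by linarith) x y hxy).2 (by positivity)

end GoodSec



section GoodSec2
variable {d : ℕ}

lemma kk_abs {e β : ℝ} (he : 0 < e) (hβ : 0 < β) (z : Ed d) : |kk e β z| ≤ kk e β (0 : Ed d) := by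
  rw [abs_of_nonneg (kk_nonneg he z)]; exact kk_le he hβ z

lemma good_pow {e β : ℝ} (he : 0 < e) (hβ : 0 < β) (n : ℕ) : Good (fun z : Ed d => kk e β z ^ n) := by
  induction n with
  | zero => simpa using good_one
  | succ n ih =>
    have := good_mul_kk he hβ ((kk_meas (d := d) e β).pow_const n) (M := kk e β (0 : Ed d) ^ n) (fun z => by
      rw [abs_pow]; exact pow_le_pow_left₀ (abs_nonneg _) (kk_abs he hβ z) n) ih
    simpa [pow_succ, mul_comm] using this

lemma good_sum {e β c : ℝ} (he : 0 < e) (hβ : 0 < β) (hc : 0 ≤ c) (N : ℕ) :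
    Good (fun z : Ed d => ∑ n ∈ Finset.range N, (c * kk e β z) ^ n / (n.factorial : ℝ)) := by
  induction N with
  | zero =>
    simp only [Finset.range_zero, Finset.sum_empty]
    have := good_cmul (le_refl 0) (good_one (d := d))
    simpa using this
  | succ N ih =>
    simp only [Finset.sum_range_succ]
    have hk0 := kk_nonneg (β := β) he (0 : Ed d)
    have hm := kk_meas (d := d) e β
    have hb : ∀ n, ∀ z : Ed d, |(c * kk e β z) ^ n / (n.factorial : ℝ)| ≤ (c * kk e β (0 : Ed d)) ^ n / (n.factorial : ℝ) := by
      intro n z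
      rw [abs_div, abs_pow, abs_mul, abs_of_nonneg hc, abs_of_nonneg (by positivity : (0:ℝ) ≤ n.factorial)]
      have := kk_abs he hβ z
      gcongr
    refine good_add (M := ∑ n ∈ Finset.range N, (c * kk e β (0 : Ed d)) ^ n / (n.factorial : ℝ))
      (M' := (c * kk e β (0 : Ed d)) ^ N / (N.factorial : ℝ)) ?_ ?_ ?_ (hb N) ih ?_
    · fun_prop
    · intro z
      exact (Finset.abs_sum_le_sum_abs _ _).trans (Finset.sum_le_sum fun n _ => hb n z)
    · fun_prop
    · have := good_cmul (c := c ^ N / (N.factorial : ℝ)) (by positivity) (good_pow (d := d) he hβ N)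
      convert this using 2 with z
      rw [mul_pow]; ring

lemma good_exp {e β c : ℝ} (he : 0 < e) (hβ : 0 < β) (hc : 0 ≤ c) :
    Good (fun z : Ed d => Real.exp (c * kk e β z)) := by
  have hm := kk_meas (d := d) e β
  refine good_lim (G := fun N (z : Ed d) => ∑ n ∈ Finset.range N, (c * kk e β z) ^ n / (n.factorial : ℝ))
    (M := Real.exp (c * kk e β (0 : Ed d))) (fun n => by fun_prop) ?_ (good_sum he hβ hc) ?_
  · intro n z
    have h0 : 0 ≤ c * kk e β z := mul_nonneg hc (kk_nonneg he z)
    rw [abs_of_nonneg (Finset.sum_nonneg fun i _ => by positivity)]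
    refine (Real.sum_le_exp_of_nonneg h0 n).trans ?_
    exact Real.exp_le_exp.2 (mul_le_mul_of_nonneg_left (kk_le he hβ z) hc)
  · intro z
    have := NormedSpace.expSeries_div_hasSum_exp (c * kk e β z)
    rw [← Real.exp_eq_exp_ℝ] at this
    exact this.tendsto_sum_nat

lemma sub_int {β l : ℝ} (hβ : 0 < β) (hβ1 : β < 1) (hl : 0 ≤ l) :
    IntegrableOn (fun u : ℝ => (1 - Real.exp (-u * l)) * u ^ (-1 - β)) (Ioi 0) := by
  rw [← Ioc_union_Ioi_eq_Ioi (zero_le_one' ℝ)]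
  apply IntegrableOn.union
  · have h : IntegrableOn (fun u : ℝ => u ^ (-β)) (Ioc 0 1) := by
      rw [← intervalIntegrable_iff_integrableOn_Ioc_of_le zero_le_one]
      exact intervalIntegral.intervalIntegrable_rpow' (by linarith)
    refine Integrable.mono' (h.const_mul l) (by fun_prop) ?_
    filter_upwards [ae_restrict_mem measurableSet_Ioc] with u hu
    have hu0 : 0 < u := hu.1
    have h1 : Real.exp (-u * l) ≤ 1 := Real.exp_le_one_iff.2 (by nlinarith)
    have h2 : 1 - Real.exp (-u * l) ≤ u * l := by linarith [Real.add_one_le_exp (-u * l)]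
    rw [Real.norm_of_nonneg (mul_nonneg (by linarith) (by positivity))]
    calc _ ≤ (u * l) * u ^ (-1 - β) := by gcongr
      _ = l * u ^ (-β) := by
        rw [show -β = 1 + (-1 - β) by ring, Real.rpow_add hu0, Real.rpow_one]; ring_nf
  · refine Integrable.mono' (kk_int0 one_pos hβ) (by fun_prop) ?_
    filter_upwards [ae_restrict_mem measurableSet_Ioi] with u hu
    have hu0 : 0 < u := one_pos.trans hu
    have h1 : Real.exp (-u * l) ≤ 1 := Real.exp_le_one_iff.2 (by nlinarith)
    rw [Real.norm_of_nonneg (mul_nonneg (by linarith) (by positivity))]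
    calc _ ≤ 1 * u ^ (-1 - β) := by
          gcongr; linarith [Real.exp_pos (-u * l)]
      _ = _ := one_mul _

lemma sub_scale {β l : ℝ} (hβ : 0 < β) (hl : 0 ≤ l) :
    ∫ u in Ioi (0:ℝ), (1 - Real.exp (-u * l)) * u ^ (-1 - β)
      = l ^ β * ∫ u in Ioi (0:ℝ), (1 - Real.exp (-u)) * u ^ (-1 - β) := by
  rcases hl.eq_or_lt with h | h
  · subst h; simp [Real.zero_rpow hβ.ne']
  · have := integral_comp_mul_left_Ioi' (fun u : ℝ => (1 - Real.exp (-u)) * u ^ (-1 - β)) 0 h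
    rw [mul_zero] at this
    rw [← this, smul_eq_mul, ← mul_assoc, ← integral_const_mul]
    apply setIntegral_congr_fun measurableSet_Ioi
    intro u (hu : 0 < u)
    simp only
    rw [Real.mul_rpow h.le hu.le]
    have : l ^ β * l * l ^ (-1 - β) = 1 := by
      rw [← Real.rpow_add_one h.ne', ← Real.rpow_add h, show β + 1 + (-1 - β) = 0 by ring, Real.rpow_zero]
    calc _ = (1 - Real.exp (-u * l)) * u ^ (-1 - β) * 1 := by ring
      _ = (1 - Real.exp (-u * l)) * u ^ (-1 - β) * (l ^ β * l * l ^ (-1 - β)) := by rw [this]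
      _ = _ := by rw [show -u * l = -(l * u) by ring]; ring

lemma sub_ipos {β : ℝ} (hβ : 0 < β) (hβ1 : β < 1) : 0 < ∫ u in Ioi (0:ℝ), (1 - Real.exp (-u)) * u ^ (-1 - β) := by
  have hi := sub_int hβ hβ1 zero_le_one
  simp only [mul_one] at hi
  rw [setIntegral_pos_iff_support_of_nonneg_ae _ hi]
  · have : Function.support (fun u : ℝ => (1 - Real.exp (-u)) * u ^ (-1 - β)) ∩ Ioi 0 = Ioi 0 := by
      ext u
      simp only [mem_inter_iff, Function.mem_support, mem_Ioi, and_iff_right_iff_imp]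
      intro hu
      have : Real.exp (-u) < 1 := Real.exp_lt_one_iff.2 (by linarith)
      have := Real.rpow_pos_of_pos hu (-1 - β)
      exact mul_ne_zero (by linarith) this.ne'
    rw [this]; simp
  · filter_upwards [ae_restrict_mem measurableSet_Ioi] with u hu
    have hu0 : 0 < u := hu
    have : Real.exp (-u) ≤ 1 := Real.exp_le_one_iff.2 (by linarith)
    exact mul_nonneg (by linarith) (by positivity)

lemma good_stable {α t : ℝ} (hα : 0 < α) (hα2 : α < 2) (ht : 0 ≤ t) : Good (fun z : Ed d => Real.exp (-t * ‖z‖ ^ α)) := by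
  set β := α / 2 with hβd
  have hβ : 0 < β := by positivity
  have hβ1 : β < 1 := by linarith
  set C := ∫ u in Ioi (0:ℝ), (1 - Real.exp (-u)) * u ^ (-1 - β) with hC
  have hCp : 0 < C := sub_ipos hβ hβ1
  clear_value C
  set e : ℕ → ℝ := fun n => 1 / ((n:ℝ) + 1) with he
  have hep : ∀ n, 0 < e n := fun n => by positivity
  have helim : Tendsto e atTop (𝓝 0) := tendsto_one_div_add_atTop_nhds_zero_nat
  have hdiff : ∀ n (z : Ed d), kk (e n) β (0 : Ed d) - kk (e n) β z
      = ∫ u in Ioi (e n), (1 - Real.exp (-u * ‖z‖ ^ 2)) * u ^ (-1 - β) := by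
    intro n z
    unfold kk
    rw [← integral_sub (kk_int (hep n) hβ (by positivity)) (kk_int (hep n) hβ (by positivity))]
    congr 1; ext u; simp; ring
  refine good_lim (G := fun n (z : Ed d) => Real.exp (-(t / C * kk (e n) β (0 : Ed d))) * Real.exp (t / C * kk (e n) β z))
    (M := 1) (fun n => ?_) ?_ ?_ ?_
  · have hm := kk_meas (d := d) (e n) β
    fun_prop
  · intro n z
    rw [← Real.exp_add, abs_of_pos (Real.exp_pos _)]
    apply Real.exp_le_one_iff.2
    have := mul_le_mul_of_nonneg_left (kk_le (hep n) hβ z) (by positivity : 0 ≤ t / C)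
    linarith
  · intro n
    exact good_cmul (Real.exp_pos _).le (good_exp (hep n) hβ (by positivity))
  · intro z
    have h1 := (aecover_Ioi_of_Ioi (μ := volume) helim).integral_tendsto_of_countably_generated (sub_int hβ hβ1 (sq_nonneg ‖z‖))
    have h2 : Tendsto (fun n => kk (e n) β (0 : Ed d) - kk (e n) β z) atTop (𝓝 (‖z‖ ^ α * C)) := by
      rw [sub_scale hβ (sq_nonneg _), ← hC] at h1
      have e1 : (‖z‖ ^ 2) ^ β = ‖z‖ ^ α := by
        rw [← Real.rpow_natCast, ← Real.rpow_mul (norm_nonneg _)]; congr 1; push_cast; rw [hβd]; ring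
      rw [e1] at h1
      refine h1.congr fun n => ?_
      rw [hdiff, Measure.restrict_restrict measurableSet_Ioi, inter_eq_left.2 (Ioi_subset_Ioi (hep n).le)]
    have h3 : Tendsto (fun n => -(t / C) * (kk (e n) β (0 : Ed d) - kk (e n) β z)) atTop (𝓝 (-t * ‖z‖ ^ α)) := by
      have := h2.const_mul (-(t / C))
      convert this using 2
      field_simp
    refine ((Real.continuous_exp.tendsto _).comp h3).congr fun n => ?_
    simp only [Function.comp]
    rw [← Real.exp_add]; ring_nf

/-- convolution profile of the stable kernel -/
def KK (d : ℕ) (α t : ℝ) (w : Ed d) : ℝ := (2 * π) ^ (-(d : ℝ)) * ∫ z : Ed d, Real.cos ⟪w, z⟫ * Real.exp (-t * ‖z‖ ^ α)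

lemma frac_eq (α t : ℝ) (x y : Ed d) : fracKernel d α t x y = KK d α t (y - x) := rfl

lemma stable_int {α t : ℝ} (hd : 0 < d) (hα : 0 < α) (ht : 0 < t) : Integrable (fun z : Ed d => Real.exp (-t * ‖z‖ ^ α)) := by
  haveI : Nonempty (Fin d) := ⟨⟨0, hd⟩⟩
  have := integrable_fun_norm_addHaar (μ := (volume : Measure (Ed d))) (f := fun r : ℝ => Real.exp (-t * r ^ α))
  refine this.2 ?_
  have h2 := integrableOn_rpow_mul_exp_neg_mul_rpow (s := ((d - 1 : ℕ) : ℝ)) (p := α) (b := t) (by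
    have : (0:ℝ) ≤ ((d - 1 : ℕ) : ℝ) := by positivity
    linarith) hα ht
  simpa using h2

lemma KK_mono {α t : ℝ} (hd : 0 < d) (hα : 0 < α) (hα2 : α < 2) (ht : 0 < t) {x y : Ed d} (hxy : ‖x‖ ≤ ‖y‖) :
    0 ≤ KK d α t y ∧ KK d α t y ≤ KK d α t x := by
  set G := fun z : Ed d => Real.exp (-t * ‖z‖ ^ α) with hG
  have hlim : ∀ x : Ed d, Tendsto (fun n : ℕ => II (1 / ((n:ℝ) + 1)) G x) atTop (𝓝 (∫ z, Real.cos ⟪x, z⟫ * G z)) := by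
    intro x
    apply tendsto_integral_of_dominated_convergence (fun z => G z)
    · intro n; apply Measurable.aestronglyMeasurable; fun_prop
    · exact stable_int hd hα ht
    · intro n; refine ae_of_all _ fun z => ?_
      rw [norm_mul, norm_mul, Real.norm_eq_abs, Real.norm_eq_abs, Real.norm_eq_abs, abs_of_pos (Real.exp_pos _),
        abs_of_pos (Real.exp_pos _)]
      have : Real.exp (-(1 / ((n:ℝ) + 1)) * ‖z‖ ^ 2) ≤ 1 := by
        apply Real.exp_le_one_iff.2
        rw [neg_mul]; apply neg_nonpos.2; positivity
      calc _ ≤ 1 * (1 * G z) := by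
            gcongr
            · exact Real.abs_cos_le_one _
        _ = _ := by ring
    · refine ae_of_all _ fun z => ?_
      have h1 : Tendsto (fun n : ℕ => Real.exp (-(1 / ((n:ℝ) + 1)) * ‖z‖ ^ 2)) atTop (𝓝 1) := by
        have : Tendsto (fun n : ℕ => -(1 / ((n:ℝ) + 1)) * ‖z‖ ^ 2) atTop (𝓝 0) := by
          have := (tendsto_one_div_add_atTop_nhds_zero_nat (𝕜 := ℝ)).neg.mul_const (‖z‖ ^ 2)
          simpa using this
        have := (Real.continuous_exp.tendsto _).comp this
        rw [Real.exp_zero] at this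
        exact this
      have := (h1.mul_const (G z)).const_mul (Real.cos ⟪x, z⟫)
      simpa using this
  have hg := good_stable (d := d) hα hα2 ht.le
  have hn : ∀ n : ℕ, 0 < 1 / ((n:ℝ) + 1) := fun n => by positivity
  unfold KK
  constructor
  · refine mul_nonneg (by positivity) (ge_of_tendsto' (hlim y) fun n => (hg _ (hn n) x y hxy).1)
  · refine mul_le_mul_of_nonneg_left ?_ (by positivity)
    exact le_of_tendsto_of_tendsto' (hlim y) (hlim x) fun n => (hg _ (hn n) x y hxy).2

end GoodSec2



section KKSec
variable {d : ℕ}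

lemma Ed_smul_int (l : ℝ) (hl : 0 < l) (f : Ed d → ℝ) : ∫ z, f (l • z) = l ^ (-(d:ℝ)) * ∫ z, f z := by
  rw [Measure.integral_comp_smul, finrank_euclideanSpace_fin, smul_eq_mul, abs_of_pos (by positivity),
    Real.rpow_neg hl.le, Real.rpow_natCast]

lemma norm_smul_rpow {α l : ℝ} (hl : 0 < l) (z : Ed d) : ‖l • z‖ ^ α = l ^ α * ‖z‖ ^ α := by
  rw [norm_smul, Real.norm_of_nonneg hl.le, Real.mul_rpow hl.le (norm_nonneg _)]

lemma KK_scal {α l t : ℝ} (hl : 0 < l) (w : Ed d) : KK d α (l ^ α * t) (l • w) = l ^ (-(d:ℝ)) * KK d α t w := by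
  unfold KK
  have : ∀ z : Ed d, Real.cos ⟪l • w, z⟫ * Real.exp (-(l ^ α * t) * ‖z‖ ^ α)
      = (fun z : Ed d => Real.cos ⟪w, z⟫ * Real.exp (-t * ‖z‖ ^ α)) (l • z) := by
    intro z
    simp only
    rw [norm_smul_rpow hl, inner_smul_left, inner_smul_right]
    simp only [conj_trivial]
    ring_nf
  rw [integral_congr_ae (ae_of_all _ this), Ed_smul_int l hl (fun z : Ed d => Real.cos ⟪w, z⟫ * Real.exp (-t * ‖z‖ ^ α))]; ring

lemma KK_neg (α t : ℝ) (w : Ed d) : KK d α t (-w) = KK d α t w := by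
  unfold KK; simp

lemma KK_meas (α : ℝ) : Measurable (fun q : ℝ × Ed d => KK d α q.1 q.2) := by
  unfold KK
  apply Measurable.const_mul
  apply StronglyMeasurable.measurable
  have : StronglyMeasurable (fun w : (ℝ × Ed d) × Ed d => Real.cos ⟪w.1.2, w.2⟫ * Real.exp (-w.1.1 * ‖w.2‖ ^ α)) :=
    Measurable.stronglyMeasurable (by fun_prop)
  exact this.integral_prod_right'

lemma KK_meas' (α t : ℝ) : Measurable (KK d α t) :=
  Measurable.of_uncurry_left (f := fun t w => KK d α t w) (KK_meas α)

lemma KK_bound {α t : ℝ} (hd : 0 < d) (hα : 0 < α) (hα2 : α < 2) (ht : 0 < t) (w : Ed d) : KK d α t w ≤ KK d α t 0 :=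
  (KK_mono hd hα hα2 ht (by simp)).2

lemma KK_nonneg {α t : ℝ} (hd : 0 < d) (hα : 0 < α) (hα2 : α < 2) (ht : 0 < t) (w : Ed d) : 0 ≤ KK d α t w :=
  (KK_mono hd hα hα2 ht (le_refl _)).1

lemma KK_pair {α t : ℝ} (hd : 0 < d) (hα : 0 < α) (ht : 0 < t) {g : Ed d → ℝ} (hg : Integrable g) :
    ∫ w, KK d α t w * g w = (2 * π) ^ (-(d : ℝ)) * ∫ z : Ed d, Real.exp (-t * ‖z‖ ^ α) * ∫ w, Real.cos ⟪w, z⟫ * g w := by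
  unfold KK
  calc _ = ∫ w : Ed d, ∫ z : Ed d, (2 * π) ^ (-(d : ℝ)) * (Real.cos ⟪w, z⟫ * Real.exp (-t * ‖z‖ ^ α) * g w) := by
        congr 1; ext w
        rw [integral_const_mul, integral_mul_const]; ring
    _ = ∫ z : Ed d, ∫ w : Ed d, (2 * π) ^ (-(d : ℝ)) * (Real.cos ⟪w, z⟫ * Real.exp (-t * ‖z‖ ^ α) * g w) := by
        apply integral_integral_swap
        unfold Function.uncurry
        apply Integrable.const_mul
        refine Integrable.mono' (hg.norm.mul_prod (stable_int hd hα ht)) ?_ (ae_of_all _ fun q => ?_)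
        · refine AEStronglyMeasurable.mul (Measurable.aestronglyMeasurable (by fun_prop)) ?_
          exact hg.aestronglyMeasurable.comp_fst
        · rw [norm_mul, norm_mul, Real.norm_of_nonneg (Real.exp_pos _).le]
          calc _ ≤ 1 * Real.exp (-t * ‖q.2‖ ^ α) * ‖g q.1‖ := by
                gcongr; exact Real.abs_cos_le_one _
            _ = _ := by ring
    _ = _ := by
        rw [← integral_const_mul]
        congr 1; ext z
        rw [integral_const_mul, ← integral_const_mul (Real.exp (-t * ‖z‖ ^ α))]
        congr 2; ext w; ring

lemma gcos_int {η : ℝ} (hη : 0 < η) (x : Ed d) : Integrable (fun w : Ed d => Real.cos ⟪x, w⟫ * Real.exp (-η * ‖w‖ ^ 2)) := by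
  refine Integrable.mono' (gauss_int hη) (Measurable.aestronglyMeasurable (by fun_prop)) (ae_of_all _ fun w => ?_)
  rw [norm_mul, Real.norm_of_nonneg (Real.exp_pos _).le]
  calc _ ≤ 1 * Real.exp (-η * ‖w‖ ^ 2) := by gcongr; exact Real.abs_cos_le_one _
    _ = _ := one_mul _

lemma gauss2 {η : ℝ} (hη : 0 < η) (z x : Ed d) :
    ∫ w : Ed d, Real.cos ⟪w, z⟫ * (Real.cos ⟪w, x⟫ * Real.exp (-η * ‖w‖ ^ 2))
      = (π / η) ^ ((d:ℝ) / 2) / 2 * (Real.exp (-‖z - x‖ ^ 2 / (4 * η)) + Real.exp (-‖z + x‖ ^ 2 / (4 * η))) := by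
  have e : ∀ w : Ed d, Real.cos ⟪w, z⟫ * (Real.cos ⟪w, x⟫ * Real.exp (-η * ‖w‖ ^ 2))
      = (1 / 2) * (Real.cos ⟪z - x, w⟫ * Real.exp (-η * ‖w‖ ^ 2) + Real.cos ⟪z + x, w⟫ * Real.exp (-η * ‖w‖ ^ 2)) := by
    intro w
    rw [inner_sub_left, inner_add_left, Real.cos_sub, Real.cos_add, real_inner_comm w z, real_inner_comm w x]; ring
  simp_rw [e]
  rw [integral_const_mul, integral_add (gcos_int hη _) (gcos_int hη _), gauss_cos hη, gauss_cos hη]; ring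

lemma gshift_int {α t η : ℝ} (hη : 0 < η) (ht : 0 < t) (x : Ed d) :
    Integrable (fun z : Ed d => Real.exp (-t * ‖z‖ ^ α) * Real.exp (-‖z - x‖ ^ 2 / (4 * η))) := by
  have h1 := (gauss_int (d := d) (η := 1 / (4 * η)) (by positivity)).comp_sub_right x
  refine Integrable.mono' h1 (Measurable.aestronglyMeasurable (by fun_prop)) (ae_of_all _ fun z => ?_)
  rw [norm_mul, Real.norm_of_nonneg (Real.exp_pos _).le, Real.norm_of_nonneg (Real.exp_pos _).le]
  have : Real.exp (-t * ‖z‖ ^ α) ≤ 1 := by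
    apply Real.exp_le_one_iff.2
    rw [neg_mul]; apply neg_nonpos.2; positivity
  calc _ ≤ 1 * Real.exp (-‖z - x‖ ^ 2 / (4 * η)) := by gcongr
    _ = _ := by rw [one_mul]; congr 1; field_simp

lemma KK_gauss {α t η : ℝ} (hd : 0 < d) (hα : 0 < α) (ht : 0 < t) (hη : 0 < η) (x : Ed d) :
    ∫ w, KK d α t w * (Real.cos ⟪w, x⟫ * Real.exp (-η * ‖w‖ ^ 2))
      = π ^ (-((d:ℝ) / 2)) * ∫ u : Ed d, Real.exp (-t * ‖x + (2 * √η) • u‖ ^ α) * Real.exp (-‖u‖ ^ 2) := by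
  have hi : Integrable (fun w : Ed d => Real.cos ⟪w, x⟫ * Real.exp (-η * ‖w‖ ^ 2)) := by
    simpa [real_inner_comm] using gcos_int hη x
  rw [KK_pair hd hα ht hi]
  simp_rw [gauss2 hη]
  have e1 : ∀ z : Ed d, Real.exp (-t * ‖z‖ ^ α) * ((π / η) ^ ((d:ℝ) / 2) / 2 * (Real.exp (-‖z - x‖ ^ 2 / (4 * η)) + Real.exp (-‖z + x‖ ^ 2 / (4 * η))))
      = ((π / η) ^ ((d:ℝ) / 2) / 2) * (Real.exp (-t * ‖z‖ ^ α) * Real.exp (-‖z - x‖ ^ 2 / (4 * η)) +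
        Real.exp (-t * ‖z‖ ^ α) * Real.exp (-‖z - (-x)‖ ^ 2 / (4 * η))) := by
    intro z; rw [sub_neg_eq_add]; ring
  simp_rw [e1]
  rw [integral_const_mul, integral_add (gshift_int hη ht _) (gshift_int hη ht _)]
  have e2 : ∫ z : Ed d, Real.exp (-t * ‖z‖ ^ α) * Real.exp (-‖z - (-x)‖ ^ 2 / (4 * η))
      = ∫ z : Ed d, Real.exp (-t * ‖z‖ ^ α) * Real.exp (-‖z - x‖ ^ 2 / (4 * η)) := by
    rw [← integral_neg_eq_self]
    congr 1; ext z
    rw [norm_neg, show -z - -x = -(z - x) by abel, norm_neg]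
  have e3 : ∫ z : Ed d, Real.exp (-t * ‖z‖ ^ α) * Real.exp (-‖z - x‖ ^ 2 / (4 * η))
      = ∫ z : Ed d, Real.exp (-t * ‖x + z‖ ^ α) * Real.exp (-‖z‖ ^ 2 / (4 * η)) := by
    rw [← integral_add_left_eq_self _ x]
    congr 1; ext z
    rw [add_sub_cancel_left]
  have hl : 0 < 2 * √η := by positivity
  have e4 : ∫ u : Ed d, Real.exp (-t * ‖x + (2 * √η) • u‖ ^ α) * Real.exp (-‖u‖ ^ 2)
      = (2 * √η) ^ (-(d:ℝ)) * ∫ z : Ed d, Real.exp (-t * ‖x + z‖ ^ α) * Real.exp (-‖z‖ ^ 2 / (4 * η)) := by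
    rw [← Ed_smul_int (2 * √η) hl]
    congr 1; ext u
    congr 2
    rw [norm_smul, Real.norm_of_nonneg hl.le, mul_pow, mul_pow, Real.sq_sqrt hη.le]
    field_simp; ring
  rw [e2, e3, e4]
  have hc : (2 * π) ^ (-(d : ℝ)) * ((π / η) ^ ((d:ℝ) / 2)) = π ^ (-((d:ℝ) / 2)) * (2 * √η) ^ (-(d:ℝ)) := by
    have hpi := Real.pi_pos
    rw [Real.mul_rpow (by norm_num) hpi.le, Real.mul_rpow (by norm_num) (Real.sqrt_nonneg _), Real.div_rpow hpi.le hη.le,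
      Real.sqrt_eq_rpow, ← Real.rpow_mul hη.le, show (1/2 : ℝ) * (-(d:ℝ)) = -((d:ℝ)/2) by ring, Real.rpow_neg hη.le]
    have : π ^ (-(d:ℝ)) * π ^ ((d:ℝ)/2) = π ^ (-((d:ℝ)/2)) := by
      rw [← Real.rpow_add hpi]; congr 1; ring
    rw [← this]; ring
  calc _ = ((2 * π) ^ (-(d : ℝ)) * ((π / η) ^ ((d:ℝ) / 2))) * ∫ z : Ed d, Real.exp (-t * ‖x + z‖ ^ α) * Real.exp (-‖z‖ ^ 2 / (4 * η)) := by ring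
    _ = _ := by rw [hc]; ring

lemma gauss_one : ∫ u : Ed d, Real.exp (-‖u‖ ^ 2) = π ^ ((d:ℝ) / 2) := by
  have := gauss_cos (d := d) (η := 1) one_pos 0
  simpa using this

lemma KK_gauss_lim {α t : ℝ} (hd : 0 < d) (hα : 0 < α) (ht : 0 < t) (x : Ed d) :
    Tendsto (fun n : ℕ => ∫ w, KK d α t w * (Real.cos ⟪w, x⟫ * Real.exp (-(1 / ((n:ℝ) + 1)) * ‖w‖ ^ 2))) atTop
      (𝓝 (Real.exp (-t * ‖x‖ ^ α))) := by
  have hn : ∀ n : ℕ, 0 < 1 / ((n:ℝ) + 1) := fun n => by positivity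
  simp_rw [fun n : ℕ => KK_gauss hd hα ht (hn n) x]
  have h : Tendsto (fun n : ℕ => ∫ u : Ed d, Real.exp (-t * ‖x + (2 * √(1 / ((n:ℝ) + 1))) • u‖ ^ α) * Real.exp (-‖u‖ ^ 2)) atTop
      (𝓝 (∫ u : Ed d, Real.exp (-t * ‖x‖ ^ α) * Real.exp (-‖u‖ ^ 2))) := by
    apply tendsto_integral_of_dominated_convergence (fun u => Real.exp (-‖u‖ ^ 2))
    · intro n; apply Measurable.aestronglyMeasurable; fun_prop
    · simpa using gauss_int (d := d) one_pos
    · intro n; refine ae_of_all _ fun u => ?_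
      rw [norm_mul, Real.norm_of_nonneg (Real.exp_pos _).le, Real.norm_of_nonneg (Real.exp_pos _).le]
      have : Real.exp (-t * ‖x + (2 * √(1 / ((n:ℝ) + 1))) • u‖ ^ α) ≤ 1 := by
        apply Real.exp_le_one_iff.2
        rw [neg_mul]; apply neg_nonpos.2; positivity
      calc _ ≤ 1 * Real.exp (-‖u‖ ^ 2) := by gcongr
        _ = _ := one_mul _
    · refine ae_of_all _ fun u => ?_
      have c : Continuous (fun s : ℝ => Real.exp (-t * ‖x + (2 * √s) • u‖ ^ α) * Real.exp (-‖u‖ ^ 2)) := by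
        refine Continuous.mul (Real.continuous_exp.comp (continuous_const.mul ?_)) continuous_const
        exact (by fun_prop : Continuous (fun s : ℝ => ‖x + (2 * √s) • u‖)).rpow_const fun _ => Or.inr hα.le
      have := (c.tendsto 0).comp (tendsto_one_div_add_atTop_nhds_zero_nat (𝕜 := ℝ))
      simpa [Function.comp_def] using this
  have h2 := h.const_mul (π ^ (-((d:ℝ) / 2)))
  rw [integral_const_mul, gauss_one] at h2
  convert h2 using 2
  have hpi := Real.pi_pos
  rw [mul_left_comm, ← Real.rpow_add hpi]; simp

lemma KK_mass {α t : ℝ} (hd : 0 < d) (hα : 0 < α) (hα2 : α < 2) (ht : 0 < t) : ∫⁻ w, ENNReal.ofReal (KK d α t w) = 1 := by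
  have hn : ∀ n : ℕ, 0 < 1 / ((n:ℝ) + 1) := fun n => by positivity
  have hm := KK_meas' (d := d) α t
  have hnn := KK_nonneg (d := d) hd hα hα2 ht
  have h1 : Tendsto (fun n : ℕ => ∫⁻ w : Ed d, ENNReal.ofReal (KK d α t w * Real.exp (-(1 / ((n:ℝ) + 1)) * ‖w‖ ^ 2))) atTop
      (𝓝 (∫⁻ w, ENNReal.ofReal (KK d α t w))) := by
    apply lintegral_tendsto_of_tendsto_of_monotone
    · intro n; fun_prop
    · refine ae_of_all _ fun w => ?_
      intro m n hmn
      apply ENNReal.ofReal_le_ofReal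
      refine mul_le_mul_of_nonneg_left ?_ (hnn w)
      apply Real.exp_le_exp.2
      have : 1 / ((n:ℝ) + 1) ≤ 1 / ((m:ℝ) + 1) := by
        have : (m:ℝ) ≤ n := by exact_mod_cast hmn
        gcongr
      nlinarith [sq_nonneg ‖w‖]
    · refine ae_of_all _ fun w => ?_
      have c : Continuous (fun s : ℝ => ENNReal.ofReal (KK d α t w * Real.exp (-s * ‖w‖ ^ 2))) :=
        ENNReal.continuous_ofReal.comp (by fun_prop)
      have := (c.tendsto 0).comp (tendsto_one_div_add_atTop_nhds_zero_nat (𝕜 := ℝ))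
      simpa [Function.comp_def] using this
  have h2 := KK_gauss_lim (d := d) hd hα ht 0
  have h3 : Tendsto (fun n : ℕ => ∫⁻ w : Ed d, ENNReal.ofReal (KK d α t w * Real.exp (-(1 / ((n:ℝ) + 1)) * ‖w‖ ^ 2))) atTop (𝓝 1) := by
    have := (ENNReal.continuous_ofReal.tendsto _).comp h2
    have e : ENNReal.ofReal (Real.exp (-t * ‖(0 : Ed d)‖ ^ α)) = 1 := by simp [Real.zero_rpow hα.ne']
    rw [e] at this
    refine this.congr fun n => ?_
    simp only [Function.comp, inner_zero_right, Real.cos_zero, one_mul]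
    rw [ofReal_integral_eq_lintegral_ofReal]
    · refine Integrable.mono' ((gauss_int (hn n)).const_mul (KK d α t 0)) ?_ (ae_of_all _ fun w => ?_)
      · exact Measurable.aestronglyMeasurable (by fun_prop)
      · rw [Real.norm_of_nonneg (mul_nonneg (hnn w) (Real.exp_pos _).le)]
        exact mul_le_mul_of_nonneg_right (KK_bound hd hα hα2 ht w) (Real.exp_pos _).le
    · exact ae_of_all _ fun w => mul_nonneg (hnn w) (Real.exp_pos _).le
  exact tendsto_nhds_unique h1 h3

lemma KK_int {α t : ℝ} (hd : 0 < d) (hα : 0 < α) (hα2 : α < 2) (ht : 0 < t) : Integrable (KK d α t) := by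
  refine ⟨(KK_meas' α t).aestronglyMeasurable, ?_⟩
  rw [hasFiniteIntegral_iff_ofReal (ae_of_all _ (KK_nonneg hd hα hα2 ht)), KK_mass hd hα hα2 ht]
  exact ENNReal.one_lt_top

lemma KK_cos {α t : ℝ} (hd : 0 < d) (hα : 0 < α) (hα2 : α < 2) (ht : 0 < t) (x : Ed d) :
    ∫ w, KK d α t w * Real.cos ⟪w, x⟫ = Real.exp (-t * ‖x‖ ^ α) := by
  refine tendsto_nhds_unique ?_ (KK_gauss_lim hd hα ht x)
  have hm := KK_meas' (d := d) α t
  apply tendsto_integral_of_dominated_convergence (fun w => KK d α t w)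
  · intro n; exact Measurable.aestronglyMeasurable (by fun_prop)
  · exact KK_int hd hα hα2 ht
  · intro n; refine ae_of_all _ fun w => ?_
    rw [norm_mul, norm_mul, Real.norm_of_nonneg (KK_nonneg hd hα hα2 ht w), Real.norm_of_nonneg (Real.exp_pos _).le]
    have : Real.exp (-(1 / ((n:ℝ) + 1)) * ‖w‖ ^ 2) ≤ 1 := by
      apply Real.exp_le_one_iff.2
      rw [neg_mul]; apply neg_nonpos.2; positivity
    calc _ ≤ KK d α t w * (1 * 1) := by
          refine mul_le_mul_of_nonneg_left ?_ (KK_nonneg hd hα hα2 ht w)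
          gcongr
          exact Real.abs_cos_le_one _
      _ = _ := by ring
  · refine ae_of_all _ fun w => ?_
    have c : Continuous (fun s : ℝ => KK d α t w * (Real.cos ⟪w, x⟫ * Real.exp (-s * ‖w‖ ^ 2))) := by fun_prop
    have := (c.tendsto 0).comp (tendsto_one_div_add_atTop_nhds_zero_nat (𝕜 := ℝ))
    simpa [Function.comp_def] using this

lemma KK_sin {α t : ℝ} (x : Ed d) : ∫ w, KK d α t w * Real.sin ⟪w, x⟫ = 0 := by
  have := integral_neg_eq_self (fun w : Ed d => KK d α t w * Real.sin ⟪w, x⟫) volume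
  simp only [KK_neg, inner_neg_left, Real.sin_neg, mul_neg] at this
  rw [integral_neg] at this
  linarith

lemma KK_conv {α s t : ℝ} (hd : 0 < d) (hα : 0 < α) (hα2 : α < 2) (hs : 0 < s) (ht : 0 < t) (x : Ed d) :
    ∫ w, KK d α t (x - w) * KK d α s w = KK d α (s + t) x := by
  have hi := KK_int (d := d) hd hα hα2 hs
  have e0 : ∫ w, KK d α t (x - w) * KK d α s w = ∫ w, KK d α t w * KK d α s (x - w) := by
    rw [← integral_sub_left_eq_self _ volume x]
    congr 1; ext w; rw [sub_sub_cancel]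
  rw [e0, KK_pair hd hα ht (hi.comp_sub_left x)]
  have hci : ∀ z : Ed d, Integrable (fun w => KK d α s w * Real.cos ⟪w, z⟫) := fun z => by
    refine Integrable.mono' hi ((KK_meas' α s).mul (by fun_prop)).aestronglyMeasurable (ae_of_all _ fun w => ?_)
    rw [norm_mul, Real.norm_of_nonneg (KK_nonneg hd hα hα2 hs w)]
    exact mul_le_of_le_one_right (KK_nonneg hd hα hα2 hs w) (Real.abs_cos_le_one _)
  have hsi : ∀ z : Ed d, Integrable (fun w => KK d α s w * Real.sin ⟪w, z⟫) := fun z => by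
    refine Integrable.mono' hi ((KK_meas' α s).mul (by fun_prop)).aestronglyMeasurable (ae_of_all _ fun w => ?_)
    rw [norm_mul, Real.norm_of_nonneg (KK_nonneg hd hα hα2 hs w)]
    exact mul_le_of_le_one_right (KK_nonneg hd hα hα2 hs w) (Real.abs_sin_le_one _)
  have e1 : ∀ z : Ed d, ∫ w, Real.cos ⟪w, z⟫ * KK d α s (x - w) = Real.cos ⟪x, z⟫ * Real.exp (-s * ‖z‖ ^ α) := by
    intro z
    rw [← integral_sub_left_eq_self _ volume x]
    have : ∀ w : Ed d, Real.cos ⟪x - w, z⟫ * KK d α s (x - (x - w)) =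
        Real.cos ⟪x, z⟫ * (KK d α s w * Real.cos ⟪w, z⟫) + Real.sin ⟪x, z⟫ * (KK d α s w * Real.sin ⟪w, z⟫) := by
      intro w; rw [sub_sub_cancel, inner_sub_left, Real.cos_sub]; ring
    simp_rw [this]
    rw [integral_add ((hci z).const_mul _) ((hsi z).const_mul _), integral_const_mul, integral_const_mul, KK_cos hd hα hα2 hs,
      KK_sin, mul_zero, add_zero]
  simp_rw [e1]
  unfold KK
  congr 2; ext z
  rw [mul_left_comm, ← Real.exp_add]; ring_nf

/-- the stable kernel, extended-nonnegative valued -/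
def pk (d : ℕ) (α : ℝ) (t : ℝ) (x y : Ed d) : ℝ≥0∞ := ENNReal.ofReal (fracKernel d α t x y)

lemma pk_eq (α t : ℝ) (x y : Ed d) : pk d α t x y = ENNReal.ofReal (KK d α t (y - x)) := rfl

lemma pk_symm (α t : ℝ) (x y : Ed d) : pk d α t x y = pk d α t y x := by
  rw [pk_eq, pk_eq, ← KK_neg, neg_sub]

lemma pk_ck {α : ℝ} (hd : 0 < d) (hα : 0 < α) (hα2 : α < 2) : CK volume (pk d α) := by
  intro s t hs ht x y
  simp only [pk_eq]
  have hms := KK_meas' (d := d) α s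
  have hmt := KK_meas' (d := d) α t
  rw [← lintegral_add_right_eq_self _ x, ← KK_conv hd hα hα2 hs ht, ofReal_integral_eq_lintegral_ofReal]
  · congr 1; ext w
    rw [← ENNReal.ofReal_mul (KK_nonneg hd hα hα2 hs _), mul_comm, add_sub_cancel_right]
    congr 2; congr 1; abel
  · refine Integrable.mono' ((KK_int hd hα hα2 hs).const_mul (KK d α t 0)) ?_ (ae_of_all _ fun w => ?_)
    · exact ((hmt.comp (by fun_prop)).mul hms).aestronglyMeasurable
    · rw [Real.norm_of_nonneg (mul_nonneg (KK_nonneg hd hα hα2 ht _) (KK_nonneg hd hα hα2 hs _))]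
      exact mul_le_mul_of_nonneg_right (KK_bound hd hα hα2 ht _) (KK_nonneg hd hα hα2 hs _)
  · exact ae_of_all _ fun w => mul_nonneg (KK_nonneg hd hα hα2 ht _) (KK_nonneg hd hα hα2 hs _)

lemma pk_mass {α t : ℝ} (hd : 0 < d) (hα : 0 < α) (hα2 : α < 2) (ht : 0 < t) (x : Ed d) : ∫⁻ z, pk d α t x z = 1 := by
  simp only [pk_eq]
  rw [← KK_mass hd hα hα2 ht, ← lintegral_add_right_eq_self _ x]
  simp

lemma pk_jm (α : ℝ) : JM (pk d α) := by
  unfold JM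
  simp only [pk_eq]
  refine Measurable.ennreal_ofReal ?_
  exact Measurable.comp (g := fun q : ℝ × Ed d => KK d α q.1 q.2) (f := fun q : ℝ × Ed d × Ed d => (q.1, q.2.2 - q.2.1))
    (KK_meas α) (by fun_prop)

lemma pk_scal {α : ℝ} (l : ℝ) (hl : 0 < l) (t : ℝ) (x y : Ed d) :
    pk d α (l ^ α * t) (l • x) (l • y) = ENNReal.ofReal (l ^ (-(d:ℝ))) * pk d α t x y := by
  rw [pk_eq, pk_eq, ← smul_sub, KK_scal hl, ENNReal.ofReal_mul (by positivity)]

end KKSec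



section BdSec
variable {d : ℕ}

/-- truncated second moment functional -/
def DD (d : ℕ) (α R : ℝ) : ℝ := ∫ w : Ed d, KK d α 1 w * (1 - Real.exp (-‖w‖ ^ 2 / R ^ 2))

lemma exp_fac_nonneg {R : ℝ} (w : Ed d) : 0 ≤ 1 - Real.exp (-‖w‖ ^ 2 / R ^ 2) := by
  have : Real.exp (-‖w‖ ^ 2 / R ^ 2) ≤ 1 := by
    apply Real.exp_le_one_iff.2
    rw [neg_div]; apply neg_nonpos.2; positivity
  linarith

lemma exp_fac_le {R : ℝ} (w : Ed d) : 1 - Real.exp (-‖w‖ ^ 2 / R ^ 2) ≤ 1 := by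
  linarith [Real.exp_pos (-‖w‖ ^ 2 / R ^ 2)]

lemma DD_int {α : ℝ} (hd : 0 < d) (hα : 0 < α) (hα2 : α < 2) (R : ℝ) :
    Integrable (fun w : Ed d => KK d α 1 w * (1 - Real.exp (-‖w‖ ^ 2 / R ^ 2))) := by
  refine Integrable.mono' (KK_int hd hα hα2 one_pos) ((KK_meas' α 1).mul (by fun_prop)).aestronglyMeasurable
    (ae_of_all _ fun w => ?_)
  rw [norm_mul, Real.norm_of_nonneg (KK_nonneg hd hα hα2 one_pos w), Real.norm_of_nonneg (exp_fac_nonneg w)]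
  exact mul_le_of_le_one_right (KK_nonneg hd hα hα2 one_pos w) (exp_fac_le w)

lemma KK_int_one {α t : ℝ} (hd : 0 < d) (hα : 0 < α) (hα2 : α < 2) (ht : 0 < t) : ∫ w, KK d α t w = 1 := by
  have := KK_cos (d := d) hd hα hα2 ht 0
  simpa [Real.zero_rpow hα.ne'] using this

lemma gsq_int : Integrable (fun u : Ed d => Real.exp (-‖u‖ ^ 2)) := by
  simpa using gauss_int (d := d) one_pos

lemma DD_eq {α : ℝ} (hd : 0 < d) (hα : 0 < α) (hα2 : α < 2) {R : ℝ} (hR : 0 < R) :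
    DD d α R = π ^ (-((d:ℝ) / 2)) * ∫ u : Ed d, (1 - Real.exp (-(R ^ (-α) * (2 ^ α * ‖u‖ ^ α)))) * Real.exp (-‖u‖ ^ 2) := by
  have hK := KK_int (d := d) hd hα hα2 one_pos
  have h1 : DD d α R = 1 - ∫ w : Ed d, KK d α 1 w * Real.exp (-‖w‖ ^ 2 / R ^ 2) := by
    have hE : Integrable (fun w : Ed d => KK d α 1 w * Real.exp (-‖w‖ ^ 2 / R ^ 2)) := by
      refine Integrable.mono' hK ((KK_meas' α 1).mul (by fun_prop)).aestronglyMeasurable (ae_of_all _ fun w => ?_)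
      rw [norm_mul, Real.norm_of_nonneg (KK_nonneg hd hα hα2 one_pos w), Real.norm_of_nonneg (Real.exp_pos _).le]
      exact mul_le_of_le_one_right (KK_nonneg hd hα hα2 one_pos w) (by linarith [exp_fac_nonneg (R := R) w])
    have := integral_sub hK hE
    rw [KK_int_one hd hα hα2 one_pos] at this
    rw [← this]
    unfold DD
    congr 1; ext w; ring
  have h2 := KK_gauss (d := d) (t := 1) (η := 1 / R ^ 2) hd hα one_pos (by positivity) 0
  have h3 : ∫ w : Ed d, KK d α 1 w * Real.exp (-‖w‖ ^ 2 / R ^ 2) = π ^ (-((d:ℝ) / 2)) * ∫ u : Ed d, Real.exp (-(R ^ (-α) * (2 ^ α * ‖u‖ ^ α))) * Real.exp (-‖u‖ ^ 2) := by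
    calc _ = ∫ w, KK d α 1 w * (Real.cos ⟪w, 0⟫ * Real.exp (-(1 / R ^ 2) * ‖w‖ ^ 2)) := by
          congr 1; ext w; rw [inner_zero_right, Real.cos_zero, one_mul]; congr 2; field_simp
      _ = _ := h2
      _ = _ := by
          congr 2; ext u
          rw [zero_add, norm_smul_rpow (by positivity), Real.sqrt_div (by norm_num), Real.sqrt_sq hR.le, Real.sqrt_one,
            Real.mul_rpow (by norm_num) (by positivity), Real.div_rpow (by norm_num) hR.le, Real.one_rpow, Real.rpow_neg hR.le]
          congr 2; ring
  have hpi := Real.pi_pos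
  have h4 : (1:ℝ) = π ^ (-((d:ℝ) / 2)) * ∫ u : Ed d, Real.exp (-‖u‖ ^ 2) := by
    rw [gauss_one, ← Real.rpow_add hpi]; simp
  rw [h1, h3]
  nth_rewrite 1 [h4]
  rw [← mul_sub, ← integral_sub gsq_int]
  · congr 2; ext u; ring
  · refine Integrable.mono' gsq_int (Measurable.aestronglyMeasurable (by fun_prop)) (ae_of_all _ fun u => ?_)
    rw [norm_mul, Real.norm_of_nonneg (Real.exp_pos _).le, Real.norm_of_nonneg (Real.exp_pos _).le]
    refine mul_le_of_le_one_left (Real.exp_pos _).le ?_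
    apply Real.exp_le_one_iff.2
    apply neg_nonpos.2; positivity

lemma DD_upper {α : ℝ} (hd : 0 < d) (hα : 0 < α) (hα2 : α < 2) : ∃ c > 0, ∀ R : ℝ, 0 < R → DD d α R ≤ c * R ^ (-α) := by
  have hI : Integrable (fun u : Ed d => ‖u‖ ^ α * Real.exp (-‖u‖ ^ 2)) := by
    refine Integrable.mono' ((gauss_int (d := d) (η := 1 / 2) (by norm_num)).const_mul 2) (Measurable.aestronglyMeasurable (by fun_prop))
      (ae_of_all _ fun u => ?_)
    rw [Real.norm_of_nonneg (by positivity)]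
    have h1 : ‖u‖ ^ α ≤ 1 + ‖u‖ ^ 2 := by
      rcases le_total ‖u‖ 1 with h | h
      · have := Real.rpow_le_one (norm_nonneg u) h hα.le
        nlinarith [sq_nonneg ‖u‖]
      · have := Real.rpow_le_rpow_of_exponent_le h hα2.le
        rw [Real.rpow_two] at this; linarith
    have h2 : 1 + ‖u‖ ^ 2 ≤ 2 * Real.exp (1 / 2 * ‖u‖ ^ 2) := by
      have := Real.add_one_le_exp (1 / 2 * ‖u‖ ^ 2); nlinarith
    calc _ ≤ (2 * Real.exp (1 / 2 * ‖u‖ ^ 2)) * Real.exp (-‖u‖ ^ 2) := by gcongr; linarith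
      _ = _ := by rw [mul_assoc, ← Real.exp_add]; ring_nf
  set J := ∫ u : Ed d, ‖u‖ ^ α * Real.exp (-‖u‖ ^ 2) with hJ
  have hJ0 : 0 ≤ J := integral_nonneg fun u => by positivity
  refine ⟨π ^ (-((d:ℝ) / 2)) * 2 ^ α * J + 1, by positivity, fun R hR => ?_⟩
  rw [DD_eq hd hα hα2 hR]
  have h : ∫ u : Ed d, (1 - Real.exp (-(R ^ (-α) * (2 ^ α * ‖u‖ ^ α)))) * Real.exp (-‖u‖ ^ 2) ≤ (R ^ (-α) * 2 ^ α) * J := by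
    rw [hJ, ← integral_const_mul]
    apply integral_mono_of_nonneg (ae_of_all _ fun u => ?_) (hI.const_mul _) (ae_of_all _ fun u => ?_)
    · refine mul_nonneg ?_ (Real.exp_pos _).le
      have : Real.exp (-(R ^ (-α) * (2 ^ α * ‖u‖ ^ α))) ≤ 1 := Real.exp_le_one_iff.2 (neg_nonpos.2 (by positivity))
      simpa using this
    · simp only
      have := Real.add_one_le_exp (-(R ^ (-α) * (2 ^ α * ‖u‖ ^ α)))
      calc _ ≤ (R ^ (-α) * (2 ^ α * ‖u‖ ^ α)) * Real.exp (-‖u‖ ^ 2) := by gcongr; linarith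
        _ = _ := by ring
  calc _ ≤ π ^ (-((d:ℝ) / 2)) * ((R ^ (-α) * 2 ^ α) * J) := by gcongr
    _ ≤ π ^ (-((d:ℝ) / 2)) * ((R ^ (-α) * 2 ^ α) * J) + R ^ (-α) := by
      have : 0 ≤ R ^ (-α) := by positivity
      linarith
    _ = _ := by ring

lemma exp_concave {a c : ℝ} (ha : 0 ≤ a) (ha1 : a ≤ 1) : a * (1 - Real.exp (-c)) ≤ 1 - Real.exp (-(a * c)) := by
  have := convexOn_exp.2 (mem_univ (-c)) (mem_univ 0) ha (by linarith : 0 ≤ 1 - a) (by ring)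
  simp only [smul_eq_mul, mul_zero, add_zero, Real.exp_zero, mul_one] at this
  rw [mul_neg] at this
  linarith

lemma Dint2 {α R : ℝ} (hR : 0 < R) : Integrable (fun u : Ed d => (1 - Real.exp (-(R ^ (-α) * (2 ^ α * ‖u‖ ^ α)))) * Real.exp (-‖u‖ ^ 2)) := by
  refine Integrable.mono' gsq_int (Measurable.aestronglyMeasurable (by fun_prop)) (ae_of_all _ fun u => ?_)
  have : Real.exp (-(R ^ (-α) * (2 ^ α * ‖u‖ ^ α))) ≤ 1 := Real.exp_le_one_iff.2 (neg_nonpos.2 (by positivity))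
  rw [norm_mul, Real.norm_of_nonneg (by linarith), Real.norm_of_nonneg (Real.exp_pos _).le]
  refine mul_le_of_le_one_left (Real.exp_pos _).le ?_
  linarith [Real.exp_pos (-(R ^ (-α) * (2 ^ α * ‖u‖ ^ α)))]

lemma DD_lower {α : ℝ} (hd : 0 < d) (hα : 0 < α) (hα2 : α < 2) : ∃ c > 0, ∀ R : ℝ, 1 ≤ R → c * R ^ (-α) ≤ DD d α R := by
  haveI : Nonempty (Fin d) := ⟨⟨0, hd⟩⟩
  refine ⟨DD d α 1, ?_, fun R hR => ?_⟩
  · rw [DD_eq hd hα hα2 one_pos]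
    have hpi := Real.pi_pos
    refine mul_pos (by positivity) ?_
    have hlt : ∀ u : Ed d, u ≠ 0 → Real.exp (-(1 ^ (-α) * (2 ^ α * ‖u‖ ^ α))) < 1 := fun u hu => by
      have : 0 < ‖u‖ := norm_pos_iff.2 hu
      exact Real.exp_lt_one_iff.2 (neg_neg_of_pos (by positivity))
    rw [integral_pos_iff_support_of_nonneg _ (Dint2 one_pos)]
    · have : ({0}ᶜ : Set (Ed d)) ⊆ Function.support (fun u : Ed d => (1 - Real.exp (-(1 ^ (-α) * (2 ^ α * ‖u‖ ^ α)))) * Real.exp (-‖u‖ ^ 2)) := by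
        intro u hu
        have := hlt u hu
        exact mul_ne_zero (by linarith) (Real.exp_pos _).ne'
      refine lt_of_lt_of_le ?_ (measure_mono this)
      have : IsOpen ({0}ᶜ : Set (Ed d)) := isOpen_compl_singleton
      refine this.measure_pos _ ?_
      obtain ⟨u, hu⟩ := exists_ne (0 : Ed d)
      exact ⟨u, hu⟩
    · intro u
      have : Real.exp (-(1 ^ (-α) * (2 ^ α * ‖u‖ ^ α))) ≤ 1 := Real.exp_le_one_iff.2 (neg_nonpos.2 (by positivity))
      exact mul_nonneg (by linarith) (Real.exp_pos _).le
  · have hR0 : 0 < R := by linarith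
    rw [DD_eq hd hα hα2 one_pos, DD_eq hd hα hα2 hR0, mul_assoc]
    refine mul_le_mul_of_nonneg_left ?_ (by positivity)
    rw [mul_comm, ← integral_const_mul]
    apply integral_mono ((Dint2 one_pos).const_mul _) (Dint2 hR0)
    intro u
    simp only
    rw [← mul_assoc]
    refine mul_le_mul_of_nonneg_right ?_ (Real.exp_pos _).le
    have := exp_concave (a := R ^ (-α)) (c := 2 ^ α * ‖u‖ ^ α) (by positivity) (Real.rpow_le_one_of_one_le_of_nonpos hR (by linarith))
    simpa using this

lemma KK_upper {α : ℝ} (hd : 0 < d) (hα : 0 < α) (hα2 : α < 2) :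
    ∃ C > 0, ∀ x : Ed d, x ≠ 0 → KK d α 1 x ≤ C * ‖x‖ ^ (-(d:ℝ) - α) := by
  haveI : Nonempty (Fin d) := ⟨⟨0, hd⟩⟩
  obtain ⟨c2, hc2, h2⟩ := DD_upper (d := d) hd hα hα2
  set f : Ed d → ℝ := (Metric.closedBall (0 : Ed d) 1).indicator (fun w => 1 - Real.exp (-‖w‖ ^ 2)) with hf
  have hfi : Integrable f := by
    rw [hf, integrable_indicator_iff measurableSet_closedBall]
    exact ContinuousOn.integrableOn_compact (isCompact_closedBall _ _) (by fun_prop)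
  have hf0 : ∀ w, 0 ≤ f w := fun w => indicator_nonneg (fun w _ => by
    have := exp_fac_nonneg (R := 1) w; simpa using this) w
  set v := ∫ w, f w with hv
  have hvp : 0 < v := by
    rw [hv, integral_pos_iff_support_of_nonneg hf0 hfi]
    have : (Metric.ball (0 : Ed d) 1 ∩ {0}ᶜ) ⊆ Function.support f := by
      intro w hw
      have hw1 : w ∈ Metric.closedBall (0 : Ed d) 1 := Metric.ball_subset_closedBall hw.1
      rw [Function.mem_support, hf, indicator_of_mem hw1]
      have : 0 < ‖w‖ := norm_pos_iff.2 hw.2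
      have : Real.exp (-‖w‖ ^ 2) < 1 := Real.exp_lt_one_iff.2 (neg_neg_of_pos (by positivity))
      linarith
    refine lt_of_lt_of_le ?_ (measure_mono this)
    refine (Metric.isOpen_ball.inter isOpen_compl_singleton).measure_pos _ ?_
    obtain ⟨u, hu⟩ := exists_norm_eq (Ed d) (by norm_num : (0:ℝ) ≤ 1 / 2)
    refine ⟨u, by simp [hu]; norm_num, ?_⟩
    intro h
    rw [mem_singleton_iff.1 h, norm_zero] at hu
    norm_num at hu
  refine ⟨c2 / v, by positivity, fun x hx => ?_⟩
  set r := ‖x‖ with hr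
  have hr0 : 0 < r := norm_pos_iff.2 hx
  have hle : ∫ w : Ed d, KK d α 1 x * f (r⁻¹ • w) ≤ DD d α r := by
    apply integral_mono_of_nonneg (ae_of_all _ fun w => mul_nonneg (KK_nonneg hd hα hα2 one_pos _) (hf0 _)) (DD_int hd hα hα2 r)
      (ae_of_all _ fun w => ?_)
    simp only
    by_cases hw : r⁻¹ • w ∈ Metric.closedBall (0 : Ed d) 1
    · have hw2 : ‖w‖ ≤ r := by
        rw [mem_closedBall_zero_iff, norm_smul, Real.norm_of_nonneg (by positivity), inv_mul_le_one₀ hr0] at hw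
        exact hw
      rw [hf, indicator_of_mem hw]
      have e : ‖r⁻¹ • w‖ ^ 2 = ‖w‖ ^ 2 / r ^ 2 := by
        rw [norm_smul, Real.norm_of_nonneg (by positivity), mul_pow]; field_simp
      rw [e, ← neg_div]
      exact mul_le_mul_of_nonneg_right (KK_mono hd hα hα2 one_pos hw2).2 (exp_fac_nonneg w)
    · rw [hf, indicator_of_notMem hw, mul_zero]
      exact mul_nonneg (KK_nonneg hd hα hα2 one_pos _) (exp_fac_nonneg w)
  rw [integral_const_mul, Ed_smul_int r⁻¹ (by positivity), ← hv] at hle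
  have h3 := hle.trans (h2 r hr0)
  have e1 : r⁻¹ ^ (-(d:ℝ)) = r ^ (d:ℝ) := by rw [Real.inv_rpow hr0.le, Real.rpow_neg hr0.le, inv_inv]
  rw [e1] at h3
  have e2 : r ^ (-(d:ℝ) - α) = r ^ (-α) / r ^ (d:ℝ) := by
    rw [← Real.rpow_sub hr0]; congr 1; ring
  rw [e2]
  have : 0 < r ^ (d:ℝ) := by positivity
  rw [div_mul_div_comm, le_div_iff₀ (by positivity)]
  linarith

lemma KK_lower {α : ℝ} (hd : 0 < d) (hα : 0 < α) (hα2 : α < 2) :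
    ∃ c > 0, ∀ x : Ed d, c * (1 + ‖x‖) ^ (-(d:ℝ) - α) ≤ KK d α 1 x := by
  haveI : Nonempty (Fin d) := ⟨⟨0, hd⟩⟩
  obtain ⟨c2, hc2, h2⟩ := DD_upper (d := d) hd hα hα2
  obtain ⟨c1, hc1, h1⟩ := DD_lower (d := d) hd hα hα2
  obtain ⟨θ, hθ0, hθ1, hθ⟩ : ∃ θ : ℝ, 0 < θ ∧ θ ≤ 1 ∧ 2 * c2 * θ ^ (2 - α) ≤ c1 / 4 := by
    have : Tendsto (fun θ : ℝ => 2 * c2 * θ ^ (2 - α)) (𝓝[>] 0) (𝓝 0) := by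
      have h := (Real.continuousAt_rpow_const 0 (2 - α) (Or.inr (by linarith))).tendsto.const_mul (2 * c2)
      rw [Real.zero_rpow (by linarith), mul_zero] at h
      exact h.mono_left nhdsWithin_le_nhds
    have h := this.eventually (eventually_le_nhds (by positivity : 0 < c1 / 4))
    have h' : ∀ᶠ θ : ℝ in 𝓝[>] 0, θ ≤ 1 := nhdsWithin_le_nhds (eventually_le_nhds one_pos)
    obtain ⟨θ, a, b, c⟩ := (h.and (h'.and self_mem_nhdsWithin)).exists
    exact ⟨θ, c, b, a⟩
  obtain ⟨M, hM0, hM⟩ : ∃ M : ℝ, 0 < M ∧ 2 * c2 * M ^ (-α) ≤ c1 / 4 := by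
    have : Tendsto (fun M : ℝ => 2 * c2 * M ^ (-α)) atTop (𝓝 0) := by
      have h := (tendsto_rpow_neg_atTop hα).const_mul (2 * c2)
      rwa [mul_zero] at h
    have h := this.eventually (eventually_le_nhds (by positivity : 0 < c1 / 4))
    obtain ⟨M, a, b⟩ := (h.and (eventually_gt_atTop 0)).exists
    exact ⟨M, b, a⟩
  set g : Ed d → ℝ := (Metric.closedBall (0 : Ed d) 1).indicator (fun _ => 1) with hg
  have hgi : Integrable g := by
    rw [hg, integrable_indicator_iff measurableSet_closedBall]
    exact ContinuousOn.integrableOn_compact (isCompact_closedBall _ _) (by fun_prop)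
  have hg0 : ∀ w, 0 ≤ g w := fun w => indicator_nonneg (fun w _ => zero_le_one) w
  set v := ∫ w, g w with hv
  have hv0 : 0 ≤ v := integral_nonneg hg0
  have hhalf : Real.exp (-1) ≤ 1 / 2 := by
    have := Real.exp_neg_one_lt_half
    linarith
  -- main estimate
  have main : ∀ x : Ed d, θ ≤ ‖x‖ → c1 / 2 * (‖x‖ / θ) ^ (-α) ≤ KK d α 1 x * ((M * (‖x‖ / θ)) ^ (d:ℝ) * v) := by
    intro x hx
    set R := ‖x‖ / θ with hR
    have hR1 : 1 ≤ R := by rw [hR, le_div_iff₀ hθ0]; linarith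
    have hR0 : 0 < R := by linarith
    have hxR : ‖x‖ = θ * R := by rw [hR]; field_simp
    have hMR : 0 < M * R := by positivity
    have hK := KK_nonneg (d := d) hd hα hα2 one_pos
    have key : DD d α R ≤ ∫ w : Ed d, (2 * θ ^ 2 * (KK d α 1 w * (1 - Real.exp (-‖w‖ ^ 2 / (θ * R) ^ 2)))
        + 2 * (KK d α 1 w * (1 - Real.exp (-‖w‖ ^ 2 / (M * R) ^ 2))) + KK d α 1 x * g ((M * R)⁻¹ • w)) := by
      apply integral_mono (DD_int hd hα hα2 R)
      · exact (((DD_int hd hα hα2 _).const_mul _).add ((DD_int hd hα hα2 _).const_mul _)).add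
          ((hgi.comp_smul (by positivity)).const_mul _)
      intro w
      simp only
      have n1 : 0 ≤ 2 * θ ^ 2 * (KK d α 1 w * (1 - Real.exp (-‖w‖ ^ 2 / (θ * R) ^ 2))) :=
        mul_nonneg (by positivity) (mul_nonneg (hK w) (exp_fac_nonneg w))
      have n2 : 0 ≤ 2 * (KK d α 1 w * (1 - Real.exp (-‖w‖ ^ 2 / (M * R) ^ 2))) :=
        mul_nonneg (by positivity) (mul_nonneg (hK w) (exp_fac_nonneg w))
      have n3 : 0 ≤ KK d α 1 x * g ((M * R)⁻¹ • w) := mul_nonneg (hK x) (hg0 _)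
      rcases le_total ‖w‖ (θ * R) with hw | hw
      · have hs1 : ‖w‖ ^ 2 / (θ * R) ^ 2 ≤ 1 := by
          rw [div_le_one (by positivity)]; gcongr
        have a1 := exp_concave (a := ‖w‖ ^ 2 / (θ * R) ^ 2) (c := 1) (by positivity) hs1
        have a2 := Real.add_one_le_exp (-‖w‖ ^ 2 / R ^ 2)
        have a3 : ‖w‖ ^ 2 / R ^ 2 = θ ^ 2 * (‖w‖ ^ 2 / (θ * R) ^ 2) := by field_simp
        have a4 : -‖w‖ ^ 2 / (θ * R) ^ 2 = -(‖w‖ ^ 2 / (θ * R) ^ 2 * 1) := by ring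
        have a5 : 0 ≤ ‖w‖ ^ 2 / (θ * R) ^ 2 := by positivity
        rw [a4] at n1 ⊢
        have : 1 - Real.exp (-‖w‖ ^ 2 / R ^ 2) ≤ 2 * θ ^ 2 * (1 - Real.exp (-(‖w‖ ^ 2 / (θ * R) ^ 2 * 1))) := by
          calc _ ≤ θ ^ 2 * (‖w‖ ^ 2 / (θ * R) ^ 2) := by rw [← a3]; rw [neg_div] at a2 ⊢; linarith
            _ ≤ θ ^ 2 * (2 * (‖w‖ ^ 2 / (θ * R) ^ 2 * (1 - Real.exp (-1)))) := by
              refine mul_le_mul_of_nonneg_left ?_ (by positivity)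
              nlinarith
            _ ≤ θ ^ 2 * (2 * (1 - Real.exp (-(‖w‖ ^ 2 / (θ * R) ^ 2 * 1)))) := by gcongr
            _ = _ := by ring
        have := mul_le_mul_of_nonneg_left this (hK w)
        linarith
      rcases le_or_gt ‖w‖ (M * R) with hw2 | hw2
      · have hm : (M * R)⁻¹ • w ∈ Metric.closedBall (0 : Ed d) 1 := by
          rw [mem_closedBall_zero_iff, norm_smul, Real.norm_of_nonneg (by positivity), inv_mul_le_one₀ hMR]; exact hw2
        have e : g ((M * R)⁻¹ • w) = 1 := by rw [hg, indicator_of_mem hm]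
        rw [e, mul_one]
        have b1 : KK d α 1 w ≤ KK d α 1 x := (KK_mono hd hα hα2 one_pos (by rw [hxR]; exact hw)).2
        have b2 := mul_le_of_le_one_right (hK w) (exp_fac_le (R := R) w)
        linarith
      · have b1 : Real.exp (-‖w‖ ^ 2 / (M * R) ^ 2) ≤ 1 / 2 := by
          refine le_trans (Real.exp_le_exp.2 ?_) hhalf
          rw [neg_div, neg_le_neg_iff, le_div_iff₀ (by positivity), one_mul]
          gcongr
        have b2 := mul_le_of_le_one_right (hK w) (exp_fac_le (R := R) w)
        have b3 : KK d α 1 w * 1 ≤ 2 * (KK d α 1 w * (1 - Real.exp (-‖w‖ ^ 2 / (M * R) ^ 2))) := by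
          have := mul_le_mul_of_nonneg_left (by linarith : (1:ℝ) ≤ 2 * (1 - Real.exp (-‖w‖ ^ 2 / (M * R) ^ 2))) (hK w)
          linarith
        linarith
    have I12 : Integrable (fun w : Ed d => 2 * θ ^ 2 * (KK d α 1 w * (1 - Real.exp (-‖w‖ ^ 2 / (θ * R) ^ 2)))
        + 2 * (KK d α 1 w * (1 - Real.exp (-‖w‖ ^ 2 / (M * R) ^ 2)))) :=
      ((DD_int hd hα hα2 _).const_mul _).add ((DD_int hd hα hα2 _).const_mul _)
    rw [integral_add I12
      ((hgi.comp_smul (by positivity)).const_mul _), integral_add ((DD_int hd hα hα2 _).const_mul _) ((DD_int hd hα hα2 _).const_mul _),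
      integral_const_mul, integral_const_mul, integral_const_mul, Ed_smul_int (M * R)⁻¹ (by positivity), ← hv] at key
    have e1 : (M * R)⁻¹ ^ (-(d:ℝ)) = (M * R) ^ (d:ℝ) := by rw [Real.inv_rpow hMR.le, Real.rpow_neg hMR.le, inv_inv]
    rw [e1] at key
    have k1 : 2 * θ ^ 2 * DD d α (θ * R) ≤ c1 / 4 * R ^ (-α) := by
      calc _ ≤ 2 * θ ^ 2 * (c2 * (θ * R) ^ (-α)) := by gcongr; exact h2 _ (by positivity)
        _ = (2 * c2 * θ ^ (2 - α)) * R ^ (-α) := by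
          rw [Real.mul_rpow hθ0.le hR0.le, show 2 - α = 2 + -α by ring, Real.rpow_add hθ0, Real.rpow_two]; ring
        _ ≤ _ := by gcongr
    have k2 : 2 * DD d α (M * R) ≤ c1 / 4 * R ^ (-α) := by
      calc _ ≤ 2 * (c2 * (M * R) ^ (-α)) := by gcongr; exact h2 _ (by positivity)
        _ = (2 * c2 * M ^ (-α)) * R ^ (-α) := by
          rw [Real.mul_rpow hM0.le hR0.le]; ring
        _ ≤ _ := by gcongr
    have k3 := h1 R hR1
    unfold DD at k1 k2
    unfold DD at key k3
    linarith
  have hd1 : (0:ℝ) < d := by exact_mod_cast hd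
  refine ⟨(c1 / 2 * θ ^ α) / ((M / θ) ^ (d:ℝ) * (v + 1)), by positivity, fun x => ?_⟩
  obtain ⟨x', hx'⟩ := exists_norm_eq (Ed d) (by positivity : 0 ≤ max θ ‖x‖)
  have h3 := main x' (by rw [hx']; exact le_max_left _ _)
  have h4 := (KK_mono (d := d) hd hα hα2 one_pos (x := x) (y := x') (by rw [hx']; exact le_max_right _ _))
  have hr0 : 0 < ‖x'‖ := by rw [hx']; positivity
  set r := ‖x'‖ with hr
  have hr1 : r ≤ 1 + ‖x‖ := by
    rw [hx']; exact max_le (by linarith [norm_nonneg x]) (by linarith)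
  have h5 : (1 + ‖x‖) ^ (-(d:ℝ) - α) ≤ r ^ (-(d:ℝ) - α) := Real.rpow_le_rpow_of_nonpos hr0 hr1 (by linarith)
  refine le_trans (mul_le_mul_of_nonneg_left h5 (by positivity)) (le_trans ?_ h4.2)
  rw [div_mul_eq_mul_div, div_le_iff₀ (by positivity)]
  have e1 : (r / θ) ^ (-α) = θ ^ α * r ^ (-α) := by
    rw [Real.div_rpow hr0.le hθ0.le, Real.rpow_neg hθ0.le, div_inv_eq_mul]; ring
  have e2 : (M * (r / θ)) ^ (d:ℝ) = (M / θ) ^ (d:ℝ) * r ^ (d:ℝ) := by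
    rw [← Real.mul_rpow (by positivity) hr0.le]; congr 1; ring
  rw [e1, e2] at h3
  have e3 : r ^ (-(d:ℝ) - α) = r ^ (-α) / r ^ (d:ℝ) := by
    rw [← Real.rpow_sub hr0]; congr 1; ring
  rw [e3]
  have hrd : 0 < r ^ (d:ℝ) := by positivity
  rw [mul_div_assoc', div_le_iff₀ hrd]
  have h6 : 0 ≤ KK d α 1 x' * ((M / θ) ^ (d:ℝ) * r ^ (d:ℝ)) := mul_nonneg h4.1 (by positivity)
  linarith

lemma KK_tscal {α t : ℝ} (hα : 0 < α) (ht : 0 < t) (w : Ed d) :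
    KK d α t w = t ^ (-(d:ℝ) / α) * KK d α 1 ((t ^ (-(1 / α))) • w) := by
  have hl : 0 < t ^ (1 / α) := by positivity
  have := KK_scal (d := d) (α := α) (t := 1) hl ((t ^ (-(1 / α))) • w)
  rw [smul_smul, ← Real.rpow_add ht, ← Real.rpow_mul ht.le, ← Real.rpow_mul ht.le] at this
  rw [show 1 / α + -(1 / α) = 0 by ring, Real.rpow_zero, one_smul, one_div_mul_cancel hα.ne', Real.rpow_one, mul_one] at this
  rw [this]; congr 2; ring

lemma pk_up1 {α : ℝ} (hd : 0 < d) (hα : 0 < α) (hα2 : α < 2) :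
    ∃ C > 0, ∀ t > 0, ∀ x y : Ed d, pk d α t x y ≤ ENNReal.ofReal (C * t ^ (-(d:ℝ) / α)) := by
  have h0 := KK_nonneg (d := d) hd hα hα2 one_pos 0
  refine ⟨KK d α 1 0 + 1, by positivity, fun t ht x y => ?_⟩
  rw [pk_eq]
  apply ENNReal.ofReal_le_ofReal
  rw [KK_tscal hα ht, mul_comm]
  have := KK_bound (d := d) hd hα hα2 one_pos ((t ^ (-(1 / α))) • (y - x))
  refine mul_le_mul_of_nonneg_right (by linarith) (by positivity)

lemma pk_up2 {α : ℝ} (hd : 0 < d) (hα : 0 < α) (hα2 : α < 2) :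
    ∃ C > 0, ∀ t > 0, ∀ x y : Ed d, x ≠ y → pk d α t x y ≤ ENNReal.ofReal (C * t * ‖x - y‖ ^ (-(d:ℝ) - α)) := by
  obtain ⟨C, hC, h⟩ := KK_upper (d := d) hd hα hα2
  refine ⟨C, hC, fun t ht x y hxy => ?_⟩
  rw [pk_eq]
  apply ENNReal.ofReal_le_ofReal
  have hl : 0 < t ^ (-(1 / α)) := by positivity
  have hne : y - x ≠ 0 := sub_ne_zero.2 hxy.symm
  rw [KK_tscal hα ht]
  calc _ ≤ t ^ (-(d:ℝ) / α) * (C * ‖(t ^ (-(1 / α))) • (y - x)‖ ^ (-(d:ℝ) - α)) := by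
        refine mul_le_mul_of_nonneg_left (h _ (smul_ne_zero hl.ne' hne)) (by positivity)
    _ = _ := by
        rw [norm_smul_rpow hl, ← Real.rpow_mul ht.le, norm_sub_rev]
        have : t ^ (-(d:ℝ) / α) * t ^ (-(1 / α) * (-(d:ℝ) - α)) = t := by
          rw [← Real.rpow_add ht]
          have : -(d:ℝ) / α + -(1 / α) * (-(d:ℝ) - α) = 1 := by field_simp; ring
          rw [this, Real.rpow_one]
        calc _ = C * (t ^ (-(d:ℝ) / α) * t ^ (-(1 / α) * (-(d:ℝ) - α))) * ‖x - y‖ ^ (-(d:ℝ) - α) := by ring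
          _ = _ := by rw [this]

lemma pk_low {α : ℝ} (hd : 0 < d) (hα : 0 < α) (hα2 : α < 2) :
    ∃ c > 0, ∀ t : ℝ, 1 / 3 ≤ t → t ≤ 1 → ∀ x y : Ed d, ENNReal.ofReal (c * (1 + ‖x - y‖) ^ (-(d:ℝ) - α)) ≤ pk d α t x y := by
  obtain ⟨c, hc, h⟩ := KK_lower (d := d) hd hα hα2
  have hd1 : (0:ℝ) < d := by exact_mod_cast hd
  refine ⟨c * (3 ^ (1 / α)) ^ (-(d:ℝ) - α), by positivity, fun t ht ht1 x y => ?_⟩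
  rw [pk_eq]
  apply ENNReal.ofReal_le_ofReal
  have ht0 : 0 < t := by linarith
  rw [KK_tscal hα ht0]
  have hl : 0 < t ^ (-(1 / α)) := by positivity
  have h1 : 1 ≤ t ^ (-(d:ℝ) / α) := by
    apply Real.one_le_rpow_of_pos_of_le_one_of_nonpos ht0 ht1
    rw [neg_div]; exact neg_nonpos.2 (by positivity)
  have h2 : t ^ (-(1 / α)) ≤ 3 ^ (1 / α) := by
    rw [Real.rpow_neg ht0.le, ← Real.inv_rpow ht0.le]
    apply Real.rpow_le_rpow (by positivity) _ (by positivity)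
    rw [inv_le_comm₀ ht0 (by norm_num)]; linarith
  have h31 : 1 ≤ (3:ℝ) ^ (1 / α) := Real.one_le_rpow (by norm_num) (by positivity)
  have h3 : 1 + ‖(t ^ (-(1 / α))) • (y - x)‖ ≤ 3 ^ (1 / α) * (1 + ‖x - y‖) := by
    rw [norm_smul, Real.norm_of_nonneg hl.le, norm_sub_rev]
    have := mul_le_mul_of_nonneg_right h2 (norm_nonneg (x - y))
    linarith
  have h4 := Real.rpow_le_rpow_of_nonpos (by positivity) h3 (by linarith : -(d:ℝ) - α ≤ 0)
  rw [Real.mul_rpow (by positivity) (by positivity)] at h4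
  calc _ = c * ((3 ^ (1 / α)) ^ (-(d:ℝ) - α) * (1 + ‖x - y‖) ^ (-(d:ℝ) - α)) := by ring
    _ ≤ c * (1 + ‖(t ^ (-(1 / α))) • (y - x)‖) ^ (-(d:ℝ) - α) := by gcongr
    _ ≤ 1 * KK d α 1 ((t ^ (-(1 / α))) • (y - x)) := by rw [one_mul]; exact h _
    _ ≤ _ := mul_le_mul_of_nonneg_right h1 (KK_nonneg hd hα hα2 one_pos _)

end BdSec



section HardySec
variable {d : ℕ}

/-- weighted time integral of the kernel -/
def Th (d : ℕ) (α a : ℝ) (x : Ed d) : ℝ≥0∞ := ∫⁻ s in Ioi (0:ℝ), ENNReal.ofReal (s ^ (a - 1)) * pk d α s x 0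

lemma Th_meas (α a : ℝ) : Measurable (Th d α a) := by
  unfold Th
  apply Measurable.lintegral_prod_right'
    (f := fun w : Ed d × ℝ => ENNReal.ofReal (w.2 ^ (a - 1)) * pk d α w.2 w.1 0)
  exact Measurable.mul (by fun_prop) ((pk_jm α).comp measurable_snd measurable_fst measurable_const)

lemma lint_timeI (a : ℝ) (ha : 0 < a) (f : ℝ → ℝ≥0∞) :
    ∫⁻ s in Ioi 0, f s = ENNReal.ofReal a * ∫⁻ s in Ioi 0, f (a * s) := by
  have h := Measure.map_addHaar_smul (volume : Measure ℝ) ha.ne'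
  have e : MeasurableEmbedding (fun z : ℝ => a • z) :=
    (Homeomorph.smulOfNeZero a ha.ne').measurableEmbedding
  rw [← lintegral_indicator measurableSet_Ioi, ← lintegral_indicator measurableSet_Ioi]
  have h2 : ∫⁻ s, (Ioi (0:ℝ)).indicator (fun s => f (a * s)) s = ∫⁻ s, (Ioi (0:ℝ)).indicator f (a • s) := by
    apply lintegral_congr; intro s
    simp only [indicator, mem_Ioi, smul_eq_mul]
    by_cases hs : 0 < s
    · rw [if_pos hs, if_pos (by positivity)]
    · rw [if_neg hs, if_neg (by rw [mul_pos_iff_of_pos_left ha]; exact hs)]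
  rw [h2, ← e.lintegral_map, h, lintegral_smul_measure, smul_eq_mul, ← mul_assoc,
    ← ENNReal.ofReal_mul ha.le]
  simp only [Module.finrank_self, pow_one]
  rw [abs_of_pos (by positivity), mul_inv_cancel₀ ha.ne', ENNReal.ofReal_one, one_mul]

lemma KK_rad {α t : ℝ} (hd : 0 < d) (hα : 0 < α) (hα2 : α < 2) (ht : 0 < t) {x y : Ed d} (h : ‖x‖ = ‖y‖) :
    KK d α t x = KK d α t y :=
  le_antisymm (KK_mono hd hα hα2 ht h.ge).2 (KK_mono hd hα hα2 ht h.le).2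

lemma Th_hom {α a : ℝ} (hd : 0 < d) (hα : 0 < α) (hα2 : α < 2) {e : Ed d} (he : ‖e‖ = 1) {x : Ed d} (hx : x ≠ 0) :
    Th d α a x = ENNReal.ofReal (‖x‖ ^ (α * a - d)) * Th d α a e := by
  have hr : 0 < ‖x‖ := norm_pos_iff.2 hx
  have hra : 0 < ‖x‖ ^ α := by positivity
  unfold Th
  rw [lint_timeI (‖x‖ ^ α) hra, ← lintegral_const_mul' _ _ ENNReal.ofReal_ne_top,
    ← lintegral_const_mul' _ _ ENNReal.ofReal_ne_top]
  apply setLIntegral_congr_fun measurableSet_Ioi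
  intro s (hs : 0 < s)
  simp only
  have e1 : pk d α (‖x‖ ^ α * s) x 0 = ENNReal.ofReal (‖x‖ ^ (-(d:ℝ))) * pk d α s e 0 := by
    have h1 := pk_scal (d := d) (α := α) ‖x‖ hr s (‖x‖⁻¹ • x) 0
    rw [smul_smul, mul_inv_cancel₀ hr.ne', one_smul, smul_zero] at h1
    rw [h1, pk_eq, pk_eq, KK_rad hd hα hα2 hs (y := 0 - e)]
    rw [zero_sub, zero_sub, norm_neg, norm_neg, he, norm_smul, norm_inv, norm_norm, inv_mul_cancel₀ hr.ne']
  rw [e1, ← mul_assoc, ← mul_assoc, ← mul_assoc, ← ENNReal.ofReal_mul hra.le, ← ENNReal.ofReal_mul (by positivity),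
    ← ENNReal.ofReal_mul (by positivity)]
  congr 2
  rw [Real.mul_rpow hra.le hs.le, ← Real.rpow_mul hr.le]
  have : ‖x‖ ^ (α * a - d) = ‖x‖ ^ α * ‖x‖ ^ (α * (a - 1)) * ‖x‖ ^ (-(d:ℝ)) := by
    rw [← Real.rpow_add hr, ← Real.rpow_add hr]; congr 1; ring
  rw [this]; ring

/-- radial Gaussian moment -/
def MM (d : ℕ) (b : ℝ) : ℝ≥0∞ := ∫⁻ u : Ed d, ENNReal.ofReal (‖u‖ ^ (-b) * Real.exp (-‖u‖ ^ 2))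

lemma MM_eq (hd : 0 < d) : ∃ v > 0, ∀ b : ℝ, b < d → MM d b = ENNReal.ofReal (v * Real.Gamma (((d:ℝ) - b) / 2)) := by
  haveI : Nonempty (Fin d) := ⟨⟨0, hd⟩⟩
  have hd1 : (0:ℝ) < d := by exact_mod_cast hd
  refine ⟨d * (volume : Measure (Ed d)).real (Metric.ball 0 1) * (1 / 2), ?_, fun b hb => ?_⟩
  · have : 0 < (volume : Measure (Ed d)).real (Metric.ball 0 1) := by
      apply ENNReal.toReal_pos
      · exact (Metric.measure_ball_pos _ _ one_pos).ne'
      · exact measure_ball_lt_top.ne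
    positivity
  · have hfun : ∀ y ∈ Ioi (0:ℝ), y ^ ((d:ℝ) - 1 - b) * Real.exp (-1 * y ^ (2:ℝ)) = y ^ (d - 1) • (y ^ (-b) * Real.exp (-y ^ 2)) := by
      intro y (hy : 0 < y)
      rw [smul_eq_mul, ← mul_assoc, ← Real.rpow_natCast, ← Real.rpow_add hy, Real.rpow_two, Nat.cast_sub hd]
      congr 2
      · push_cast; ring
      · ring
    have hI := integrableOn_rpow_mul_exp_neg_mul_rpow (s := (d:ℝ) - 1 - b) (p := 2) (b := 1) (by linarith) (by norm_num) one_pos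
    have hV := integral_rpow_mul_exp_neg_mul_rpow (q := (d:ℝ) - 1 - b) (p := 2) (b := 1) (by norm_num) (by linarith) one_pos
    have hI2 : Integrable (fun u : Ed d => ‖u‖ ^ (-b) * Real.exp (-‖u‖ ^ 2)) := by
      refine (integrable_fun_norm_addHaar (μ := (volume : Measure (Ed d))) (f := fun r : ℝ => r ^ (-b) * Real.exp (-r ^ 2))).2 ?_
      rw [finrank_euclideanSpace_fin]
      exact hI.congr_fun hfun measurableSet_Ioi
    have hV2 := integral_fun_norm_addHaar (volume : Measure (Ed d)) (fun r : ℝ => r ^ (-b) * Real.exp (-r ^ 2))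
    rw [finrank_euclideanSpace_fin, ← setIntegral_congr_fun measurableSet_Ioi hfun, hV] at hV2
    unfold MM
    rw [← ofReal_integral_eq_lintegral_ofReal hI2 (ae_of_all _ fun u => by positivity), hV2]
    congr 1
    rw [Real.one_rpow, nsmul_eq_mul, smul_eq_mul]
    rw [show (d:ℝ) - 1 - b + 1 = d - b by ring]; ring

lemma gam_lint {a c : ℝ} (ha : 0 < a) (hc : 0 < c) :
    ∫⁻ s in Ioi (0:ℝ), ENNReal.ofReal (s ^ (a - 1) * Real.exp (-c * s)) = ENNReal.ofReal (Real.Gamma a * c ^ (-a)) := by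
  have hI := integrableOn_rpow_mul_exp_neg_mul_rpow (s := a - 1) (p := 1) (b := c) (by linarith) one_pos hc
  have hV := integral_rpow_mul_exp_neg_mul_rpow (q := a - 1) (p := 1) (b := c) one_pos (by linarith) hc
  simp only [Real.rpow_one] at hI hV
  rw [← ofReal_integral_eq_lintegral_ofReal hI, hV]
  · congr 1; rw [sub_add_cancel, div_one, div_one]; ring
  · filter_upwards [ae_restrict_mem measurableSet_Ioi] with s hs
    have : 0 < s := hs
    positivity

lemma Th_pair {α a : ℝ} (hd : 0 < d) (hα : 0 < α) (hα2 : α < 2) (ha : 0 < a) :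
    ∫⁻ w : Ed d, Th d α a w * ENNReal.ofReal (Real.exp (-‖w‖ ^ 2))
      = ENNReal.ofReal (π ^ (-((d:ℝ) / 2)) * Real.Gamma a * 2 ^ (-(α * a))) * MM d (α * a) := by
  have hpi := Real.pi_pos
  have hpm : Measurable (fun q : Ed d × ℝ => pk d α q.2 q.1 0) := (pk_jm α).comp measurable_snd measurable_fst measurable_const
  calc _ = ∫⁻ w : Ed d, ∫⁻ s in Ioi (0:ℝ), ENNReal.ofReal (s ^ (a - 1)) * pk d α s w 0 * ENNReal.ofReal (Real.exp (-‖w‖ ^ 2)) := by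
        apply lintegral_congr; intro w
        unfold Th
        rw [lintegral_mul_const' _ _ ENNReal.ofReal_ne_top]
    _ = ∫⁻ s in Ioi (0:ℝ), ∫⁻ w : Ed d, ENNReal.ofReal (s ^ (a - 1)) * pk d α s w 0 * ENNReal.ofReal (Real.exp (-‖w‖ ^ 2)) := by
        apply lintegral_lintegral_swap
        apply Measurable.aemeasurable
        unfold Function.uncurry
        exact Measurable.mul (Measurable.mul (by fun_prop) hpm) (by fun_prop)
    _ = ∫⁻ s in Ioi (0:ℝ), ENNReal.ofReal (s ^ (a - 1)) * (ENNReal.ofReal (π ^ (-((d:ℝ) / 2))) *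
          ∫⁻ u : Ed d, ENNReal.ofReal (Real.exp (-s * (2 ^ α * ‖u‖ ^ α)) * Real.exp (-‖u‖ ^ 2))) := by
        apply setLIntegral_congr_fun measurableSet_Ioi
        intro s (hs : 0 < s)
        simp only
        simp_rw [mul_assoc]
        rw [lintegral_const_mul' _ _ ENNReal.ofReal_ne_top]
        congr 1
        have h := KK_gauss (d := d) (η := 1) hd hα hs one_pos 0
        simp only [inner_zero_right, Real.cos_zero, one_mul, Real.sqrt_one, mul_one, zero_add, norm_smul_rpow (by norm_num : (0:ℝ) < 2), neg_mul] at h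
        have hn := KK_nonneg (d := d) hd hα hα2 hs
        have e1 : ∫⁻ w : Ed d, pk d α s w 0 * ENNReal.ofReal (Real.exp (-‖w‖ ^ 2))
            = ENNReal.ofReal (∫ w, KK d α s w * Real.exp (-‖w‖ ^ 2)) := by
          rw [ofReal_integral_eq_lintegral_ofReal]
          · apply lintegral_congr; intro w
            rw [pk_eq, zero_sub, KK_neg, ENNReal.ofReal_mul (hn w)]
          · refine Integrable.mono' (gsq_int.const_mul (KK d α s 0)) ((KK_meas' α s).mul (by fun_prop)).aestronglyMeasurable (ae_of_all _ fun w => ?_)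
            rw [Real.norm_of_nonneg (mul_nonneg (hn w) (Real.exp_pos _).le)]
            exact mul_le_mul_of_nonneg_right (KK_bound hd hα hα2 hs w) (Real.exp_pos _).le
          · exact ae_of_all _ fun w => mul_nonneg (hn w) (Real.exp_pos _).le
        rw [e1, h, ENNReal.ofReal_mul (by positivity)]
        congr 1
        rw [ofReal_integral_eq_lintegral_ofReal]
        · simp only [neg_mul]
        · refine Integrable.mono' gsq_int (Measurable.aestronglyMeasurable (by fun_prop)) (ae_of_all _ fun u => ?_)
          rw [norm_mul, Real.norm_of_nonneg (Real.exp_pos _).le, Real.norm_of_nonneg (Real.exp_pos _).le]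
          refine mul_le_of_le_one_left (Real.exp_pos _).le ?_
          apply Real.exp_le_one_iff.2
          apply neg_nonpos.2; positivity
        · exact ae_of_all _ fun u => by positivity
    _ = ∫⁻ s in Ioi (0:ℝ), ∫⁻ u : Ed d, ENNReal.ofReal (π ^ (-((d:ℝ) / 2))) * (ENNReal.ofReal (s ^ (a - 1)) *
          ENNReal.ofReal (Real.exp (-s * (2 ^ α * ‖u‖ ^ α)) * Real.exp (-‖u‖ ^ 2))) := by
        congr 1; ext s
        rw [lintegral_const_mul' _ _ ENNReal.ofReal_ne_top, lintegral_const_mul' _ _ ENNReal.ofReal_ne_top]; ring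
    _ = ∫⁻ u : Ed d, ∫⁻ s in Ioi (0:ℝ), ENNReal.ofReal (π ^ (-((d:ℝ) / 2))) * (ENNReal.ofReal (s ^ (a - 1)) *
          ENNReal.ofReal (Real.exp (-s * (2 ^ α * ‖u‖ ^ α)) * Real.exp (-‖u‖ ^ 2))) := by
        apply lintegral_lintegral_swap
        apply Measurable.aemeasurable
        unfold Function.uncurry
        fun_prop
    _ = ∫⁻ u : Ed d, ENNReal.ofReal (π ^ (-((d:ℝ) / 2)) * Real.Gamma a * 2 ^ (-(α * a))) *
          ENNReal.ofReal (‖u‖ ^ (-(α * a)) * Real.exp (-‖u‖ ^ 2)) := by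
        apply lintegral_congr_ae
        filter_upwards [ae_ne0 hd] with u hu
        have hr : 0 < ‖u‖ := norm_pos_iff.2 hu
        rw [lintegral_const_mul' _ _ ENNReal.ofReal_ne_top]
        have : ∀ s ∈ Ioi (0:ℝ), ENNReal.ofReal (s ^ (a - 1)) * ENNReal.ofReal (Real.exp (-s * (2 ^ α * ‖u‖ ^ α)) * Real.exp (-‖u‖ ^ 2))
            = ENNReal.ofReal (Real.exp (-‖u‖ ^ 2)) * ENNReal.ofReal (s ^ (a - 1) * Real.exp (-(2 ^ α * ‖u‖ ^ α) * s)) := by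
          intro s (hs : 0 < s)
          rw [← ENNReal.ofReal_mul (by positivity), ← ENNReal.ofReal_mul (by positivity)]
          congr 1
          rw [show -s * (2 ^ α * ‖u‖ ^ α) = -(2 ^ α * ‖u‖ ^ α) * s by ring]; ring
        rw [setLIntegral_congr_fun measurableSet_Ioi this, lintegral_const_mul' _ _ ENNReal.ofReal_ne_top,
          gam_lint ha (by positivity), ← ENNReal.ofReal_mul (by positivity), ← ENNReal.ofReal_mul (by positivity),
          ← ENNReal.ofReal_mul (by have := Real.Gamma_pos_of_pos ha; positivity)]
        congr 1
        rw [Real.mul_rpow (by positivity) (by positivity), ← Real.rpow_mul (by norm_num), ← Real.rpow_mul hr.le, mul_neg]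
        ring
    _ = _ := by
        rw [lintegral_const_mul' _ _ ENNReal.ofReal_ne_top]; rfl

/-- the constant in the Riesz-type formula -/
def CG (d : ℕ) (α γ : ℝ) : ℝ := π ^ (-((d:ℝ) / 2)) * Real.Gamma (((d:ℝ) - γ) / α) * 2 ^ (-((d:ℝ) - γ)) * Real.Gamma (γ / 2) / Real.Gamma (((d:ℝ) - γ) / 2)

lemma CG_pos {α γ : ℝ} (hα : 0 < α) (hγ : 0 < γ) (hγd : γ < d) : 0 < CG d α γ := by
  have hpi := Real.pi_pos
  have h1 := Real.Gamma_pos_of_pos (div_pos (by linarith : 0 < (d:ℝ) - γ) hα)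
  have h2 := Real.Gamma_pos_of_pos (div_pos (by linarith : 0 < (d:ℝ) - γ) two_pos)
  have h3 := Real.Gamma_pos_of_pos (div_pos hγ two_pos)
  unfold CG; positivity

lemma Th_eq {α γ : ℝ} (hd : 0 < d) (hα : 0 < α) (hα2 : α < 2) (hγ : 0 < γ) (hγd : γ < d) {x : Ed d} (hx : x ≠ 0) :
    Th d α (((d:ℝ) - γ) / α) x = ENNReal.ofReal (CG d α γ) * hp d γ x := by
  haveI : Nonempty (Fin d) := ⟨⟨0, hd⟩⟩
  have hpi := Real.pi_pos
  have hdg : 0 < (d:ℝ) - γ := by linarith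
  have ha : 0 < ((d:ℝ) - γ) / α := by positivity
  obtain ⟨e, he⟩ := exists_norm_eq (Ed d) (zero_le_one' ℝ)
  have hαa : α * (((d:ℝ) - γ) / α) = d - γ := by field_simp
  have hh : ∀ x : Ed d, x ≠ 0 → Th d α (((d:ℝ) - γ) / α) x = Th d α (((d:ℝ) - γ) / α) e * hp d γ x := by
    intro x hx
    rw [Th_hom hd hα hα2 he hx, hαa, mul_comm]; congr 2
    congr 1; ring
  have h1 := Th_pair (d := d) hd hα hα2 ha
  have h2 : ∫⁻ w : Ed d, Th d α (((d:ℝ) - γ) / α) w * ENNReal.ofReal (Real.exp (-‖w‖ ^ 2)) = Th d α (((d:ℝ) - γ) / α) e * MM d γ := by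
    unfold MM
    rw [← lintegral_const_mul _ (by fun_prop)]
    apply lintegral_congr_ae
    filter_upwards [ae_ne0 hd] with w hw
    rw [hh w hw, mul_assoc]; congr 1
    unfold hp
    rw [ENNReal.ofReal_mul (by positivity)]
  obtain ⟨v, hv, hM⟩ := MM_eq (d := d) hd
  rw [hαa] at h1
  rw [h2, hM γ hγd, hM ((d:ℝ) - γ) (by linarith), sub_sub_cancel] at h1
  have g1 := Real.Gamma_pos_of_pos ha
  have g2 := Real.Gamma_pos_of_pos (div_pos hdg two_pos)
  have g3 := Real.Gamma_pos_of_pos (div_pos hγ two_pos)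
  have hC : Th d α (((d:ℝ) - γ) / α) e = ENNReal.ofReal (CG d α γ) := by
    have hvg : 0 < v * Real.Gamma (((d:ℝ) - γ) / 2) := by positivity
    rw [← ENNReal.mul_left_inj (c := ENNReal.ofReal (v * Real.Gamma (((d:ℝ) - γ) / 2))) (by simpa using hvg) ENNReal.ofReal_ne_top, h1,
      ← ENNReal.ofReal_mul (by positivity), ← ENNReal.ofReal_mul (CG_pos hα hγ hγd).le]
    congr 1
    unfold CG
    field_simp
  rw [hh x hx, hC]

end HardySec



section HardySec2
variable {d : ℕ}

lemma Th_PO {α a t : ℝ} (hd : 0 < d) (hα : 0 < α) (hα2 : α < 2) (ht : 0 < t) (x : Ed d) :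
    PO volume (pk d α) t (Th d α a) x
      = ∫⁻ r, (Ioi t).indicator (fun r => ENNReal.ofReal ((r - t) ^ (a - 1))) r * pk d α r x 0 := by
  unfold PO Th
  have h1 : ∀ z, pk d α t x z * ∫⁻ s in Ioi (0:ℝ), ENNReal.ofReal (s ^ (a - 1)) * pk d α s z 0
      = ∫⁻ s in Ioi (0:ℝ), pk d α t x z * (ENNReal.ofReal (s ^ (a - 1)) * pk d α s z 0) := by
    intro z
    rw [lintegral_const_mul]
    exact Measurable.mul (by fun_prop) ((pk_jm α).comp measurable_id measurable_const measurable_const)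
  simp_rw [h1]
  rw [lintegral_lintegral_swap]
  · have h2 : ∀ s ∈ Ioi (0:ℝ), ∫⁻ z, pk d α t x z * (ENNReal.ofReal (s ^ (a - 1)) * pk d α s z 0)
        = ENNReal.ofReal (s ^ (a - 1)) * pk d α (s + t) x 0 := by
      intro s hs
      rw [add_comm s t, ← pk_ck hd hα hα2 t s ht hs x 0, ← lintegral_const_mul' _ _ ENNReal.ofReal_ne_top]
      apply lintegral_congr; intro z; ring
    rw [setLIntegral_congr_fun measurableSet_Ioi h2, ← lintegral_indicator measurableSet_Ioi,
      ← lintegral_sub_right_eq_self _ t]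
    apply lintegral_congr; intro r
    by_cases hr : t < r
    · rw [indicator_of_mem (show r - t ∈ Ioi (0:ℝ) from sub_pos.2 hr), indicator_of_mem (show r ∈ Ioi t from hr), sub_add_cancel]
    · rw [indicator_of_notMem (show r - t ∉ Ioi (0:ℝ) by simpa using hr), indicator_of_notMem (show r ∉ Ioi t from hr), zero_mul]
  · apply Measurable.aemeasurable
    exact Measurable.mul ((pk_jm α).comp measurable_const measurable_const measurable_fst)
      (Measurable.mul (by fun_prop) ((pk_jm α).comp measurable_snd measurable_fst measurable_const))

lemma Th_TI {α b t : ℝ} (hd : 0 < d) (hα : 0 < α) (hα2 : α < 2) (x : Ed d) :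
    TI volume (pk d α) t (Th d α b) x
      = ∫⁻ r, (∫⁻ s in Ioo 0 t, (Ioi s).indicator (fun r => ENNReal.ofReal ((r - s) ^ (b - 1))) r) * pk d α r x 0 := by
  unfold TI
  rw [setLIntegral_congr_fun measurableSet_Ioo (fun s hs => Th_PO (a := b) hd hα hα2 hs.1 x)]
  have hm : Measurable (fun w : ℝ × ℝ => (Ioi w.1).indicator (fun r => ENNReal.ofReal ((r - w.1) ^ (b - 1))) w.2) := by
    have : (fun w : ℝ × ℝ => (Ioi w.1).indicator (fun r => ENNReal.ofReal ((r - w.1) ^ (b - 1))) w.2)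
        = ({w : ℝ × ℝ | w.1 < w.2}).indicator (fun w => ENNReal.ofReal ((w.2 - w.1) ^ (b - 1))) := by
      ext w; simp [indicator]
    rw [this]
    exact Measurable.indicator (by fun_prop) (measurableSet_lt measurable_fst measurable_snd)
  rw [lintegral_lintegral_swap]
  · apply lintegral_congr; intro r
    rw [lintegral_mul_const]
    exact hm.comp (measurable_id.prodMk measurable_const)
  · apply Measurable.aemeasurable
    exact hm.mul ((pk_jm α).comp measurable_snd measurable_const measurable_const)

lemma time_int {b m r : ℝ} (hb : 0 < b) (hm : 0 ≤ m) (hmr : m ≤ r) :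
    ENNReal.ofReal b * ∫⁻ s in Ioo 0 m, ENNReal.ofReal ((r - s) ^ (b - 1)) = ENNReal.ofReal (r ^ b - (r - m) ^ b) := by
  have hInt0 : IntervalIntegrable (fun s => (r - s) ^ (b - 1)) volume 0 m := by
    have := (intervalIntegral.intervalIntegrable_rpow' (a := r - 0) (b := r - m) (r := b - 1) (by linarith)).comp_sub_left r
    simpa using this
  rw [setLIntegral_congr Ioo_ae_eq_Ioc, ← ofReal_integral_eq_lintegral_ofReal ((intervalIntegrable_iff_integrableOn_Ioc_of_le hm).1 hInt0),
    ← intervalIntegral.integral_of_le hm, intervalIntegral.integral_comp_sub_left (fun u => u ^ (b - 1)) r,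
    integral_rpow (Or.inl (by linarith)), ← ENNReal.ofReal_mul hb.le]
  · congr 1
    simp only [sub_zero, sub_add_cancel]
    field_simp
  · filter_upwards [ae_restrict_mem measurableSet_Ioc] with s hs
    exact Real.rpow_nonneg (by linarith [hs.2]) _

lemma time_id {b t r : ℝ} (hb : 0 < b) (ht : 0 < t) :
    (Ioi t).indicator (fun r => ENNReal.ofReal ((r - t) ^ b)) r
      + ENNReal.ofReal b * (∫⁻ s in Ioo 0 t, (Ioi s).indicator (fun r => ENNReal.ofReal ((r - s) ^ (b - 1))) r)
      = (Ioi (0:ℝ)).indicator (fun r => ENNReal.ofReal (r ^ b)) r := by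
  by_cases h1 : t < r
  · have : ∀ s ∈ Ioo 0 t, (Ioi s).indicator (fun r => ENNReal.ofReal ((r - s) ^ (b - 1))) r = ENNReal.ofReal ((r - s) ^ (b - 1)) := by
      intro s hs
      rw [indicator_of_mem (show r ∈ Ioi s from hs.2.trans h1)]
    rw [setLIntegral_congr_fun measurableSet_Ioo this, time_int hb ht.le h1.le,
      indicator_of_mem (show r ∈ Ioi t from h1), indicator_of_mem (show r ∈ Ioi (0:ℝ) from ht.trans h1),
      ← ENNReal.ofReal_add]
    · congr 1; ring
    · exact Real.rpow_nonneg (by linarith) _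
    · have := Real.rpow_le_rpow (by linarith : 0 ≤ r - t) (by linarith : r - t ≤ r) hb.le
      linarith
  · rw [indicator_of_notMem (show r ∉ Ioi t from h1), zero_add]
    push Not at h1
    by_cases h2 : 0 < r
    · have : ∫⁻ s in Ioo 0 t, (Ioi s).indicator (fun r => ENNReal.ofReal ((r - s) ^ (b - 1))) r
          = ∫⁻ s in Ioo 0 r, ENNReal.ofReal ((r - s) ^ (b - 1)) := by
        rw [← lintegral_indicator measurableSet_Ioo, ← lintegral_indicator measurableSet_Ioo]
        apply lintegral_congr; intro s
        simp only [indicator, mem_Ioo, mem_Ioi]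
        by_cases hs : s < r
        · by_cases hs0 : 0 < s
          · simp [hs, hs0, hs.trans_le h1]
          · simp [hs0]
        · simp [hs]
      rw [this, time_int hb h2.le le_rfl, indicator_of_mem (show r ∈ Ioi (0:ℝ) from h2), sub_self, Real.zero_rpow hb.ne', sub_zero]
    · rw [indicator_of_notMem (show r ∉ Ioi (0:ℝ) from h2)]
      have : ∀ s ∈ Ioo 0 t, (Ioi s).indicator (fun r => ENNReal.ofReal ((r - s) ^ (b - 1))) r = 0 := by
        intro s hs
        apply indicator_of_notMem
        simp only [mem_Ioi, not_lt] at h2 ⊢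
        linarith [hs.1]
      rw [setLIntegral_congr_fun measurableSet_Ioo this]; simp

lemma Th_hardy {α b t : ℝ} (hd : 0 < d) (hα : 0 < α) (hα2 : α < 2) (hb : 0 < b) (ht : 0 < t) (x : Ed d) :
    PO volume (pk d α) t (Th d α (b + 1)) x + ENNReal.ofReal b * TI volume (pk d α) t (Th d α b) x = Th d α (b + 1) x := by
  rw [Th_PO hd hα hα2 ht, Th_TI hd hα hα2]
  have hpm : Measurable (fun r => pk d α r x 0) := (pk_jm α).comp measurable_id measurable_const measurable_const
  rw [← lintegral_const_mul' _ _ ENNReal.ofReal_ne_top, ← lintegral_add_left]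
  · unfold Th
    rw [← lintegral_indicator measurableSet_Ioi]
    apply lintegral_congr; intro r
    rw [← mul_assoc, ← add_mul]
    simp only [add_sub_cancel_right]
    rw [time_id hb ht]
    by_cases h : r ∈ Ioi (0:ℝ)
    · rw [indicator_of_mem h, indicator_of_mem h]
    · rw [indicator_of_notMem h, indicator_of_notMem h, zero_mul]
  · exact Measurable.mul (Measurable.indicator (by fun_prop) measurableSet_Ioi) hpm

lemma kappa_CG {α γ : ℝ} (hα : 0 < α) (hγ : 0 < γ) (hγd : γ < (d:ℝ) - α) :
    (((d:ℝ) - (γ + α)) / α) * CG d α (γ + α) = CG d α γ * kappa d α γ := by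
  have hpi := Real.pi_pos
  have hb : 0 < ((d:ℝ) - (γ + α)) / α := div_pos (by linarith) hα
  have e1 : ((d:ℝ) - γ) / α = ((d:ℝ) - (γ + α)) / α + 1 := by field_simp; ring
  have g0 := Real.Gamma_pos_of_pos hb
  have g1 := Real.Gamma_pos_of_pos (div_pos hγ two_pos)
  have g2 := Real.Gamma_pos_of_pos (div_pos (by linarith : 0 < γ + α) two_pos)
  have g3 := Real.Gamma_pos_of_pos (div_pos (by linarith : 0 < (d:ℝ) - γ) two_pos)
  have g4 := Real.Gamma_pos_of_pos (div_pos (by linarith : 0 < (d:ℝ) - (γ + α)) two_pos)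
  unfold CG kappa
  rw [e1, Real.Gamma_add_one hb.ne', show (d:ℝ) - γ - α = d - (γ + α) by ring,
    show -((d:ℝ) - (γ + α)) = -((d:ℝ) - γ) + α by ring, Real.rpow_add two_pos]
  generalize Real.Gamma (((d:ℝ) - (γ + α)) / α) = G0 at *
  generalize Real.Gamma (((d:ℝ) - (γ + α)) / 2) = G4 at *
  generalize Real.Gamma (((d:ℝ) - γ) / 2) = G3 at *
  generalize Real.Gamma (γ / 2) = G1 at *
  generalize Real.Gamma ((γ + α) / 2) = G2 at *
  generalize ((d:ℝ) - (γ + α)) / α = b at *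
  field_simp

lemma pk_hardy {α : ℝ} (hd : 0 < d) (hα : 0 < α) (hα2 : α < 2) (γ : ℝ) (hγ : 0 < γ) (hγd : γ < (d:ℝ) - α)
    (t : ℝ) (ht : 0 < t) (x : Ed d) (hx : x ≠ 0) :
    PO volume (pk d α) t (hp d γ) x + ENNReal.ofReal (kappa d α γ) * TI volume (pk d α) t (hp d (γ + α)) x = hp d γ x := by
  have hb : 0 < ((d:ℝ) - (γ + α)) / α := div_pos (by linarith) hα
  have e1 : ((d:ℝ) - (γ + α)) / α + 1 = ((d:ℝ) - γ) / α := by field_simp; ring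
  have h := Th_hardy hd hα hα2 hb ht x
  have hc := CG_pos (d := d) hα hγ (by linarith)
  have hPO : ∀ s γ' : ℝ, 0 < γ' → γ' < (d:ℝ) → PO volume (pk d α) s (Th d α (((d:ℝ) - γ') / α)) x
      = ENNReal.ofReal (CG d α γ') * PO volume (pk d α) s (hp d γ') x := by
    intro s γ' h1 h2
    rw [← PO_cmul volume (pk_jm α) (hp_meas d γ')]
    unfold PO
    apply lintegral_congr_ae
    filter_upwards [ae_ne0 hd] with z hz
    rw [Th_eq hd hα hα2 h1 h2 hz]
  have hTI : TI volume (pk d α) t (Th d α (((d:ℝ) - (γ + α)) / α)) x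
      = ENNReal.ofReal (CG d α (γ + α)) * TI volume (pk d α) t (hp d (γ + α)) x := by
    unfold TI
    refine Eq.trans ?_ (lintegral_const_mul' (ENNReal.ofReal (CG d α (γ + α))) (fun s => PO volume (pk d α) s (hp d (γ + α)) x) ENNReal.ofReal_ne_top)
    apply lintegral_congr; intro s
    exact hPO s (γ + α) (by linarith) (by linarith)
  rw [e1, hPO t γ hγ (by linarith), hTI, Th_eq hd hα hα2 hγ (by linarith) hx, ← mul_assoc, ← ENNReal.ofReal_mul hb.le,
    kappa_CG hα hγ hγd, ENNReal.ofReal_mul hc.le, mul_assoc, ← mul_add] at h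
  exact (ENNReal.mul_right_inj (by simpa using hc) ENNReal.ofReal_ne_top).1 h

end HardySec2



section KappaSec
variable {d : ℕ}

lemma gseq_prod (a b s : ℝ) (n : ℕ) (a' b' : ℝ) (hab : a + b = a' + b') (hn : n ≠ 0) :
    ∃ A : ℝ, 0 ≤ A ∧
    Real.GammaSeq (a' + s) n * Real.GammaSeq (b' + s) n * (Real.GammaSeq a n * Real.GammaSeq b n)
      = A / ∏ j ∈ Finset.range (n + 1), ((a' + s + j) * (b' + s + j) * ((a + j) * (b + j))) ∧
    Real.GammaSeq (a + s) n * Real.GammaSeq (b + s) n * (Real.GammaSeq a' n * Real.GammaSeq b' n)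
      = A / ∏ j ∈ Finset.range (n + 1), ((a + s + j) * (b + s + j) * ((a' + j) * (b' + j))) := by
  have hn' : (0:ℝ) < n := by positivity
  refine ⟨(n:ℝ) ^ (2 * (a + b) + 2 * s) * (n.factorial : ℝ) ^ 4, by positivity, ?_, ?_⟩
  · simp only [Real.GammaSeq, Finset.prod_mul_distrib, div_mul_div_comm]
    congr 1
    rw [show 2 * (a + b) + 2 * s = (a' + s) + (b' + s) + a + b by linarith]
    simp only [Real.rpow_add hn']
    ring
  · simp only [Real.GammaSeq, Finset.prod_mul_distrib, div_mul_div_comm]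
    congr 1
    rw [show 2 * (a + b) + 2 * s = (a + s) + (b + s) + a' + b' by linarith]
    simp only [Real.rpow_add hn']
    ring

lemma gamma_ratio {a b s a' b' : ℝ} (ha : 0 < a) (hb : 0 < b) (hs : 0 < s) (ha' : 0 < a') (hb' : 0 < b')
    (hab : a + b = a' + b') (hD : a * b < a' * b') :
    Real.Gamma (a + s) * Real.Gamma (b + s) * (Real.Gamma a' * Real.Gamma b')
      < Real.Gamma (a' + s) * Real.Gamma (b' + s) * (Real.Gamma a * Real.Gamma b) := by
  set l : ℝ := ((a + s) * (b + s) * (a' * b')) / ((a' + s) * (b' + s) * (a * b)) with hl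
  have key : ∀ k : ℝ, 0 ≤ k → (a' + s + k) * (b' + s + k) * ((a + k) * (b + k)) < (a + s + k) * (b + s + k) * ((a' + k) * (b' + k)) := by
    intro k hk
    have e1 : (a' + k) * (b' + k) = (a + k) * (b + k) + (a' * b' - a * b) := by
      have : b' = a + b - a' := by linarith
      subst this; ring
    have e2 : (a' + s + k) * (b' + s + k) = (a + s + k) * (b + s + k) + (a' * b' - a * b) := by
      have : b' = a + b - a' := by linarith
      subst this; ring
    rw [e1, e2]
    have : (a + k) * (b + k) < (a + s + k) * (b + s + k) := by
      have : (a + s + k) * (b + s + k) = (a + k) * (b + k) + s * (a + k + (b + k) + s) := by ring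
      have : 0 < s * (a + k + (b + k) + s) := by positivity
      linarith
    nlinarith
  have hl1 : 1 < l := by
    rw [hl, one_lt_div (by positivity)]
    simpa using key 0 le_rfl
  have hle : l * (Real.Gamma (a + s) * Real.Gamma (b + s) * (Real.Gamma a' * Real.Gamma b'))
      ≤ Real.Gamma (a' + s) * Real.Gamma (b' + s) * (Real.Gamma a * Real.Gamma b) := by
    have T := Real.GammaSeq_tendsto_Gamma
    refine le_of_tendsto_of_tendsto ((((T (a + s)).mul (T (b + s))).mul ((T a').mul (T b'))).const_mul l)
      (((T (a' + s)).mul (T (b' + s))).mul ((T a).mul (T b))) ?_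
    filter_upwards [eventually_ne_atTop 0] with n hn
    obtain ⟨A, hA, e1, e2⟩ := gseq_prod a b s n a' b' hab hn
    rw [e1, e2]
    have h1 : 0 < ∏ j ∈ Finset.range (n + 1), ((a' + s + j) * (b' + s + j) * ((a + j) * (b + j))) :=
      Finset.prod_pos (fun j _ => by positivity)
    have h2 : 0 < ∏ j ∈ Finset.range (n + 1), ((a + s + j) * (b + s + j) * ((a' + j) * (b' + j))) :=
      Finset.prod_pos (fun j _ => by positivity)
    rw [← mul_div_assoc, div_le_div_iff₀ h2 h1, mul_comm l A, mul_assoc]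
    apply mul_le_mul_of_nonneg_left _ hA
    rw [Finset.prod_range_succ', Finset.prod_range_succ']
    simp only [Nat.cast_zero, add_zero]
    have e3 : l * ((a' + s) * (b' + s) * (a * b)) = (a + s) * (b + s) * (a' * b') := by
      rw [hl]; field_simp
    rw [mul_comm, mul_assoc, mul_comm _ l, e3]
    apply mul_le_mul_of_nonneg_right _ (by positivity)
    apply Finset.prod_le_prod
    · intro j _; positivity
    · intro j _; exact (key _ (by positivity)).le
  have g1 := Real.Gamma_pos_of_pos (add_pos ha hs)
  have g2 := Real.Gamma_pos_of_pos (add_pos hb hs)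
  have g3 := Real.Gamma_pos_of_pos ha'
  have g4 := Real.Gamma_pos_of_pos hb'
  have : 0 < Real.Gamma (a + s) * Real.Gamma (b + s) * (Real.Gamma a' * Real.Gamma b') := by positivity
  nlinarith

lemma kappa_pos {α γ : ℝ} (hα : 0 < α) (hγ : 0 < γ) (hγd : γ < (d:ℝ) - α) : 0 < kappa d α γ := by
  have g1 := Real.Gamma_pos_of_pos (div_pos hγ two_pos)
  have g2 := Real.Gamma_pos_of_pos (div_pos (by linarith : 0 < γ + α) two_pos)
  have g3 := Real.Gamma_pos_of_pos (div_pos (by linarith : 0 < (d:ℝ) - γ) two_pos)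
  have g4 := Real.Gamma_pos_of_pos (div_pos (by linarith : 0 < (d:ℝ) - γ - α) two_pos)
  unfold kappa; positivity

lemma kappa_mono {α γ γ' : ℝ} (hα : 0 < α) (hγ : 0 < γ) (h : γ < γ') (h' : γ' ≤ ((d:ℝ) - α) / 2) :
    kappa d α γ < kappa d α γ' := by
  have hγ'' : γ' < (d:ℝ) - α := by linarith
  have g1 := Real.Gamma_pos_of_pos (div_pos hγ two_pos)
  have g4 := Real.Gamma_pos_of_pos (div_pos (by linarith : 0 < (d:ℝ) - γ - α) two_pos)
  have g1' := Real.Gamma_pos_of_pos (div_pos (hγ.trans h) two_pos)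
  have g4' := Real.Gamma_pos_of_pos (div_pos (by linarith : 0 < (d:ℝ) - γ' - α) two_pos)
  have R := gamma_ratio (a := γ / 2) (b := ((d:ℝ) - γ - α) / 2) (s := α / 2) (a' := γ' / 2) (b' := ((d:ℝ) - γ' - α) / 2)
    (by positivity) (by linarith) (by positivity) (by linarith) (by linarith) (by ring) (by nlinarith)
  rw [show γ / 2 + α / 2 = (γ + α) / 2 by ring, show γ' / 2 + α / 2 = (γ' + α) / 2 by ring,
    show ((d:ℝ) - γ - α) / 2 + α / 2 = (d - γ) / 2 by ring, show ((d:ℝ) - γ' - α) / 2 + α / 2 = (d - γ') / 2 by ring] at R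
  unfold kappa
  rw [div_lt_div_iff₀ (by positivity) (by positivity)]
  have := mul_lt_mul_of_pos_left R (show (0:ℝ) < 2 ^ α by positivity)
  linarith

lemma kappa_symm (α γ : ℝ) : kappa d α ((d:ℝ) - α - γ) = kappa d α γ := by
  unfold kappa
  rw [show (d:ℝ) - α - γ + α = d - γ by ring, show (d:ℝ) - (d - α - γ) = γ + α by ring,
    show γ + α - α = γ by ring, show (d:ℝ) - α - γ = d - γ - α by ring]
  ring

lemma pk_hyp {α : ℝ} (h : α ∈ Ioo (0:ℝ) (min 2 d)) : KernelHyp d α (kappa d α) (pk d α) := by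
  have hα := h.1
  have hα2 : α < 2 := lt_of_lt_of_le h.2 (min_le_left _ _)
  have hαd : α < d := lt_of_lt_of_le h.2 (min_le_right _ _)
  have hd : 0 < d := by
    have : (0:ℝ) < d := hα.trans hαd
    exact_mod_cast this
  exact {
    hα := h
    jm := pk_jm α
    ck := pk_ck hd hα hα2
    symm := pk_symm α
    mass := fun t ht x => pk_mass hd hα hα2 ht x
    up1 := pk_up1 hd hα hα2
    up2 := pk_up2 hd hα hα2
    low := pk_low hd hα hα2
    scal := fun l hl t ht x y => pk_scal l hl t x y
    hardy := pk_hardy hd hα hα2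
    kmono := fun γ γ' h1 h2 h3 => kappa_mono hα h1 h2 h3
    kpos := fun γ h1 h2 => kappa_pos hα h1 h2 }

end KappaSec



section PotSec
variable {d : ℕ}

/-- reflected Bessel integral -/
def BJ (ν r : ℝ) : ℝ := ∫ u in Ioi (0:ℝ), Real.exp (-u) * u ^ (ν - 1) * Real.exp (-(r ^ 2 / (4 * u)))

lemma bessel_BJ {ν r : ℝ} (hr : 0 < r) : besselK ν r = (1 / 2) * (r / 2) ^ (-ν) * BJ ν r := by
  have h1 : ∫ u in Ioi (0 : ℝ), u ^ (-ν - 1) * Real.exp (-u - r ^ 2 / (4 * u)) = (r / 2) ^ (-(2 * ν)) * BJ ν r := by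
    set c : ℝ := (r / 2) ^ 2 with hc
    have hc0 : 0 < c := by positivity
    have s1 := integral_comp_mul_left_Ioi (fun u : ℝ => u ^ (-ν - 1) * Real.exp (-u - r ^ 2 / (4 * u))) 0 hc0
    rw [mul_zero] at s1
    have s2 := integral_comp_rpow_Ioi (fun x : ℝ => (c * x) ^ (-ν - 1) * Real.exp (-(c * x) - r ^ 2 / (4 * (c * x)))) (p := -1) (by norm_num)
    have s3 : ∫ u in Ioi (0 : ℝ), u ^ (-ν - 1) * Real.exp (-u - r ^ 2 / (4 * u))
        = c * ∫ x in Ioi (0:ℝ), (c * x) ^ (-ν - 1) * Real.exp (-(c * x) - r ^ 2 / (4 * (c * x))) := by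
      rw [s1, smul_eq_mul, ← mul_assoc, mul_inv_cancel₀ hc0.ne', one_mul]
    rw [s3, ← s2, ← integral_const_mul]
    unfold BJ
    rw [← integral_const_mul]
    apply setIntegral_congr_fun measurableSet_Ioi
    intro x (hx : 0 < x)
    simp only [smul_eq_mul, abs_neg, abs_one, one_mul]
    have e1 : -(c * x ^ (-1:ℝ)) - r ^ 2 / (4 * (c * x ^ (-1:ℝ))) = -x + -(r ^ 2 / (4 * x)) := by
      rw [Real.rpow_neg_one, hc]; field_simp; ring
    rw [e1, Real.exp_add, Real.mul_rpow hc0.le (by positivity), ← Real.rpow_mul hx.le]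
    have e2 : c * c ^ (-ν - 1) = (r / 2) ^ (-(2 * ν)) := by
      have : c * c ^ (-ν - 1) = c ^ (1:ℝ) * c ^ (-ν - 1) := by rw [Real.rpow_one]
      rw [this, ← Real.rpow_add hc0, hc, ← Real.rpow_natCast, ← Real.rpow_mul (by positivity)]; congr 1; push_cast; ring
    have e3 : x ^ (-1 - 1:ℝ) * x ^ (-1 * (-ν - 1)) = x ^ (ν - 1) := by
      rw [← Real.rpow_add hx]; congr 1; ring
    rw [← e2, ← e3]; ring
  unfold besselK
  rw [h1, ← mul_assoc, mul_assoc (1/2:ℝ), ← Real.rpow_add (by positivity)]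
  congr 3; ring

lemma g_le_one (r : ℝ) {u : ℝ} (hu : 0 < u) : Real.exp (-(r ^ 2 / (4 * u))) ≤ 1 := by
  rw [Real.exp_le_one_iff]
  have : 0 ≤ r ^ 2 / (4 * u) := by positivity
  linarith

lemma BJ_int {ν : ℝ} (r : ℝ) (hν : 0 < ν) : IntegrableOn (fun u => Real.exp (-u) * u ^ (ν - 1) * Real.exp (-(r ^ 2 / (4 * u)))) (Ioi 0) := by
  refine Integrable.mono' (Real.GammaIntegral_convergent hν) (by fun_prop) ?_
  filter_upwards [ae_restrict_mem measurableSet_Ioi] with u (hu : 0 < u)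
  rw [Real.norm_of_nonneg (by positivity)]
  exact mul_le_of_le_one_right (by positivity) (g_le_one r hu)

lemma BJ_le {ν : ℝ} (r : ℝ) (hν : 0 < ν) : BJ ν r ≤ Real.Gamma ν := by
  rw [Real.Gamma_eq_integral hν]
  apply setIntegral_mono_on (BJ_int r hν) (Real.GammaIntegral_convergent hν) measurableSet_Ioi
  intro u (hu : 0 < u)
  exact mul_le_of_le_one_right (by positivity) (g_le_one r hu)

lemma BJ_ge {ν θ r : ℝ} (hr : 0 < r) (hν : 0 < ν) (hθ : 0 < θ) (hθ1 : θ ≤ 1) (hθν : θ < ν) :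
    Real.Gamma ν - (r / 2) ^ (2 * θ) * Real.Gamma (ν - θ) ≤ BJ ν r := by
  have hν' : 0 < ν - θ := by linarith
  have I1 := Real.GammaIntegral_convergent hν
  have I2 := (Real.GammaIntegral_convergent hν').const_mul ((r / 2) ^ (2 * θ))
  rw [Real.Gamma_eq_integral hν, Real.Gamma_eq_integral hν', ← integral_const_mul, ← integral_sub I1 I2]
  apply setIntegral_mono_on (I1.sub I2) (BJ_int r hν) measurableSet_Ioi
  intro u (hu : 0 < u)
  have e1 : (r / 2) ^ (2 * θ) * u ^ (ν - θ - 1) = u ^ (ν - 1) * (r ^ 2 / (4 * u)) ^ θ := by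
    rw [show r ^ 2 / (4 * u) = (r / 2) ^ 2 / u by field_simp; ring, Real.div_rpow (by positivity) hu.le,
      Real.rpow_mul (by positivity), Real.rpow_two, show ν - θ - 1 = (ν - 1) - θ by ring, Real.rpow_sub hu]
    field_simp
  have h2 : 1 - (r ^ 2 / (4 * u)) ^ θ ≤ Real.exp (-(r ^ 2 / (4 * u))) := by
    set x := r ^ 2 / (4 * u) with hx
    have hx0 : 0 < x := by positivity
    by_cases h : x ≤ 1
    · have := Real.rpow_le_rpow_of_exponent_ge hx0 h hθ1
      rw [Real.rpow_one] at this
      linarith [Real.add_one_le_exp (-x)]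
    · have := Real.one_le_rpow (le_of_not_ge h) hθ.le
      linarith [Real.exp_pos (-x)]
  calc _ = Real.exp (-u) * u ^ (ν - 1) * (1 - (r ^ 2 / (4 * u)) ^ θ) := by
        rw [mul_sub, mul_assoc _ _ ((r ^ 2 / (4 * u)) ^ θ), ← e1]; simp only [Pi.sub_apply]; ring
    _ ≤ _ := mul_le_mul_of_nonneg_left h2 (by positivity)

lemma BJ_pos' {ν r : ℝ} (hr : 0 < r) (hν : 0 < ν) : (r / 2) ^ ν / 2 * Real.exp (-(3 * r / 2)) ≤ BJ ν r := by
  have h0 : (r / 2) ^ ν / 2 * Real.exp (-(3 * r / 2)) = ∫ u in Ioo (r / 2) r, (r / 2) ^ ν / r * Real.exp (-(3 * r / 2)) := by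
    rw [setIntegral_const, Measure.real, Real.volume_Ioo, ENNReal.toReal_ofReal (by linarith), smul_eq_mul]
    field_simp; ring
  rw [h0]
  have hsub : Ioo (r / 2) r ⊆ Ioi 0 := fun u hu => lt_trans (by positivity : 0 < r / 2) hu.1
  calc _ ≤ ∫ u in Ioo (r / 2) r, Real.exp (-u) * u ^ (ν - 1) * Real.exp (-(r ^ 2 / (4 * u))) := by
        apply setIntegral_mono_on (integrableOn_const (by simp)) ((BJ_int r hν).mono_set hsub) measurableSet_Ioo
        intro u hu
        have hu0 : 0 < u := hsub hu
        have e : Real.exp (-(3 * r / 2)) = Real.exp (-r) * Real.exp (-(r / 2)) := by rw [← Real.exp_add]; congr 1; ring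
        rw [e]
        have h1 : Real.exp (-r) ≤ Real.exp (-u) := Real.exp_le_exp.2 (by linarith [hu.2])
        have h2 : Real.exp (-(r / 2)) ≤ Real.exp (-(r ^ 2 / (4 * u))) := by
          apply Real.exp_le_exp.2
          have : r ^ 2 / (4 * u) ≤ r / 2 := by
            rw [div_le_div_iff₀ (by positivity) two_pos]
            nlinarith [hu.1]
          linarith
        have h3 : (r / 2) ^ ν / r ≤ u ^ (ν - 1) := by
          rw [Real.rpow_sub_one hu0.ne']
          exact div_le_div₀ (by positivity) (Real.rpow_le_rpow (by positivity) hu.1.le hν.le) hu0 hu.2.le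
        calc (r / 2) ^ ν / r * (Real.exp (-r) * Real.exp (-(r / 2))) = Real.exp (-r) * ((r / 2) ^ ν / r) * Real.exp (-(r / 2)) := by ring
          _ ≤ _ := by gcongr
    _ ≤ _ := by
        apply setIntegral_mono_set (BJ_int r hν)
        · filter_upwards [ae_restrict_mem measurableSet_Ioi] with u (hu : 0 < u)
          simp only [Pi.zero_apply]; positivity
        · exact hsub.eventuallyLE

lemma BJ_cheb {ν s r : ℝ} (hν : 0 < ν) (hs : 0 < s) :
    Real.Gamma (ν + s) * BJ ν r ≤ Real.Gamma ν * BJ (ν + s) r := by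
  have g1 := Real.Gamma_pos_of_pos hν
  have hνs : 0 < ν + s := by linarith
  have g2 := Real.Gamma_pos_of_pos hνs
  set m : ℝ := (Real.Gamma (ν + s) / Real.Gamma ν) ^ s⁻¹ with hm
  have hm0 : 0 < m := by positivity
  have hms : m ^ s = Real.Gamma (ν + s) / Real.Gamma ν := by
    rw [hm, ← Real.rpow_mul (by positivity), inv_mul_cancel₀ hs.ne', Real.rpow_one]
  clear_value m
  have I1 := BJ_int r hνs
  have I2 := (BJ_int r hν).const_mul (m ^ s)
  have I3 := (Real.GammaIntegral_convergent hνs).const_mul (Real.exp (-(r ^ 2 / (4 * m))))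
  have I4 := (Real.GammaIntegral_convergent hν).const_mul (Real.exp (-(r ^ 2 / (4 * m))) * m ^ s)
  have key : 0 ≤ ∫ u in Ioi (0:ℝ), ((Real.exp (-u) * u ^ (ν + s - 1) * Real.exp (-(r ^ 2 / (4 * u)))
      - m ^ s * (Real.exp (-u) * u ^ (ν - 1) * Real.exp (-(r ^ 2 / (4 * u)))))
      - (Real.exp (-(r ^ 2 / (4 * m))) * (Real.exp (-u) * u ^ (ν + s - 1))
      - Real.exp (-(r ^ 2 / (4 * m))) * m ^ s * (Real.exp (-u) * u ^ (ν - 1)))) := by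
    apply setIntegral_nonneg measurableSet_Ioi
    intro u (hu : 0 < u)
    have e : u ^ (ν + s - 1) = u ^ (ν - 1) * u ^ s := by rw [← Real.rpow_add hu]; congr 1; ring
    rw [e]
    have : 0 ≤ (u ^ s - m ^ s) * (Real.exp (-(r ^ 2 / (4 * u))) - Real.exp (-(r ^ 2 / (4 * m)))) := by
      rcases le_total u m with h | h
      · apply mul_nonneg_of_nonpos_of_nonpos
        · linarith [Real.rpow_le_rpow hu.le h hs.le]
        · have : r ^ 2 / (4 * m) ≤ r ^ 2 / (4 * u) := by gcongr
          linarith [Real.exp_le_exp.2 (neg_le_neg this)]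
      · apply mul_nonneg
        · linarith [Real.rpow_le_rpow hm0.le h hs.le]
        · have : r ^ 2 / (4 * u) ≤ r ^ 2 / (4 * m) := by gcongr
          linarith [Real.exp_le_exp.2 (neg_le_neg this)]
    have h2 : 0 ≤ Real.exp (-u) * u ^ (ν - 1) := by positivity
    have := mul_nonneg h2 this
    linarith
  have I12 : IntegrableOn (fun u => Real.exp (-u) * u ^ (ν + s - 1) * Real.exp (-(r ^ 2 / (4 * u)))
      - m ^ s * (Real.exp (-u) * u ^ (ν - 1) * Real.exp (-(r ^ 2 / (4 * u))))) (Ioi 0) := I1.sub I2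
  have I34 : IntegrableOn (fun u => Real.exp (-(r ^ 2 / (4 * m))) * (Real.exp (-u) * u ^ (ν + s - 1))
      - Real.exp (-(r ^ 2 / (4 * m))) * m ^ s * (Real.exp (-u) * u ^ (ν - 1))) (Ioi 0) := I3.sub I4
  rw [integral_sub I12 I34, integral_sub I1 I2, integral_sub I3 I4, integral_const_mul, integral_const_mul, integral_const_mul,
    ← Real.Gamma_eq_integral hν, ← Real.Gamma_eq_integral hνs, hms] at key
  have e : Real.exp (-(r ^ 2 / (4 * m))) * Real.Gamma (ν + s) - Real.exp (-(r ^ 2 / (4 * m))) * (Real.Gamma (ν + s) / Real.Gamma ν) * Real.Gamma ν = 0 := by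
    field_simp; ring
  rw [e, sub_zero] at key
  change 0 ≤ BJ (ν + s) r - Real.Gamma (ν + s) / Real.Gamma ν * BJ ν r at key
  have := mul_nonneg g1.le key
  have e2 : Real.Gamma ν * (BJ (ν + s) r - Real.Gamma (ν + s) / Real.Gamma ν * BJ ν r) = Real.Gamma ν * BJ (ν + s) r - Real.Gamma (ν + s) * BJ ν r := by
    field_simp
  linarith

lemma BJ_large {ν s r0 : ℝ} (hν : 0 < ν) (hs : 0 < s) (hr0 : 0 < r0) :
    ∃ M > 0, ∀ r, r0 ≤ r → BJ (ν + s) r ≤ M * r ^ s * BJ ν r := by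
  have hνs : 0 < ν + s := by linarith
  have I5 : IntegrableOn (fun u : ℝ => u ^ (ν + s - 1) * Real.exp (-(1/2) * u)) (Ioi 0) := by
    have := integrableOn_rpow_mul_exp_neg_mul_rpow (p := 1) (s := ν + s - 1) (b := 1/2) (by linarith) one_pos (by norm_num)
    simpa using this
  set C := ∫ u in Ioi (0:ℝ), u ^ (ν + s - 1) * Real.exp (-(1/2) * u) with hC
  have hC0 : 0 ≤ C := by
    apply setIntegral_nonneg measurableSet_Ioi
    intro u (hu : 0 < u); positivity
  refine ⟨3 ^ s + C * 2 / ((r0 / 2) ^ ν * r0 ^ s), by positivity, ?_⟩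
  intro r hr
  have hr' : 0 < r := by linarith
  have hJ := BJ_pos' hr' hν
  have h1 : BJ (ν + s) r ≤ (3 * r) ^ s * BJ ν r + Real.exp (-(3 * r / 2)) * C := by
    have I2 := (BJ_int r hν).const_mul ((3 * r) ^ s)
    have I6 := I5.const_mul (Real.exp (-(3 * r / 2)))
    unfold BJ
    rw [hC, ← integral_const_mul, ← integral_const_mul, ← integral_add I2 I6]
    apply setIntegral_mono_on (BJ_int r hνs) (I2.add I6) measurableSet_Ioi
    intro u (hu : 0 < u)
    have e : u ^ (ν + s - 1) = u ^ (ν - 1) * u ^ s := by rw [← Real.rpow_add hu]; congr 1; ring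
    simp only [Pi.add_apply]
    rcases le_total u (3 * r) with h | h
    · have : Real.exp (-u) * u ^ (ν + s - 1) * Real.exp (-(r ^ 2 / (4 * u))) ≤ (3 * r) ^ s * (Real.exp (-u) * u ^ (ν - 1) * Real.exp (-(r ^ 2 / (4 * u)))) := by
        rw [e]
        have h3 := Real.rpow_le_rpow hu.le h hs.le
        have := mul_le_mul_of_nonneg_right h3 (show 0 ≤ Real.exp (-u) * u ^ (ν - 1) * Real.exp (-(r ^ 2 / (4 * u))) by positivity)
        linarith
      have h4 : 0 ≤ Real.exp (-(3 * r / 2)) * (u ^ (ν + s - 1) * Real.exp (-(1 / 2) * u)) := by positivity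
      linarith
    · have h4 : 0 ≤ (3 * r) ^ s * (Real.exp (-u) * u ^ (ν - 1) * Real.exp (-(r ^ 2 / (4 * u)))) := by positivity
      have h5 : Real.exp (-u) ≤ Real.exp (-(3 * r / 2)) * Real.exp (-(1 / 2) * u) := by
        rw [← Real.exp_add]; apply Real.exp_le_exp.2; linarith
      have h6 : Real.exp (-u) * u ^ (ν + s - 1) * Real.exp (-(r ^ 2 / (4 * u))) ≤ Real.exp (-u) * u ^ (ν + s - 1) :=
        mul_le_of_le_one_right (by positivity) (g_le_one r hu)
      have h7 := mul_le_mul_of_nonneg_right h5 (show 0 ≤ u ^ (ν + s - 1) by positivity)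
      linarith
  have h8 : Real.exp (-(3 * r / 2)) ≤ 2 / ((r0 / 2) ^ ν * r0 ^ s) * r ^ s * BJ ν r := by
    have h9 : (r0 / 2) ^ ν ≤ (r / 2) ^ ν := Real.rpow_le_rpow (by positivity) (by linarith) hν.le
    have h10 : r0 ^ s ≤ r ^ s := Real.rpow_le_rpow hr0.le hr hs.le
    have h11 : (r0 / 2) ^ ν / 2 * Real.exp (-(3 * r / 2)) ≤ BJ ν r := le_trans (by gcongr) hJ
    have h12 : r0 ^ s * ((r0 / 2) ^ ν / 2 * Real.exp (-(3 * r / 2))) ≤ r ^ s * BJ ν r :=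
      mul_le_mul h10 h11 (by positivity) (by positivity)
    rw [mul_assoc, div_mul_eq_mul_div, le_div_iff₀ (by positivity)]
    linarith
  have h13 := mul_le_mul_of_nonneg_right h8 hC0
  rw [Real.mul_rpow (by norm_num) hr'.le] at h1
  calc BJ (ν + s) r ≤ 3 ^ s * r ^ s * BJ ν r + 2 / ((r0 / 2) ^ ν * r0 ^ s) * r ^ s * BJ ν r * C := by linarith
    _ = _ := by ring

end PotSec



section PotSec2
variable {d : ℕ}

lemma BJ_pos {ν r : ℝ} (hr : 0 < r) (hν : 0 < ν) : 0 < BJ ν r :=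
  lt_of_lt_of_le (by positivity) (BJ_pos' hr hν)

lemma VProf_eq {α β r : ℝ} (hβ : 0 < β) (hr : 0 < r) :
    VProf d α β r = 2 ^ α * (Real.Gamma (((d:ℝ) - β) / 2) / Real.Gamma (((d:ℝ) - β - α) / 2)) * r ^ (-α)
      * (BJ (β / 2 + α / 2) r / BJ (β / 2) r) := by
  have hJ := BJ_pos hr (half_pos hβ)
  unfold VProf
  rw [bessel_BJ hr, bessel_BJ hr, show (β + α) / 2 = β / 2 + α / 2 by ring]
  have e1 : (r / 2) ^ (-(β / 2 + α / 2)) = (r / 2) ^ (-(β / 2)) * (r ^ (-(α / 2)) * 2 ^ (α / 2)) := by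
    rw [neg_add, Real.rpow_add (by positivity)]; congr 1
    rw [Real.div_rpow hr.le two_pos.le, Real.rpow_neg two_pos.le]; field_simp
  have e2 : (2:ℝ) ^ α = 2 ^ (α / 2) * 2 ^ (α / 2) := by rw [← Real.rpow_add two_pos]; congr 1; ring
  have e3 : r ^ (-α) = r ^ (-(α / 2)) * r ^ (-(α / 2)) := by rw [← Real.rpow_add hr]; congr 1; ring
  rw [e1, e2, e3]
  have : 0 < (r / 2) ^ (-(β / 2)) := by positivity
  generalize (r / 2) ^ (-(β / 2)) = X at *
  field_simp

lemma kappa_eq {α β : ℝ} :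
    kappa d α β = 2 ^ α * (Real.Gamma (((d:ℝ) - β) / 2) / Real.Gamma (((d:ℝ) - β - α) / 2)) * (Real.Gamma (β / 2 + α / 2) / Real.Gamma (β / 2)) := by
  unfold kappa
  rw [show (β + α) / 2 = β / 2 + α / 2 by ring]
  ring

lemma GG_pos {α β : ℝ} (hα : 0 < α) (hβ : β < (d:ℝ) - α) :
    0 < 2 ^ α * (Real.Gamma (((d:ℝ) - β) / 2) / Real.Gamma (((d:ℝ) - β - α) / 2)) := by
  have g3 := Real.Gamma_pos_of_pos (div_pos (by linarith : 0 < (d:ℝ) - β) two_pos)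
  have g4 := Real.Gamma_pos_of_pos (div_pos (by linarith : 0 < (d:ℝ) - β - α) two_pos)
  positivity

lemma VProf_ge {α β r : ℝ} (hα : 0 < α) (hβ : 0 < β) (hβd : β < (d:ℝ) - α) (hr : 0 < r) :
    kappa d α β * r ^ (-α) ≤ VProf d α β r := by
  have hJ := BJ_pos hr (half_pos hβ)
  have hG := GG_pos hα hβd
  have g := Real.Gamma_pos_of_pos (half_pos hβ)
  rw [VProf_eq hβ hr, kappa_eq, mul_right_comm]
  apply mul_le_mul_of_nonneg_left _ (by positivity)
  rw [div_le_div_iff₀ g hJ]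
  have := BJ_cheb (r := r) (half_pos hβ) (half_pos hα)
  linarith

lemma VProf_le {α β ε : ℝ} (hα : 0 < α) (hβ : 0 < β) (hβd : β < (d:ℝ) - α) (hε : 0 < ε) (hε2 : ε ≤ 2) (hεβ : ε < β) :
    ∃ A, 0 ≤ A ∧ ∀ r, 0 < r → VProf d α β r ≤ UU (kappa d α β) A α ε r := by
  have hG := GG_pos hα hβd
  have hκ := kappa_pos hα hβ hβd
  have g := Real.Gamma_pos_of_pos (half_pos hβ)
  have gs := Real.Gamma_pos_of_pos (add_pos (half_pos hβ) (half_pos hα))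
  have gθ := Real.Gamma_pos_of_pos (by linarith : 0 < β / 2 - ε / 2)
  set G := 2 ^ α * (Real.Gamma (((d:ℝ) - β) / 2) / Real.Gamma (((d:ℝ) - β - α) / 2)) with hGd
  set C : ℝ := (1 / 2) ^ ε * Real.Gamma (β / 2 - ε / 2) / Real.Gamma (β / 2) with hC
  have hC0 : 0 < C := by positivity
  set r0 : ℝ := (1 / (2 * C)) ^ ε⁻¹ with hr0
  have hr00 : 0 < r0 := by positivity
  have hr0e : r0 ^ ε = 1 / (2 * C) := by
    rw [hr0, ← Real.rpow_mul (by positivity), inv_mul_cancel₀ hε.ne', Real.rpow_one]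
  obtain ⟨M, hM, hL⟩ := BJ_large (half_pos hβ) (half_pos hα) hr00
  have hκe : kappa d α β = G * (Real.Gamma (β / 2 + α / 2) / Real.Gamma (β / 2)) := kappa_eq
  clear_value G C r0
  refine ⟨2 * C * kappa d α β + G * M, by positivity, ?_⟩
  intro r hr
  have hJ := BJ_pos hr (half_pos hβ)
  have p1 : 0 < r ^ (-α) := by positivity
  have p2 : 0 < r ^ (-(α - ε)) := by positivity
  have p3 : 0 < r ^ (-(α / 2)) := by positivity
  have e2 : r ^ (-(α - ε)) = r ^ (-α) * r ^ ε := by rw [← Real.rpow_add hr]; congr 1; ring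
  have e3 : r ^ (-(α / 2)) = r ^ (-α) * r ^ (α / 2) := by rw [← Real.rpow_add hr]; congr 1; ring
  rw [VProf_eq hβ hr, ← hGd]
  unfold UU
  have n1 : 0 ≤ 2 * C * kappa d α β * r ^ (-(α / 2)) := by positivity
  have n2 : 0 ≤ G * M * r ^ (-(α - ε)) := by positivity
  have n3 : 0 ≤ G * M * r ^ (-(α / 2)) := by positivity
  have n4 : 0 ≤ 2 * C * kappa d α β * r ^ (-(α - ε)) := by positivity
  have n5 : 0 ≤ kappa d α β * r ^ (-α) := by positivity
  rcases le_total r r0 with h | h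
  · have h1 : C * r ^ ε ≤ 1 / 2 := by
      have := Real.rpow_le_rpow hr.le h hε.le
      rw [hr0e] at this
      have h2 := mul_le_mul_of_nonneg_left this hC0.le
      have h3 : C * (1 / (2 * C)) = 1 / 2 := by field_simp
      linarith
    have h2 := BJ_le r (add_pos (half_pos hβ) (half_pos hα))
    have h3 := BJ_ge hr (half_pos hβ) (half_pos hε) (by linarith) (by linarith : ε / 2 < β / 2)
    have h4 : Real.Gamma (β / 2) * (1 - C * r ^ ε) ≤ BJ (β / 2) r := by
      refine le_trans (le_of_eq ?_) h3
      rw [hC, show 2 * (ε / 2) = ε by ring, show r / 2 = (1 / 2) * r by ring, Real.mul_rpow (by norm_num) hr.le]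
      field_simp
    have h5 : BJ (β / 2 + α / 2) r / BJ (β / 2) r ≤ Real.Gamma (β / 2 + α / 2) / Real.Gamma (β / 2) * (1 + 2 * (C * r ^ ε)) := by
      rw [div_le_iff₀ hJ]
      have y0 : 0 ≤ C * r ^ ε := by positivity
      have h6 : 1 ≤ (1 - C * r ^ ε) * (1 + 2 * (C * r ^ ε)) := by nlinarith
      have h7 := mul_le_mul_of_nonneg_left h4 (show 0 ≤ Real.Gamma (β / 2 + α / 2) / Real.Gamma (β / 2) * (1 + 2 * (C * r ^ ε)) by positivity)
      refine le_trans ?_ h7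
      have h8 : Real.Gamma (β / 2 + α / 2) / Real.Gamma (β / 2) * (1 + 2 * (C * r ^ ε)) * (Real.Gamma (β / 2) * (1 - C * r ^ ε))
          = Real.Gamma (β / 2 + α / 2) * ((1 - C * r ^ ε) * (1 + 2 * (C * r ^ ε))) := by field_simp
      rw [h8]
      nlinarith
    have h9 := mul_le_mul_of_nonneg_left h5 (show 0 ≤ G * r ^ (-α) by positivity)
    have h10 : G * r ^ (-α) * (Real.Gamma (β / 2 + α / 2) / Real.Gamma (β / 2) * (1 + 2 * (C * r ^ ε)))
        = kappa d α β * r ^ (-α) + 2 * C * kappa d α β * r ^ (-(α - ε)) := by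
      rw [e2, hκe]; ring
    linarith
  · have h1 := hL r h
    have h2 : BJ (β / 2 + α / 2) r / BJ (β / 2) r ≤ M * r ^ (α / 2) := by
      rw [div_le_iff₀ hJ]; exact h1
    have h9 := mul_le_mul_of_nonneg_left h2 (show 0 ≤ G * r ^ (-α) by positivity)
    have h10 : G * r ^ (-α) * (M * r ^ (α / 2)) = G * M * r ^ (-(α / 2)) := by rw [e3]; ring
    linarith

lemma besselK_meas (ν : ℝ) : Measurable (besselK ν) := by
  unfold besselK
  apply Measurable.mul (by fun_prop)
  apply StronglyMeasurable.measurable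
  apply StronglyMeasurable.integral_prod_right (f := fun r u : ℝ => u ^ (-ν - 1) * Real.exp (-u - r ^ 2 / (4 * u)))
  apply Measurable.stronglyMeasurable
  unfold Function.uncurry
  fun_prop

lemma Vbeta_meas (α β : ℝ) : Measurable (Vbeta d α β) := by
  unfold Vbeta VProf
  exact Measurable.mul (Measurable.mul measurable_const (((besselK_meas _).comp measurable_norm).div ((besselK_meas _).comp measurable_norm))) (by fun_prop)

end PotSec2



section TransferSec
variable {d : ℕ}

lemma pk_toReal {α t : ℝ} (hd : 0 < d) (hα : 0 < α) (hα2 : α < 2) (ht : 0 < t) (x y : Ed d) :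
    (pk d α t x y).toReal = fracKernel d α t x y := by
  rw [pk_eq, ENNReal.toReal_ofReal (KK_nonneg hd hα hα2 ht _)]; rfl

lemma PN_le_PT {α : ℝ} (q : Ed d → ℝ≥0∞) (n : ℕ) (t : ℝ) (x y : Ed d) :
    PN volume (pk d α) q n t x y ≤ PT volume (pk d α) q t x y := ENNReal.le_tsum n

lemma transferN {α T : ℝ} (hd : 0 < d) (hα : 0 < α) (hα2 : α < 2) {q : Ed d → ℝ} (hq : Measurable q)
    (hq0 : ∀ z, z ≠ 0 → 0 ≤ q z)
    (hfin : ∀ t, 0 < t → t ≤ T → ∀ x y : Ed d, x ≠ 0 → y ≠ 0 → PT volume (pk d α) (fun z => ENNReal.ofReal (q z)) t x y ≠ ∞)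
    (n : ℕ) : ∀ t, 0 < t → t ≤ T → ∀ x y : Ed d, x ≠ 0 → y ≠ 0 →
      pertN d (fracKernel d α) q n t x y = (PN volume (pk d α) (fun z => ENNReal.ofReal (q z)) n t x y).toReal := by
  have hQ : Measurable (fun z => ENNReal.ofReal (q z)) := hq.ennreal_ofReal
  induction n with
  | zero =>
    intro t ht _ x y _ _
    exact (pk_toReal hd hα hα2 ht x y).symm
  | succ n ih =>
    intro t ht htT x y hx hy
    have hPm := PN_JM volume (pk_jm (d := d) α) hQ n
    have hm : Measurable (fun w : ℝ × Ed d => PN volume (pk d α) (fun z => ENNReal.ofReal (q z)) n w.1 x w.2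
        * ENNReal.ofReal (q w.2) * pk d α (t - w.1) w.2 y) :=
      ((hPm.comp measurable_fst measurable_const measurable_snd).mul (hQ.comp measurable_snd)).mul
        ((pk_jm α).comp (measurable_const.sub measurable_fst) measurable_snd measurable_const)
    have hinner : ∀ s ∈ Ioo 0 t, ∫ z : Ed d, pertN d (fracKernel d α) q n s x z * q z * fracKernel d α (t - s) z y
        = (∫⁻ z, PN volume (pk d α) (fun z => ENNReal.ofReal (q z)) n s x z * ENNReal.ofReal (q z) * pk d α (t - s) z y).toReal := by
      intro s hs
      rw [← integral_toReal]
      · apply integral_congr_ae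
        filter_upwards [ae_ne0 hd] with z hz
        rw [ih s hs.1 (hs.2.le.trans htT) x z hx hz, ENNReal.toReal_mul, ENNReal.toReal_mul,
          pk_toReal hd hα hα2 (sub_pos.2 hs.2), ENNReal.toReal_ofReal (hq0 z hz)]
      · exact (hm.comp (measurable_const.prodMk measurable_id)).aemeasurable
      · filter_upwards [ae_ne0 hd] with z hz
        have h1 : PN volume (pk d α) (fun z => ENNReal.ofReal (q z)) n s x z ≠ ∞ :=
          ne_top_of_le_ne_top (hfin s hs.1 (hs.2.le.trans htT) x z hx hz) (PN_le_PT _ _ _ _ _)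
        have h2 : pk d α (t - s) z y ≠ ∞ := ENNReal.ofReal_ne_top
        exact lt_top_iff_ne_top.2 (ENNReal.mul_ne_top (ENNReal.mul_ne_top h1 ENNReal.ofReal_ne_top) h2)
    have e : pertN d (fracKernel d α) q (n + 1) t x y
        = ∫ s in Ioo (0:ℝ) t, ∫ z : Ed d, pertN d (fracKernel d α) q n s x z * q z * fracKernel d α (t - s) z y := rfl
    have hF : PN volume (pk d α) (fun z => ENNReal.ofReal (q z)) (n + 1) t x y ≠ ∞ :=
      ne_top_of_le_ne_top (hfin t ht htT x y hx hy) (PN_le_PT _ _ _ _ _)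
    rw [PN_succ] at hF
    rw [e, PN_succ, setIntegral_congr_fun measurableSet_Ioo hinner, integral_toReal]
    · exact (Measurable.lintegral_prod_right' hm).aemeasurable
    · exact ae_lt_top (Measurable.lintegral_prod_right' hm) hF

lemma transfer {α T : ℝ} (hd : 0 < d) (hα : 0 < α) (hα2 : α < 2) {q : Ed d → ℝ} (hq : Measurable q)
    (hq0 : ∀ z, z ≠ 0 → 0 ≤ q z)
    (hfin : ∀ t, 0 < t → t ≤ T → ∀ x y : Ed d, x ≠ 0 → y ≠ 0 → PT volume (pk d α) (fun z => ENNReal.ofReal (q z)) t x y ≠ ∞)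
    {t : ℝ} (ht : 0 < t) (htT : t ≤ T) {x y : Ed d} (hx : x ≠ 0) (hy : y ≠ 0) :
      pert d (fracKernel d α) q t x y = (PT volume (pk d α) (fun z => ENNReal.ofReal (q z)) t x y).toReal := by
  unfold pert PT
  rw [ENNReal.tsum_toReal_eq]
  · exact tsum_congr (fun n => transferN hd hα hα2 hq hq0 hfin n t ht htT x y hx hy)
  · intro n
    exact ne_top_of_le_ne_top (hfin t ht htT x y hx hy) (PN_le_PT _ _ _ _ _)

end TransferSec

/-- Comparability of the perturbations of the fractional kernel `p⁰` by `V⁰_δ` and by `V_δ`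
(Proposition 3.5). -/
theorem stmt_15 (d : ℕ) (α δ : ℝ) (hα : α ∈ Ioo 0 (min 2 (d : ℝ)))
    (hδ : δ ∈ Ioo 0 ((d : ℝ) - α)) (T : ℝ) (hT : 0 < T) :
    ∃ c : ℝ, 0 < c ∧ ∀ t ∈ Ioc (0 : ℝ) T, ∀ x y : Ed d, x ≠ 0 → y ≠ 0 →
      pert d (fracKernel d α) (fun z => kappa d α δ * ‖z‖ ^ (-α)) t x y ≤
          pert d (fracKernel d α) (Vbeta d α δ) t x y ∧
        pert d (fracKernel d α) (Vbeta d α δ) t x y ≤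
          c * pert d (fracKernel d α) (fun z => kappa d α δ * ‖z‖ ^ (-α)) t x y := by
  have hα0 := hα.1
  have hα2 : α < 2 := lt_of_lt_of_le hα.2 (min_le_left _ _)
  have hαd : α < d := lt_of_lt_of_le hα.2 (min_le_right _ _)
  have hd : 0 < d := by
    have : (0:ℝ) < d := hα0.trans hαd
    exact_mod_cast this
  obtain ⟨hδ0, hδd⟩ := hδ
  have hκ := kappa_pos hα0 hδ0 hδd
  -- reduction to the subcritical representative of the coupling constant
  obtain ⟨δ', h1, h2, h3, h4⟩ : ∃ δ' : ℝ, 0 < δ' ∧ δ' ≤ ((d:ℝ) - α) / 2 ∧ δ' ≤ δ ∧ kappa d α δ' = kappa d α δ := by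
    rcases le_total δ (((d:ℝ) - α) / 2) with h | h
    · exact ⟨δ, hδ0, h, le_rfl, rfl⟩
    · exact ⟨(d:ℝ) - α - δ, by linarith, by linarith, by linarith, kappa_symm α δ⟩
  obtain ⟨ε, hε, hε1, hε2⟩ : ∃ ε : ℝ, 0 < ε ∧ ε ≤ α / 2 ∧ ε < δ' :=
    ⟨min (α / 2) (δ' / 2), by positivity, min_le_left _ _, lt_of_le_of_lt (min_le_right _ _) (by linarith)⟩
  obtain ⟨A, hA, hV⟩ := VProf_le (d := d) hα0 hδ0 hδd hε (by linarith) (by linarith)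
  obtain ⟨c, hc, hP⟩ := (pk_hyp hα).part2 h1 h2 hε hε1 hε2 hA hT
  rw [h4] at hP
  have hq0 : q0 d α (kappa d α δ) = fun z => ENNReal.ofReal (kappa d α δ * ‖z‖ ^ (-α)) := by
    ext z; rw [ENNReal.ofReal_mul hκ.le]; rfl
  rw [hq0] at hP
  have hb : ∀ z : Ed d, z ≠ 0 → kappa d α δ * ‖z‖ ^ (-α) ≤ Vbeta d α δ z := fun z hz =>
    VProf_ge hα0 hδ0 hδd (norm_pos_iff.2 hz)
  have hb0 : ∀ z : Ed d, z ≠ 0 → 0 ≤ kappa d α δ * ‖z‖ ^ (-α) := fun z hz => by positivity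
  have hVb : ∀ z : Ed d, z ≠ 0 → ENNReal.ofReal (Vbeta d α δ z) ≤ ENNReal.ofReal (UU (kappa d α δ) A α ε ‖z‖) :=
    fun z hz => ENNReal.ofReal_le_ofReal (hV _ (norm_pos_iff.2 hz))
  have hm : ∀ t x y, PT volume (pk d α) (fun z => ENNReal.ofReal (kappa d α δ * ‖z‖ ^ (-α))) t x y
      ≤ PT volume (pk d α) (fun z => ENNReal.ofReal (Vbeta d α δ z)) t x y := by
    intro t x y
    apply PT_mono
    filter_upwards [ae_ne0 hd] with z hz
    exact ENNReal.ofReal_le_ofReal (hb z hz)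
  have hf1 : ∀ t, 0 < t → t ≤ T → ∀ x y : Ed d, x ≠ 0 → y ≠ 0 →
      PT volume (pk d α) (fun z => ENNReal.ofReal (Vbeta d α δ z)) t x y ≠ ∞ :=
    fun t ht htT x y hx hy => (hP _ hVb t ht htT x y hx hy).2
  have hf0 : ∀ t, 0 < t → t ≤ T → ∀ x y : Ed d, x ≠ 0 → y ≠ 0 →
      PT volume (pk d α) (fun z => ENNReal.ofReal (kappa d α δ * ‖z‖ ^ (-α))) t x y ≠ ∞ :=
    fun t ht htT x y hx hy => ne_top_of_le_ne_top (hf1 t ht htT x y hx hy) (hm t x y)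
  refine ⟨c, hc, ?_⟩
  rintro t ⟨ht, htT⟩ x y hx hy
  rw [transfer hd hα0 hα2 (Vbeta_meas α δ) (fun z hz => (hb0 z hz).trans (hb z hz)) hf1 ht htT hx hy,
    transfer hd hα0 hα2 (q := fun z => kappa d α δ * ‖z‖ ^ (-α)) (by fun_prop) hb0 hf0 ht htT hx hy]
  constructor
  · exact ENNReal.toReal_mono (hf1 t ht htT x y hx hy) (hm t x y)
  · have h := (hP _ hVb t ht htT x y hx hy).1
    have h5 := ENNReal.toReal_mono (ENNReal.mul_ne_top ENNReal.ofReal_ne_top (hf0 t ht htT x y hx hy)) h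
    rwa [ENNReal.toReal_mul, ENNReal.toReal_ofReal hc.le] at h5
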